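/- arXiv:1303.1424 — 9 statements merged into one kernel-verified Lean document; each statement's English description precedes it below -/
import Mathlib

section
/- For every x ∈ M, the set C_A(x) ∩ A contains at most one element; that is, if a, b ∈ C_A(x) and a, b ∈ A, then a = b. -/
/-- `C_A(x)`: the norm closure of the convex hull of `{u * x * u⋆ : u a unitary of A}`. -/
noncomputable def CA {H : Type*} [NormedAddCommGroup H] [InnerProductSpace ℂ H] [CompleteSpace H]
    (A : StarSubalgebra ℂ (H →L[ℂ] H)) (x : H →L[ℂ] H) : Set (H →L[ℂ] H) :=
  closure (convexHull ℝ {y | ∃ u ∈ A, star u * u = 1 ∧ u * star u = 1 ∧ y = u * x * star u})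

/-- Elements of the convex hull of a commuting set commute. -/
theorem commute_of_mem_convexHull {R : Type*} [Ring R] [Algebra ℝ R] {K : Set R}
    (hK : ∀ S ∈ K, ∀ T ∈ K, Commute S T) {S T : R}
    (hS : S ∈ convexHull ℝ K) (hT : T ∈ convexHull ℝ K) : Commute S T := by
  have hconv (T : R) : Convex ℝ {S : R | Commute S T} := fun S hS S' hS' a b _ _ _ =>
    (hS.smul_left a).add_left (hS'.smul_left b)
  refine convexHull_min (fun S hS => ?_) (hconv T) hS
  exact (convexHull_min (fun T hT => hK T hT S hS) (hconv S) hT).symm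

/-- The maps `z ↦ u * z * star u`, for `u` a unitary of `A`. -/
def unitaryConjugations {H : Type*} [NormedAddCommGroup H] [InnerProductSpace ℂ H]
    [CompleteSpace H] (A : StarSubalgebra ℂ (H →L[ℂ] H)) : Set (Module.End ℝ (H →L[ℂ] H)) :=
  {T | ∃ u ∈ A, star u * u = 1 ∧ u * star u = 1 ∧ T = LinearMap.mulLeftRight ℝ (u, star u)}

section Averaging

variable {H : Type*} [NormedAddCommGroup H] [InnerProductSpace ℂ H] [CompleteSpace H]
  {A : StarSubalgebra ℂ (H →L[ℂ] H)}

theorem commute_of_mem_unitaryConjugations (hA : ∀ a ∈ A, ∀ b ∈ A, a * b = b * a)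
    {S T : Module.End ℝ (H →L[ℂ] H)} (hS : S ∈ unitaryConjugations A)
    (hT : T ∈ unitaryConjugations A) : Commute S T := by
  obtain ⟨u, hu, -, -, rfl⟩ := hS
  obtain ⟨v, hv, -, -, rfl⟩ := hT
  refine LinearMap.ext fun z => ?_
  change u * (v * z * star v) * star u = v * (u * z * star u) * star v
  calc u * (v * z * star v) * star u = (u * v) * z * (star v * star u) := by noncomm_ring
    _ = (v * u) * z * (star u * star v) := by
      rw [hA u hu v hv, hA _ (star_mem hv) _ (star_mem hu)]
    _ = v * (u * z * star u) * star v := by noncomm_ring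

theorem apply_eq_self_of_mem_convexHull (hA : ∀ a ∈ A, ∀ b ∈ A, a * b = b * a)
    {T : Module.End ℝ (H →L[ℂ] H)} (hT : T ∈ convexHull ℝ (unitaryConjugations A))
    {c : H →L[ℂ] H} (hc : c ∈ A) : T c = c := by
  refine convexHull_min (t := {T : Module.End ℝ (H →L[ℂ] H) | T c = c}) ?_ ?_ hT
  · rintro _ ⟨u, hu, -, hu', rfl⟩
    change u * c * star u = c
    rw [hA u hu c hc, mul_assoc, hu', mul_one]
  · intro S hS S' hS' a b _ _ hab
    change a • S c + b • S' c = c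
    rw [hS, hS', ← add_smul, hab, one_smul]

theorem norm_apply_le_of_mem_convexHull {T : Module.End ℝ (H →L[ℂ] H)}
    (hT : T ∈ convexHull ℝ (unitaryConjugations A)) (z : H →L[ℂ] H) : ‖T z‖ ≤ ‖z‖ := by
  refine convexHull_min (t := {T : Module.End ℝ (H →L[ℂ] H) | ‖T z‖ ≤ ‖z‖}) ?_ ?_ hT
  · rintro _ ⟨u, hu, hu₁, hu₂, rfl⟩
    have h : u ∈ unitary (H →L[ℂ] H) := Unitary.mem_iff.mpr ⟨hu₁, hu₂⟩
    change ‖u * z * star u‖ ≤ ‖z‖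
    rw [CStarRing.norm_mul_mem_unitary _ (Unitary.star_mem h), CStarRing.norm_mem_unitary_mul _ h]
  · intro S hS S' hS' a b ha hb hab
    simpa using (convex_closedBall (0 : H →L[ℂ] H) ‖z‖) (x := S z) (by simpa using hS)
      (y := S' z) (by simpa using hS') ha hb hab

theorem exists_mem_convexHull_norm_apply_sub_lt {x c : H →L[ℂ] H} (hc : c ∈ CA A x) {ε : ℝ}
    (hε : 0 < ε) : ∃ T ∈ convexHull ℝ (unitaryConjugations A), ‖T x - c‖ < ε := by
  obtain ⟨y, hy, hyc⟩ := Metric.mem_closure_iff.mp hc ε hε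
  have horbit : {y | ∃ u ∈ A, star u * u = 1 ∧ u * star u = 1 ∧ y = u * x * star u} =
      LinearMap.applyₗ (R := ℝ) x '' unitaryConjugations A := by
    ext y
    constructor
    · rintro ⟨u, hu, hu₁, hu₂, rfl⟩
      exact ⟨_, ⟨u, hu, hu₁, hu₂, rfl⟩, rfl⟩
    · rintro ⟨_, ⟨u, hu, hu₁, hu₂, rfl⟩, rfl⟩
      exact ⟨u, hu, hu₁, hu₂, rfl⟩
  rw [horbit, ← LinearMap.image_convexHull] at hy
  obtain ⟨T, hT, rfl⟩ := hy
  exact ⟨T, hT, by simpa [dist_eq_norm, norm_sub_rev] using hyc⟩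

end Averaging

/-- If `A` is a MASA in a von Neumann algebra `M` and `x ∈ M`, then `C_A(x) ∩ A` contains at
most one element. -/
theorem stmt_0 {H : Type*} [NormedAddCommGroup H] [InnerProductSpace ℂ H] [CompleteSpace H]
    (M : VonNeumannAlgebra H) (A : StarSubalgebra ℂ (H →L[ℂ] H))
    (hMASA : ∀ y : H →L[ℂ] H, y ∈ A ↔ (y ∈ M ∧ ∀ a ∈ A, a * y = y * a))
    (x : H →L[ℂ] H) (hx : x ∈ M)
    (a b : H →L[ℂ] H) (haC : a ∈ CA A x) (haA : a ∈ A) (hbC : b ∈ CA A x) (hbA : b ∈ A) :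
    a = b := by
  have hA : ∀ a ∈ A, ∀ b ∈ A, a * b = b * a := fun a ha b hb => ((hMASA b).mp hb).2 a ha
  refine eq_of_forall_dist_le fun ε hε => ?_
  obtain ⟨T, hT, hTa⟩ := exists_mem_convexHull_norm_apply_sub_lt haC (half_pos hε)
  obtain ⟨S, hS, hSb⟩ := exists_mem_convexHull_norm_apply_sub_lt hbC (half_pos hε)
  have hcomm : S (T x) = T (S x) := LinearMap.congr_fun (commute_of_mem_convexHull
    (fun _ h _ h' => commute_of_mem_unitaryConjugations hA h h') hS hT) x
  have ha := norm_apply_le_of_mem_convexHull hS (T x - a)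
  have hb := norm_apply_le_of_mem_convexHull hT (S x - b)
  rw [map_sub, apply_eq_self_of_mem_convexHull hA hS haA, hcomm] at ha
  rw [map_sub, apply_eq_self_of_mem_convexHull hA hT hbA] at hb
  have htri := dist_triangle_left a b (T (S x))
  rw [dist_eq_norm (T (S x)), dist_eq_norm (T (S x))] at htri
  linarith
end

section
/- Let q₁, …, q_n be a finite partition of 1 in A, let λ = exp(2πi/n), and set w = Σ_{k=1}^n λ^{k-1} q_k. Then w is a unitary element of A, and for every x ∈ M one has (1/n) Σ_{j=0}^{n-1} w^j x (w*)^j = Σ_{k=1}^n q_k x q_k; in particular Σ_{k=1}^n q_k x q_k ∈ C_A(x). -/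
open scoped ComplexConjugate in
/-- Orthogonality of the characters `j ↦ ζ ^ (k * j)` of `ℤ / n`. -/
lemma IsPrimitiveRoot.geom_sum_pow_mul_conj_pow {n : ℕ} {ζ : ℂ} (hζ : IsPrimitiveRoot ζ n)
    (hconj : ζ * conj ζ = 1) (k l : Fin n) :
    ∑ j ∈ Finset.range n, (ζ ^ (k : ℕ)) ^ j * (conj ζ ^ (l : ℕ)) ^ j =
      if k = l then (n : ℂ) else 0 := by
  simp_rw [← mul_pow]
  split_ifs with h
  · subst h
    simp [← mul_pow, hconj]
  · have hne : ζ ^ (k : ℕ) * conj ζ ^ (l : ℕ) ≠ 1 := by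
      intro h1
      apply h
      apply Fin.ext
      apply hζ.pow_inj k.2 l.2
      calc ζ ^ (k : ℕ) = ζ ^ (k : ℕ) * (ζ * conj ζ) ^ (l : ℕ) := by rw [hconj]; simp
        _ = ζ ^ (k : ℕ) * conj ζ ^ (l : ℕ) * ζ ^ (l : ℕ) := by ring
        _ = ζ ^ (l : ℕ) := by rw [h1, one_mul]
    have hpow : (ζ ^ (k : ℕ) * conj ζ ^ (l : ℕ)) ^ n = 1 := by
      rw [mul_pow, ← pow_mul, ← pow_mul, mul_comm, mul_comm (l : ℕ), mul_comm (k : ℕ), pow_mul,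
        pow_mul, ← map_pow, hζ.pow_eq_one]
      simp
    rw [geom_sum_eq hne, hpow, sub_self, zero_div]

section OrthogonalIdempotents

variable {ι R : Type*} [Fintype ι] [Ring R] [Algebra ℂ R] {q : ι → R}

lemma OrthogonalIdempotents.sum_smul_mul_sum_smul (hq : OrthogonalIdempotents q) (c d : ι → ℂ) :
    (∑ k, c k • q k) * (∑ k, d k • q k) = ∑ k, (c k * d k) • q k := by
  classical
  simp [Finset.sum_mul_sum, hq.mul_eq, smul_smul, mul_comm]

lemma CompleteOrthogonalIdempotents.sum_smul_pow (hq : CompleteOrthogonalIdempotents q)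
    (c : ι → ℂ) (j : ℕ) : (∑ k, c k • q k) ^ j = ∑ k, (c k ^ j) • q k := by
  induction j with
  | zero => simp [hq.complete]
  | succ j ih =>
    rw [pow_succ, ih, hq.toOrthogonalIdempotents.sum_smul_mul_sum_smul]
    simp_rw [pow_succ]

end OrthogonalIdempotents

/-- The average of finitely many conjugates of `x` by unitaries of `A` lies in `C_A(x)`. -/
lemma inv_smul_sum_conj_pow_mem_CA {H : Type*} [NormedAddCommGroup H] [InnerProductSpace ℂ H]
    [CompleteSpace H] (A : StarSubalgebra ℂ (H →L[ℂ] H)) {w : H →L[ℂ] H} (hwA : w ∈ A)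
    (h1 : star w * w = 1) (h2 : w * star w = 1) {n : ℕ} (hn : n ≠ 0) (x : H →L[ℂ] H) :
    (n : ℂ)⁻¹ • ∑ j ∈ Finset.range n, w ^ j * x * (star w) ^ j ∈ CA A x := by
  apply subset_closure
  have hsmul : (n : ℂ)⁻¹ • ∑ j ∈ Finset.range n, w ^ j * x * (star w) ^ j =
      ∑ j ∈ Finset.range n, (n : ℝ)⁻¹ • (w ^ j * x * (star w) ^ j) := by
    rw [← Finset.smul_sum, ← Complex.coe_smul]
    simp
  rw [hsmul]
  refine (convex_convexHull ℝ _).sum_mem (fun _ _ => by positivity) ?_ fun j _ => ?_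
  · simp [hn]
  · have hu : w ^ j ∈ unitary (H →L[ℂ] H) := pow_mem (Unitary.mem_iff.2 ⟨h1, h2⟩) j
    exact subset_convexHull ℝ _ ⟨w ^ j, pow_mem hwA j, (Unitary.mem_iff.1 hu).1,
      (Unitary.mem_iff.1 hu).2, by rw [star_pow]⟩

/-- Given a finite partition of `1` in the MASA `A` by projections `q k`, `k = 0, …, n-1`, and
`w = ∑ λ^k • q k` with `λ = exp(2πi/n)`, the element `w` is a unitary of `A` and for every
`x ∈ M` one has `(1/n) ∑_{j<n} wʲ x (w⋆)ʲ = ∑ₖ qₖ x qₖ`; in particular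
`∑ₖ qₖ x qₖ ∈ C_A(x)`. -/
theorem stmt_1 {H : Type*} [NormedAddCommGroup H] [InnerProductSpace ℂ H] [CompleteSpace H]
    (M : VonNeumannAlgebra H) (A : StarSubalgebra ℂ (H →L[ℂ] H))
    (hMASA : ∀ y : H →L[ℂ] H, y ∈ A ↔ (y ∈ M ∧ ∀ a ∈ A, a * y = y * a))
    (n : ℕ) (hn : 1 ≤ n) (q : Fin n → (H →L[ℂ] H))
    (hqA : ∀ k, q k ∈ A) (hqsa : ∀ k, star (q k) = q k) (hqidem : ∀ k, q k * q k = q k)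
    (hqorth : ∀ k l, k ≠ l → q k * q l = 0) (hqsum : ∑ k, q k = 1)
    (w : H →L[ℂ] H)
    (hw : w = ∑ k : Fin n, (Complex.exp (2 * Real.pi * Complex.I / n)) ^ (k : ℕ) • q k) :
    (w ∈ A ∧ star w * w = 1 ∧ w * star w = 1) ∧
      ∀ x : H →L[ℂ] H, x ∈ M →
        ((n : ℂ)⁻¹ • ∑ j ∈ Finset.range n, w ^ j * x * (star w) ^ j = ∑ k, q k * x * q k) ∧
        (∑ k, q k * x * q k) ∈ CA A x := by
  have hn0 : n ≠ 0 := by omega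
  have hζ := Complex.isPrimitiveRoot_exp n hn0
  set ζ := Complex.exp (2 * Real.pi * Complex.I / n)
  have hconj : ζ * (starRingEnd ℂ) ζ = 1 := by
    rw [Complex.mul_conj', hζ.norm'_eq_one hn0]
    simp
  have hq : CompleteOrthogonalIdempotents q :=
    ⟨⟨fun k => hqidem k, fun k l h => hqorth k l h⟩, hqsum⟩
  have hsw : star w = ∑ k : Fin n, (starRingEnd ℂ) ζ ^ (k : ℕ) • q k := by
    simp [hw, star_sum, star_smul, hqsa]
  have hww : w * star w = 1 := by
    rw [hsw, hw, hq.toOrthogonalIdempotents.sum_smul_mul_sum_smul]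
    simp [← mul_pow, hconj, hqsum]
  have hww' : star w * w = 1 := by
    rw [hsw, hw, hq.toOrthogonalIdempotents.sum_smul_mul_sum_smul]
    simp [← mul_pow, mul_comm _ ζ, hconj, hqsum]
  have hwA : w ∈ A := hw ▸ sum_mem fun k _ => A.smul_mem (hqA k) _
  refine ⟨⟨hwA, hww', hww⟩, fun x _ => ?_⟩
  have key : (n : ℂ)⁻¹ • ∑ j ∈ Finset.range n, w ^ j * x * (star w) ^ j =
      ∑ k, q k * x * q k := by
    have hterm (j : ℕ) : w ^ j * x * (star w) ^ j = ∑ k : Fin n, ∑ l : Fin n,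
        ((ζ ^ (k : ℕ)) ^ j * ((starRingEnd ℂ) ζ ^ (l : ℕ)) ^ j) • (q k * x * q l) := by
      rw [hsw, hw, hq.sum_smul_pow, hq.sum_smul_pow, Finset.sum_mul, Finset.sum_mul_sum]
      simp_rw [smul_mul_assoc, mul_smul_comm, smul_smul]
    simp_rw [hterm]
    rw [Finset.sum_comm, Finset.smul_sum]
    refine Finset.sum_congr rfl fun k _ => ?_
    rw [Finset.sum_comm]
    simp_rw [← Finset.sum_smul, hζ.geom_sum_pow_mul_conj_pow hconj]
    simp [smul_smul, hn0]
  exact ⟨key, key ▸ inv_smul_sum_conj_pow_mem_CA A hwA hww' hww hn0 x⟩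
end

section
/- Assume that for every y ∈ M the set C_A(y) ∩ A is nonempty. Then for every x ∈ M and every ε > 0 there exist a finite partition of 1 in A by projections q₁, …, q_n and an element a ∈ C_A(x) ∩ A such that ‖Σ_{k=1}^n q_k x q_k − a‖ ≤ ε. -/
open scoped InnerProductSpace

section StarProjections

/-- Disjointification of finitely many commuting projections with supremum `1`. -/
theorem exists_orthogonal_refinement {R : Type*} [CommRing R] [StarRing R] {n : ℕ} (f : Fin n → R)
    (hf : ∀ i, IsStarProjection (f i)) (hcover : ∏ i, (1 - f i) = 0) :
    ∃ q : Fin n → R, (∀ i, IsStarProjection (q i)) ∧ (∀ i j, i ≠ j → q i * q j = 0) ∧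
      ∑ i, q i = 1 ∧ ∀ i, f i * q i = q i := by
  have hmul {a b : R} (ha : IsStarProjection a) (hb : IsStarProjection b) :
      IsStarProjection (a * b) := ha.mul hb (mul_comm a b)
  have hlt : ∀ i j, i < j →
      (f i * ∏ k with k < i, (1 - f k)) * (f j * ∏ k with k < j, (1 - f k)) = 0 := by
    intro i j hij
    rw [← Finset.mul_prod_erase (Finset.univ.filter (· < j)) (fun k ↦ 1 - f k) (a := i)
      (by simp [hij])]
    linear_combination (∏ k with k < i, (1 - f k)) * f j *
      (∏ k ∈ (Finset.univ.filter (· < j)).erase i, (1 - f k)) * (hf i).mul_one_sub_self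
  refine ⟨fun i ↦ f i * ∏ j with j < i, (1 - f j), fun i ↦ hmul (hf i) ?_, fun i j hij ↦ ?_, ?_,
    fun i ↦ ?_⟩
  · exact Finset.prod_induction _ IsStarProjection (fun _ _ ↦ hmul) (.one R) fun j _ ↦ (hf j).one_sub
  · rcases lt_or_gt_of_ne hij with h | h
    · exact hlt i j h
    · rw [mul_comm]; exact hlt j i h
  · have := Finset.prod_one_sub_ordered Finset.univ f
    rw [hcover] at this
    linear_combination this
  · rw [← mul_assoc, (hf i).isIdempotentElem.eq]

end StarProjections

section Operators

variable {H : Type*} [NormedAddCommGroup H] [InnerProductSpace ℂ H] [CompleteSpace H]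

/-- Existence of the range projection of a bounded operator. -/
theorem exists_range_projection (b : H →L[ℂ] H) :
    ∃ p : H →L[ℂ] H, IsStarProjection p ∧ p * b = b ∧
      ∀ S T : H →L[ℂ] H, S * b = T * b → S * p = T * p := by
  refine ⟨b.range.topologicalClosure.starProjection, isStarProjection_starProjection, ?_, ?_⟩
  · ext v
    exact Submodule.starProjection_eq_self_iff.2
      (b.range.le_topologicalClosure (LinearMap.mem_range_self _ v))
  · intro S T h
    ext v
    have hv := Submodule.starProjection_apply_mem b.range.topologicalClosure v
    have hclosed : IsClosed {w | S w = T w} := isClosed_eq S.continuous T.continuous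
    refine closure_minimal ?_ hclosed hv
    rintro _ ⟨w, rfl⟩
    exact congrArg (fun X : H →L[ℂ] H ↦ X w) h

theorem commute_range_projection {b p y : H →L[ℂ] H} (hp : IsStarProjection p) (hpb : p * b = b)
    (hext : ∀ S T : H →L[ℂ] H, S * b = T * b → S * p = T * p)
    (hy : Commute b y) (hy' : Commute b (star y)) : Commute p y := by
  have key : ∀ z, Commute b z → p * z * p = z * p := fun z hz ↦ hext _ _ <| by
    rw [mul_assoc, ← hz.eq, ← mul_assoc, hpb]
  have h := congrArg star (key _ hy')
  simp only [star_mul, star_star, hp.isSelfAdjoint.star_eq] at h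
  rw [Commute, SemiconjBy, ← h, ← mul_assoc, key _ hy]

/-- Approximate spectral projections of a normal operator. -/
theorem exists_approx_spectral_projections (u : H →L[ℂ] H) [IsStarNormal u] {δ : ℝ} (hδ : 0 < δ) :
    ∃ (t : Finset ℂ) (p : ℂ → H →L[ℂ] H), (∀ c ∈ t, c ∈ spectrum ℂ u) ∧
      (∀ c, IsStarProjection (p c)) ∧ (∀ c, ‖(u - algebraMap ℂ _ c) * p c‖ ≤ δ) ∧
      (∀ y, Commute u y → Commute (star u) y → ∀ c, Commute (p c) y) ∧
      ∀ r : H →L[ℂ] H, (∀ c ∈ t, p c * r = 0) → r = 0 := by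
  obtain ⟨t, htσ, htfin, htcover⟩ := (spectrum.isCompact (𝕜 := ℂ) u).finite_cover_balls hδ
  let f : ℂ → ℂ → ℂ := fun c z ↦ ((max 0 (δ - ‖z - c‖) : ℝ) : ℂ)
  have hf : ∀ c, Continuous (f c) := fun c ↦ by fun_prop
  let g : ℂ → ℂ → ℂ := fun c z ↦ ((δ / max δ ‖z - c‖ : ℝ) : ℂ) * (z - c)
  have hmax : ∀ z c : ℂ, 0 < max δ ‖z - c‖ := fun z c ↦ lt_max_of_lt_left hδ
  have hg : ∀ c, Continuous (g c) := fun c ↦ by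
    have : Continuous fun z : ℂ ↦ δ / max δ ‖z - c‖ :=
      continuous_const.div (by fun_prop) fun z ↦ (hmax z c).ne'
    fun_prop
  have hgnorm : ∀ c z, ‖g c z‖ ≤ δ := fun c z ↦ by
    rw [norm_mul, Complex.norm_real, Real.norm_of_nonneg (div_nonneg hδ.le (hmax z c).le),
      div_mul_eq_mul_div, div_le_iff₀ (hmax z c)]
    exact mul_le_mul_of_nonneg_left (le_max_right _ _) hδ.le
  have hgf : ∀ c z, g c z * f c z = (z - c) * f c z := fun c z ↦ by
    rcases le_total δ ‖z - c‖ with h | h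
    · simp [f, h]
    · simp [g, max_eq_left h, hδ.ne']
  have hsa : ∀ c, IsSelfAdjoint (cfc (f c) u) := fun c ↦ by
    rw [IsSelfAdjoint, ← cfc_star]
    congr 1
    ext z
    simp [f]
  choose p hp hpb hext using fun c ↦ exists_range_projection (cfc (f c) u)
  have hcomm : ∀ y, Commute u y → Commute (star u) y → ∀ c, Commute (cfc (f c) u) y :=
    fun y h h' c ↦ h.cfc h' _
  refine ⟨htfin.toFinset, p, fun c hc ↦ htσ (by simpa using hc), hp, fun c ↦ ?_,
    fun y hy hy' c ↦ commute_range_projection (hp c) (hpb c) (hext c) (hcomm y hy hy' c)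
      (hcomm _ (by simpa using hy'.star_star) (by simpa using hy.star_star) c), fun r hr ↦ ?_⟩
  · have hsub : u - algebraMap ℂ _ c = cfc (fun z ↦ z - c) u := by
      rw [cfc_sub .., cfc_id' .., cfc_const ..]
    have heq : (u - algebraMap ℂ _ c) * p c = cfc (g c) u * p c := by
      apply hext
      rw [hsub, ← cfc_mul _ _ u (by fun_prop) (hf c).continuousOn,
        ← cfc_mul _ _ u (hg c).continuousOn (hf c).continuousOn]
      congr 1
      ext z
      exact (hgf c z).symm
    rw [heq]
    calc ‖cfc (g c) u * p c‖ ≤ ‖cfc (g c) u‖ * ‖p c‖ := norm_mul_le _ _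
      _ ≤ δ * 1 := mul_le_mul (norm_cfc_le hδ.le fun z _ ↦ hgnorm c z) (hp c).norm_le
          (norm_nonneg _) hδ.le
      _ = δ := mul_one δ
  · have hbp : ∀ c, cfc (f c) u * p c = cfc (f c) u := fun c ↦ by
      simpa [(hp c).isSelfAdjoint.star_eq, (hsa c).star_eq] using congrArg star (hpb c)
    have hunit : IsUnit (cfc (∑ c ∈ htfin.toFinset, f c) u) := by
      refine isUnit_cfc _ u (by
        rw [Finset.sum_fn]
        exact (continuous_finsetSum _ fun c _ ↦ hf c).continuousOn) inferInstance fun z hz ↦ ?_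
      obtain ⟨c, hct, hzc⟩ := Set.mem_iUnion₂.1 (htcover hz)
      rw [Metric.mem_ball, dist_eq_norm] at hzc
      have hpos : 0 < ∑ c ∈ htfin.toFinset, max 0 (δ - ‖z - c‖) :=
        Finset.sum_pos' (fun _ _ ↦ le_max_left _ _)
          ⟨c, by simpa using hct, lt_max_of_lt_right (sub_pos.2 hzc)⟩
      simp only [Finset.sum_apply, f]
      exact_mod_cast hpos.ne'
    rw [← hunit.mul_right_eq_zero, cfc_sum _ _ _ fun c _ ↦ (hf c).continuousOn, Finset.sum_mul]
    refine Finset.sum_eq_zero fun c hc ↦ ?_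
    rw [← hbp c, mul_assoc, hr c hc, mul_zero]

/-- A family of mutually orthogonal projections in `A` with sum `1`. -/
structure IsProjectionPartition (A : StarSubalgebra ℂ (H →L[ℂ] H)) {ι : Type*} [Fintype ι]
    (q : ι → H →L[ℂ] H) : Prop where
  mem : ∀ k, q k ∈ A
  proj : ∀ k, IsStarProjection (q k)
  orthogonal : ∀ k l, k ≠ l → q k * q l = 0
  sum_eq_one : ∑ k, q k = 1

namespace IsProjectionPartition

variable {A : StarSubalgebra ℂ (H →L[ℂ] H)} {ι κ : Type*} [Fintype ι] [Fintype κ]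
  {q : ι → H →L[ℂ] H} {r : κ → H →L[ℂ] H}

theorem prod (hA : ∀ a ∈ A, ∀ b ∈ A, Commute a b) (hq : IsProjectionPartition A q)
    (hr : IsProjectionPartition A r) :
    IsProjectionPartition A fun k : ι × κ ↦ q k.1 * r k.2 where
  mem k := mul_mem (hq.mem _) (hr.mem _)
  proj k := (hq.proj _).mul (hr.proj _) (hA _ (hq.mem _) _ (hr.mem _))
  orthogonal := by
    rintro ⟨i, j⟩ ⟨i', j'⟩ h
    have hc : q i * r j * (q i' * r j') = (q i * q i') * (r j * r j') :=
      (hA _ (hr.mem j) _ (hq.mem i')).mul_mul_mul_comm _ _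
    rw [hc]
    by_cases hi : i = i'
    · rw [hr.orthogonal j j' (by rintro rfl; exact h (by rw [hi])), mul_zero]
    · rw [hq.orthogonal i i' hi, zero_mul]
  sum_eq_one := by
    rw [Fintype.sum_prod_type]
    simp only [← Finset.mul_sum, hr.sum_eq_one, mul_one, hq.sum_eq_one]

theorem reindex (e : κ ≃ ι) (hq : IsProjectionPartition A q) :
    IsProjectionPartition A (q ∘ e) where
  mem k := hq.mem _
  proj k := hq.proj _
  orthogonal k l h := hq.orthogonal _ _ (e.injective.ne h)
  sum_eq_one := by simpa using (e.sum_comp q).trans hq.sum_eq_one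

theorem norm_sum_apply_sq (hq : IsProjectionPartition A q) (w : ι → H) :
    ‖∑ k, q k (w k)‖ ^ 2 = ∑ k, ‖q k (w k)‖ ^ 2 := by
  have h : ∀ k l, k ≠ l → ⟪q k (w k), q l (w l)⟫_ℂ = 0 := fun k l hkl ↦ by
    rw [← ContinuousLinearMap.adjoint_inner_right, ← ContinuousLinearMap.star_eq_adjoint,
      (hq.proj k).isSelfAdjoint.star_eq, ← mul_apply_eq_comp, hq.orthogonal k l hkl]
    simp
  have : ((‖∑ k, q k (w k)‖ ^ 2 : ℝ) : ℂ) = ((∑ k, ‖q k (w k)‖ ^ 2 : ℝ) : ℂ) := by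
    push_cast
    have h2 (v : H) : (‖v‖ : ℂ) ^ 2 = ⟪v, v⟫_ℂ := (inner_self_eq_norm_sq_to_K v).symm
    simp only [h2, sum_inner, inner_sum]
    refine Finset.sum_congr rfl fun k _ ↦ Finset.sum_eq_single k (fun l _ hl ↦ ?_) (by simp)
    exact h _ _ hl
  exact_mod_cast this

theorem norm_sum_mul_mul_le (hq : IsProjectionPartition A q) (T : H →L[ℂ] H) {C : ℝ} (hC : 0 ≤ C)
    (hT : ∀ k, ‖q k * T * q k‖ ≤ C) : ‖∑ k, q k * T * q k‖ ≤ C := by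
  refine ContinuousLinearMap.opNorm_le_bound _ hC fun v ↦ ?_
  refine le_of_sq_le_sq ?_ (by positivity)
  have hsum := hq.norm_sum_apply_sq fun k ↦ T (q k v)
  have hv := hq.norm_sum_apply_sq fun _ ↦ v
  rw [← sum_apply, hq.sum_eq_one, one_apply_eq_self] at hv
  rw [sum_apply]
  simp only [mul_apply_eq_comp]
  rw [hsum, mul_pow, hv, Finset.mul_sum]
  refine Finset.sum_le_sum fun k _ ↦ ?_
  rw [← mul_pow]
  refine pow_le_pow_left₀ (norm_nonneg _) ?_ 2
  have hid : q k (q k v) = q k v :=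
    congrArg (fun X : H →L[ℂ] H ↦ X v) (hq.proj k).isIdempotentElem.eq
  have := ((q k * T * q k).le_opNorm (q k v)).trans
    (mul_le_mul_of_nonneg_right (hT k) (norm_nonneg _))
  simpa [hid] using this

end IsProjectionPartition

variable {A : StarSubalgebra ℂ (H →L[ℂ] H)}

/-- The set of operators whose difference with `x` has arbitrarily small pavings over `A`. -/
def pavedTo (A : StarSubalgebra ℂ (H →L[ℂ] H)) (x : H →L[ℂ] H) : Set (H →L[ℂ] H) :=
  {y | ∀ δ > (0 : ℝ), ∃ (n : ℕ) (q : Fin n → H →L[ℂ] H), IsProjectionPartition A q ∧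
    ∀ k, ‖q k * (y - x) * q k‖ ≤ δ}

theorem norm_projection_mul_mul_le {p : H →L[ℂ] H} (hp : IsStarProjection p) (T : H →L[ℂ] H) :
    ‖p * T * p‖ ≤ ‖T‖ :=
  calc ‖p * T * p‖ ≤ ‖p‖ * ‖T‖ * ‖p‖ := norm_mul₃_le
    _ ≤ 1 * ‖T‖ * 1 := by gcongr <;> exact hp.norm_le
    _ = ‖T‖ := by ring

theorem isClosed_pavedTo (x : H →L[ℂ] H) : IsClosed (pavedTo A x) := by
  refine isClosed_of_closure_subset fun y hy δ hδ ↦ ?_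
  obtain ⟨z, hz, hyz⟩ := Metric.mem_closure_iff.1 hy (δ / 2) (by positivity)
  obtain ⟨n, q, hq, hqz⟩ := hz (δ / 2) (by positivity)
  refine ⟨n, q, hq, fun k ↦ ?_⟩
  have hsplit : q k * (y - x) * q k = q k * (y - z) * q k + q k * (z - x) * q k := by
    noncomm_ring
  rw [hsplit]
  refine (norm_add_le _ _).trans ?_
  have := norm_projection_mul_mul_le (hq.proj k) (y - z)
  rw [dist_eq_norm] at hyz
  linarith [hqz k]

theorem convex_pavedTo (hA : ∀ a ∈ A, ∀ b ∈ A, Commute a b) (x : H →L[ℂ] H) :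
    Convex ℝ (pavedTo A x) := by
  intro y hy z hz a b ha hb hab δ hδ
  obtain ⟨n, q, hq, hqy⟩ := hy δ hδ
  obtain ⟨m, r, hr, hrz⟩ := hz δ hδ
  refine ⟨n * m, _, (hq.prod hA hr).reindex finProdFinEquiv.symm, fun k ↦ ?_⟩
  obtain ⟨⟨i, j⟩, rfl⟩ := finProdFinEquiv.surjective k
  simp only [Function.comp_apply, Equiv.symm_apply_apply]
  have hqr : q i * r j = r j * q i := hA _ (hq.mem i) _ (hr.mem j)
  have hx : a • y + b • z - x = a • (y - x) + b • (z - x) := by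
    rw [smul_sub, smul_sub, ← add_sub_add_comm, ← add_smul, hab, one_smul]
  have hsplit : q i * r j * (a • y + b • z - x) * (q i * r j) =
      a • (r j * (q i * (y - x) * q i) * r j) + b • (q i * (r j * (z - x) * r j) * q i) := by
    rw [hx, mul_add, add_mul]
    simp only [mul_smul_comm, smul_mul_assoc]
    congr 2
    · nth_rw 1 [hqr]; simp only [mul_assoc]
    · nth_rw 2 [hqr]; simp only [mul_assoc]
  rw [hsplit]
  calc _ ≤ ‖a • (r j * (q i * (y - x) * q i) * r j)‖ + ‖b • (q i * (r j * (z - x) * r j) * q i)‖ :=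
        norm_add_le _ _
    _ ≤ a * δ + b * δ := by
        rw [norm_smul, norm_smul, Real.norm_of_nonneg ha, Real.norm_of_nonneg hb]
        gcongr
        · exact (norm_projection_mul_mul_le (hr.proj j) _).trans (hqy i)
        · exact (norm_projection_mul_mul_le (hq.proj i) _).trans (hrz j)
    _ = δ := by rw [← add_mul, hab, one_mul]

theorem norm_compress_conj_sub_le {u x q : H →L[ℂ] H} {c : ℂ} {δ : ℝ} (hc : ‖c‖ = 1)
    (hu : ‖u‖ ≤ 1) (hq : IsStarProjection q) (huq : Commute u q)
    (h : ‖(u - algebraMap ℂ _ c) * q‖ ≤ δ) :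
    ‖q * (u * x * star u - x) * q‖ ≤ 2 * δ * ‖x‖ := by
  set d := (u - algebraMap ℂ (H →L[ℂ] H) c) * q with hd
  have huq' : q * star u = star (u * q) := by rw [star_mul, hq.isSelfAdjoint.star_eq]
  have hcc : star c * c = 1 := by
    rw [mul_comm, Complex.star_def, Complex.mul_conj, Complex.normSq_eq_norm_sq, hc]; simp
  have hduq : u * q = d + c • q := by
    rw [hd, sub_mul, ← Algebra.smul_def]; abel
  have hsq : star u * q = q * star u := by
    have := congrArg star huq.eq
    simpa [hq.isSelfAdjoint.star_eq] using this.symm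
  have hsplit : q * (u * x * star u - x) * q =
      d * x * star (u * q) + c • (q * x * star d) := by
    have h1 : q * (u * x * star u - x) * q = (u * q) * x * star (u * q) - q * x * q := by
      rw [← huq', huq.eq, mul_sub, sub_mul]
      simp only [mul_assoc, hsq]
    have h2 : q * x * q = (c • q) * x * star (c • q) := by
      rw [star_smul, hq.isSelfAdjoint.star_eq]
      simp only [smul_mul_assoc, mul_smul_comm, smul_smul]
      rw [hcc, one_smul]
    have h3 : star d = star (u * q) - star (c • q) := by rw [hduq, star_add]; abel
    have h4 : d = u * q - c • q := by rw [hduq]; abel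
    rw [h1, h2, h3, h4, sub_mul, sub_mul, mul_sub, smul_sub]
    simp only [smul_mul_assoc]
    abel
  rw [hsplit]
  have hδ : 0 ≤ δ := (norm_nonneg _).trans h
  have huqn : ‖star (u * q)‖ ≤ 1 := by
    rw [norm_star]
    exact (norm_mul_le _ _).trans (mul_le_one₀ hu (norm_nonneg _) hq.norm_le)
  calc _ ≤ ‖d * x * star (u * q)‖ + ‖c • (q * x * star d)‖ := norm_add_le _ _
    _ ≤ ‖d‖ * ‖x‖ * ‖star (u * q)‖ + ‖c‖ * (‖q‖ * ‖x‖ * ‖star d‖) := by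
        rw [norm_smul]; gcongr <;> exact norm_mul₃_le
    _ ≤ δ * ‖x‖ * 1 + 1 * (1 * ‖x‖ * δ) := by
        rw [hc, norm_star d]; gcongr; exact hq.norm_le
    _ = 2 * δ * ‖x‖ := by ring

/-- A unitary of a maximal abelian subalgebra is nearly scalar on each piece of a partition. -/
theorem exists_partition_near_scalar (M : VonNeumannAlgebra H)
    (hMASA : ∀ y : H →L[ℂ] H, y ∈ A ↔ (y ∈ M ∧ ∀ a ∈ A, a * y = y * a))
    {u : H →L[ℂ] H} (hu : u ∈ A) (hu₁ : star u * u = 1) (hu₂ : u * star u = 1)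
    {δ : ℝ} (hδ : 0 < δ) :
    ∃ (n : ℕ) (q : Fin n → H →L[ℂ] H) (c : Fin n → ℂ), IsProjectionPartition A q ∧
      ∀ k, ‖c k‖ = 1 ∧ ‖(u - algebraMap ℂ _ (c k)) * q k‖ ≤ δ := by
  have hA : ∀ a ∈ A, ∀ b ∈ A, a * b = b * a := fun a ha b hb ↦ ((hMASA b).1 hb).2 a ha
  have : IsStarNormal u := ⟨hu₁.trans hu₂.symm⟩
  obtain ⟨t, p, htσ, hp, hpu, hpcomm, hpcover⟩ := exists_approx_spectral_projections u hδ
  have hpA : ∀ c, p c ∈ A := fun c ↦ by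
    refine (hMASA _).2 ⟨?_, fun a ha ↦ (hpcomm a (hA _ hu _ ha) (hA _ (star_mem hu) _ ha) c).eq.symm⟩
    rw [← M.commutant_commutant, VonNeumannAlgebra.mem_commutant_iff]
    intro y hy
    rw [VonNeumannAlgebra.mem_commutant_iff] at hy
    exact (hpcomm y (hy u ((hMASA u).1 hu).1) (hy _ ((hMASA _).1 (star_mem hu)).1) c).eq.symm
  let _ : CommRing A := { (inferInstance : Ring A) with
    mul_comm := fun a b ↦ Subtype.ext (hA a a.2 b b.2) }
  let c : Fin t.card → ℂ := fun i ↦ t.equivFin.symm i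
  let f : Fin t.card → A := fun i ↦ ⟨p (c i), hpA _⟩
  have hf : ∀ i, IsStarProjection (f i) := fun i ↦
    ⟨Subtype.ext (hp _).isIdempotentElem.eq, Subtype.ext (hp _).isSelfAdjoint.star_eq⟩
  have hcover : ∏ i, (1 - f i) = 0 := by
    refine Subtype.ext (hpcover _ fun z hz ↦ ?_)
    have hmul : f (t.equivFin ⟨z, hz⟩) * ∏ i, (1 - f i) = 0 := by
      rw [← Finset.mul_prod_erase _ _ (Finset.mem_univ (t.equivFin ⟨z, hz⟩)), ← mul_assoc,
        (hf _).mul_one_sub_self, zero_mul]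
    simpa [f, c] using congrArg Subtype.val hmul
  obtain ⟨q, hq, hqorth, hqsum, hfq⟩ := exists_orthogonal_refinement f hf hcover
  refine ⟨t.card, fun k ↦ q k, c, ⟨fun k ↦ (q k).2, fun k ↦ ?_, fun k l hkl ↦ ?_, ?_⟩,
    fun k ↦ ⟨?_, ?_⟩⟩
  · exact ⟨congrArg Subtype.val (hq k).isIdempotentElem.eq,
      congrArg Subtype.val (hq k).isSelfAdjoint.star_eq⟩
  · exact congrArg Subtype.val (hqorth k l hkl)
  · have := congrArg A.subtype hqsum
    rw [map_sum] at this
    exact this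
  · have hmem : u ∈ unitary (H →L[ℂ] H) := ⟨hu₁, hu₂⟩
    simpa using spectrum.subset_circle_of_unitary hmem (htσ (c k) (t.equivFin.symm k).2)
  · have hpq : p (c k) * (q k : H →L[ℂ] H) = q k := congrArg Subtype.val (hfq k)
    have hqn : ‖(q k : H →L[ℂ] H)‖ ≤ 1 := IsStarProjection.norm_le (q k : H →L[ℂ] H)
      ⟨congrArg Subtype.val (hq k).isIdempotentElem.eq,
        congrArg Subtype.val (hq k).isSelfAdjoint.star_eq⟩
    calc ‖(u - algebraMap ℂ _ (c k)) * (q k : H →L[ℂ] H)‖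
        = ‖(u - algebraMap ℂ _ (c k)) * p (c k) * (q k : H →L[ℂ] H)‖ := by rw [mul_assoc, hpq]
      _ ≤ ‖(u - algebraMap ℂ _ (c k)) * p (c k)‖ * ‖(q k : H →L[ℂ] H)‖ := norm_mul_le _ _
      _ ≤ δ * 1 := mul_le_mul (hpu _) hqn (norm_nonneg _) hδ.le
      _ = δ := mul_one δ

theorem CA_subset_pavedTo (M : VonNeumannAlgebra H)
    (hMASA : ∀ y : H →L[ℂ] H, y ∈ A ↔ (y ∈ M ∧ ∀ a ∈ A, a * y = y * a)) (x : H →L[ℂ] H) :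
    CA A x ⊆ pavedTo A x := by
  have hA : ∀ a ∈ A, ∀ b ∈ A, Commute a b := fun a ha b hb ↦ ((hMASA b).1 hb).2 a ha
  refine closure_minimal (convexHull_min ?_ (convex_pavedTo hA x)) (isClosed_pavedTo x)
  rintro _ ⟨u, hu, hu₁, hu₂, rfl⟩ δ hδ
  have hx : 0 < 2 * (‖x‖ + 1) := by positivity
  obtain ⟨n, q, c, hq, hqc⟩ := exists_partition_near_scalar M hMASA hu hu₁ hu₂ (div_pos hδ hx)
  have hun : ‖u‖ ≤ 1 := by
    have h := CStarRing.norm_star_mul_self (x := u)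
    rw [hu₁] at h
    nlinarith [(IsStarProjection.one (H →L[ℂ] H)).norm_le, norm_nonneg u]
  refine ⟨n, q, hq, fun k ↦ ?_⟩
  refine (norm_compress_conj_sub_le (hqc k).1 hun (hq.proj k) (hA _ hu _ (hq.mem k))
    (hqc k).2).trans ?_
  rw [show 2 * (δ / (2 * (‖x‖ + 1))) * ‖x‖ = δ * (‖x‖ / (‖x‖ + 1)) by field_simp]
  exact mul_le_of_le_one_right hδ.le ((div_le_one (by positivity)).2 (by linarith))

end Operators

/-- If `C_A(y) ∩ A ≠ ∅` for every `y ∈ M`, then for every `x ∈ M` and every `ε > 0` there is a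
finite partition of `1` in `A` by projections `q k` and an element `a ∈ C_A(x) ∩ A` with
`‖∑ₖ qₖ x qₖ - a‖ ≤ ε`. -/
theorem stmt_2 {H : Type*} [NormedAddCommGroup H] [InnerProductSpace ℂ H] [CompleteSpace H]
    (M : VonNeumannAlgebra H) (A : StarSubalgebra ℂ (H →L[ℂ] H))
    (hMASA : ∀ y : H →L[ℂ] H, y ∈ A ↔ (y ∈ M ∧ ∀ a ∈ A, a * y = y * a))
    (hne : ∀ y ∈ M, (CA A y ∩ (A : Set (H →L[ℂ] H))).Nonempty) :
    ∀ x ∈ M, ∀ ε > (0 : ℝ), ∃ (n : ℕ) (q : Fin n → (H →L[ℂ] H)),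
      (∀ k, q k ∈ A) ∧ (∀ k, star (q k) = q k) ∧ (∀ k, q k * q k = q k) ∧
      (∀ k l, k ≠ l → q k * q l = 0) ∧ (∑ k, q k = 1) ∧
      ∃ a ∈ CA A x ∩ (A : Set (H →L[ℂ] H)), ‖(∑ k, q k * x * q k) - a‖ ≤ ε := by
  intro x hx ε hε
  obtain ⟨a, haC, haA⟩ := hne x hx
  obtain ⟨n, q, hq, hqa⟩ := CA_subset_pavedTo M hMASA x haC ε hε
  refine ⟨n, q, hq.mem, fun k ↦ (hq.proj k).isSelfAdjoint.star_eq,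
    fun k ↦ (hq.proj k).isIdempotentElem.eq, hq.orthogonal, hq.sum_eq_one, a, ⟨haC, haA⟩, ?_⟩
  have hdiag : ∑ k, q k * a * q k = a := by
    have hk : ∀ k, q k * a * q k = q k * a := fun k ↦ by
      rw [mul_assoc, ((hMASA (q k)).1 (hq.mem k)).2 a haA, ← mul_assoc,
        (hq.proj k).isIdempotentElem.eq]
    simp only [hk, ← Finset.sum_mul, hq.sum_eq_one, one_mul]
  have hsub : ∑ k, q k * x * q k - a = -∑ k, q k * (a - x) * q k := by
    simp only [mul_sub, sub_mul, Finset.sum_sub_distrib, hdiag, neg_sub]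
  rw [hsub, norm_neg]
  exact hq.norm_sum_mul_mul_le _ hε.le hqa
end

section
/- Let x ∈ M and suppose a ∈ C_A(x) ∩ A. Let E : M → M be any linear map with range contained in A such that ‖E(y)‖ ≤ ‖y‖ for all y ∈ M, E(b) = b for all b ∈ A, and E(b y c) = b E(y) c for all b, c ∈ A and y ∈ M. Then E(x) = a. In particular, if C_A(y) ∩ A is nonempty for every y ∈ M, then there is at most one such map E (the conditional expectation of M onto A is unique). -/
/-- `E : M → M` is a linear map with range in `A`, contractive, restricting to the identity on
`A`, and `A`-bimodular. -/
def IsCondExp {H : Type*} [NormedAddCommGroup H] [InnerProductSpace ℂ H] [CompleteSpace H]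
    (M : VonNeumannAlgebra H) (A : StarSubalgebra ℂ (H →L[ℂ] H))
    (E : (H →L[ℂ] H) → (H →L[ℂ] H)) : Prop :=
  (∀ y ∈ M, ∀ z ∈ M, E (y + z) = E y + E z) ∧
  (∀ (c : ℂ), ∀ y ∈ M, E (c • y) = c • E y) ∧
  (∀ y ∈ M, E y ∈ A) ∧
  (∀ y ∈ M, ‖E y‖ ≤ ‖y‖) ∧
  (∀ b ∈ A, E b = b) ∧
  (∀ b ∈ A, ∀ c ∈ A, ∀ y ∈ M, E (b * y * c) = b * E y * c)

section

variable {H : Type*} [NormedAddCommGroup H] [InnerProductSpace ℂ H] [CompleteSpace H]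
  {M : VonNeumannAlgebra H} {A : StarSubalgebra ℂ (H →L[ℂ] H)}
  {E : (H →L[ℂ] H) → (H →L[ℂ] H)}

/-- The fibres of a conditional expectation are convex. -/
theorem IsCondExp.convex_fiber (hE : IsCondExp M A E) (b : H →L[ℂ] H) :
    Convex ℝ {z | z ∈ M ∧ E z = b} := by
  obtain ⟨hadd, hsmul, -, -, -, -⟩ := hE
  rintro y ⟨hyM, hy⟩ z ⟨hzM, hz⟩ s t - - hst
  have smul_mem (c : ℂ) {w : H →L[ℂ] H} (hw : w ∈ M) : c • w ∈ M :=
    M.toStarSubalgebra.smul_mem hw c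
  rw [← Complex.coe_smul s y, ← Complex.coe_smul t z]
  refine ⟨add_mem (smul_mem _ hyM) (smul_mem _ hzM), ?_⟩
  rw [hadd _ (smul_mem _ hyM) _ (smul_mem _ hzM), hsmul _ _ hyM, hsmul _ _ hzM, hy, hz,
    ← add_smul, ← Complex.ofReal_add, hst, Complex.ofReal_one, one_smul]

/-- A conditional expectation onto a commutative algebra is constant on the convex hull of the
unitary orbit of `x`. -/
theorem IsCondExp.convexHull_subset_fiber (hE : IsCondExp M A E) (hAM : ∀ b ∈ A, b ∈ M)
    (hcomm : ∀ b ∈ A, ∀ c ∈ A, b * c = c * b) {x : H →L[ℂ] H} (hx : x ∈ M) :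
    convexHull ℝ {y | ∃ u ∈ A, star u * u = 1 ∧ u * star u = 1 ∧ y = u * x * star u} ⊆
      {z | z ∈ M ∧ E z = E x} := by
  refine convexHull_min ?_ (hE.convex_fiber _)
  obtain ⟨-, -, hrange, -, -, hbimod⟩ := hE
  rintro y ⟨u, hu, -, hu', rfl⟩
  have hsu : star u ∈ A := star_mem hu
  refine ⟨mul_mem (mul_mem (hAM u hu) hx) (hAM _ hsu), ?_⟩
  rw [hbimod u hu _ hsu x hx, hcomm u hu _ (hrange x hx), mul_assoc, hu', mul_one]

/-- A conditional expectation onto a commutative algebra `A` sends `x` to any element of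
`C_A(x) ∩ A`. -/
theorem IsCondExp.eq_of_mem_CA (hE : IsCondExp M A E) (hAM : ∀ b ∈ A, b ∈ M)
    (hcomm : ∀ b ∈ A, ∀ c ∈ A, b * c = c * b) {x a : H →L[ℂ] H} (hx : x ∈ M)
    (haC : a ∈ CA A x) (haA : a ∈ A) : E x = a := by
  have hfiber := hE.convexHull_subset_fiber hAM hcomm hx
  obtain ⟨hadd, -, -, hnorm, hid, -⟩ := hE
  refine (eq_of_forall_dist_le fun ε hε => ?_).symm
  obtain ⟨z, hz, hdist⟩ := Metric.mem_closure_iff.1 haC ε hε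
  obtain ⟨hzM, hEz⟩ := hfiber hz
  have hazM : a - z ∈ M := sub_mem (hAM a haA) hzM
  have hsub : E (a - z) = a - E x := by
    rw [← hEz, eq_sub_iff_add_eq, ← hadd _ hazM _ hzM, sub_add_cancel, hid a haA]
  rw [dist_eq_norm, ← hsub]
  exact (hnorm _ hazM).trans (dist_eq_norm a z ▸ hdist.le)

end

/-- If `a ∈ C_A(x) ∩ A` then any contractive `A`-bimodular projection `E` of `M` onto `A`
satisfies `E x = a`; in particular, if `C_A(y) ∩ A ≠ ∅` for all `y ∈ M`, such a conditional
expectation is unique. -/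
theorem stmt_3 {H : Type*} [NormedAddCommGroup H] [InnerProductSpace ℂ H] [CompleteSpace H]
    (M : VonNeumannAlgebra H) (A : StarSubalgebra ℂ (H →L[ℂ] H))
    (hMASA : ∀ y : H →L[ℂ] H, y ∈ A ↔ (y ∈ M ∧ ∀ a ∈ A, a * y = y * a))
    (x : H →L[ℂ] H) (hx : x ∈ M) (a : H →L[ℂ] H) (haC : a ∈ CA A x) (haA : a ∈ A) :
    (∀ E : (H →L[ℂ] H) → (H →L[ℂ] H), IsCondExp M A E → E x = a) ∧
    ((∀ y ∈ M, (CA A y ∩ (A : Set (H →L[ℂ] H))).Nonempty) →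
      ∀ E₁ E₂ : (H →L[ℂ] H) → (H →L[ℂ] H), IsCondExp M A E₁ → IsCondExp M A E₂ →
        ∀ y ∈ M, E₁ y = E₂ y) := by
  have hAM : ∀ b ∈ A, b ∈ M := fun b hb => ((hMASA b).1 hb).1
  have hcomm : ∀ b ∈ A, ∀ c ∈ A, b * c = c * b := fun b hb c hc => ((hMASA c).1 hc).2 b hb
  refine ⟨fun E hE => hE.eq_of_mem_CA hAM hcomm hx haC haA, fun h E₁ E₂ h₁ h₂ y hy => ?_⟩
  obtain ⟨b, hbC, hbA⟩ := h y hy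
  rw [h₁.eq_of_mem_CA hAM hcomm hy hbC hbA, h₂.eq_of_mem_CA hAM hcomm hy hbC hbA]
end

section
/- Let φ : M → ℂ be a state on M and let A ⊆ M be a commutative weakly closed unital *-subalgebra such that φ(p) ∈ {0, 1} for every projection p ∈ A. Then φ(a x) = φ(x a) for all a ∈ A and x ∈ M; consequently φ(u x u*) = φ(x) for every unitary u ∈ A and every x ∈ M, and φ(y) = φ(x) for every x ∈ M and every y ∈ C_A(x). -/
open scoped ComplexOrder

/-- The weak operator topology on `H →L[ℂ] H`: the topology induced by the maps
`T ↦ ⟪T x, y⟫`. -/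
noncomputable def wot (H : Type*) [NormedAddCommGroup H] [InnerProductSpace ℂ H] :
    TopologicalSpace (H →L[ℂ] H) :=
  TopologicalSpace.induced (fun T => fun xy : H × H => (@inner ℂ H _ (T xy.1) xy.2)) inferInstance

open Filter Topology

/-- The Cauchy-Schwarz degeneracy of a positive functional: a null vector is orthogonal to
everything. -/
theorem positive_functional_null_mul {E : Type*} [Ring E] [StarRing E] [Algebra ℂ E]
    [StarModule ℂ E] (B : StarSubalgebra ℂ E) (φ : E → ℂ)
    (hadd : ∀ x ∈ B, ∀ y ∈ B, φ (x + y) = φ x + φ y)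
    (hsmul : ∀ (c : ℂ), ∀ x ∈ B, φ (c • x) = c * φ x)
    (hpos : ∀ x ∈ B, 0 ≤ φ (star x * x)) {z : E} (hz : z ∈ B) (hz0 : φ (star z * z) = 0)
    {y : E} (hy : y ∈ B) : φ (y * z) = 0 ∧ φ (star z * y) = 0 := by
  have key : ∀ w ∈ B, φ (star w * z) = 0 ∧ φ (star z * w) = 0 := by
    intro w hw
    have hww := mul_mem (star_mem hw) hw
    have hwz := mul_mem (star_mem hw) hz
    have hzw := mul_mem (star_mem hz) hw
    have hzz := mul_mem (star_mem hz) hz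
    have expand : ∀ t : ℂ,
        0 ≤ φ (star w * w) + t * φ (star w * z) + star t * φ (star z * w) := by
      intro t
      have h := hpos (w + t • z) (add_mem hw (B.smul_mem hz t))
      have e : star (w + t • z) * (w + t • z) =
          (star w * w + t • (star w * z)) + (star t • (star z * w)
            + (star t * t) • (star z * z)) := by
        simp only [star_add, star_smul, add_mul, mul_add, smul_mul_assoc, mul_smul_comm,
          smul_add, mul_smul]
        rw [smul_comm t (star t)]
        abel
      rw [e, hadd _ (add_mem hww (B.smul_mem hwz _)) _
          (add_mem (B.smul_mem hzw _) (B.smul_mem hzz _)),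
        hadd _ hww _ (B.smul_mem hwz _), hadd _ (B.smul_mem hzw _) _ (B.smul_mem hzz _),
        hsmul _ _ hwz, hsmul _ _ hzw, hsmul _ _ hzz, hz0] at h
      simpa [add_assoc] using h
    generalize φ (star w * w) = r at expand
    generalize φ (star w * z) = α at expand ⊢
    generalize φ (star z * w) = β at expand ⊢
    have aux : ∀ γ : ℂ, (∀ s : ℝ, 0 ≤ r + s * γ) → γ = 0 := by
      intro γ h
      have hr := h 0
      have h1 := h 1
      simp only [Complex.le_def] at h hr h1
      simp at h hr h1
      apply Complex.ext
      · by_contra hne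
        have := (h (-(r.re + 1) / γ.re)).1
        rw [div_mul_cancel₀ _ hne] at this
        linarith
      · simp
        rw [← hr.2] at h1
        linarith [h1.2]
    have h1 : α + β = 0 := aux _ fun s => by
      have := expand s
      simp only [RCLike.star_def, Complex.conj_ofReal] at this
      rwa [add_assoc, ← mul_add] at this
    have h2 : Complex.I * (α - β) = 0 := aux _ fun s => by
      have := expand (s * Complex.I)
      simp only [RCLike.star_def, map_mul, Complex.conj_ofReal, Complex.conj_I] at this
      convert this using 1
      ring
    have h3 : α - β = 0 := by simpa using h2
    exact ⟨by linear_combination (h1 + h3) / 2, by linear_combination (h1 - h3) / 2⟩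
  exact ⟨by simpa using (key _ (star_mem hy)).1, (key _ hy).2⟩

section Projection

variable {H : Type*} [NormedAddCommGroup H] [InnerProductSpace ℂ H]

theorem continuous_wot_id :
    @Continuous (H →L[ℂ] H) (H →L[ℂ] H) inferInstance (wot H) id := by
  refine continuous_induced_rng.2 (continuous_pi fun xy => ?_)
  simp only [Function.comp_def, id]
  fun_prop

theorem isClosed_of_isClosed_wot {S : Set (H →L[ℂ] H)} (hS : @IsClosed _ (wot H) S) :
    IsClosed S :=
  @IsClosed.preimage _ _ _ (wot H) id continuous_wot_id S hS

theorem mem_of_tendsto_strong {S : Set (H →L[ℂ] H)} (hS : @IsClosed _ (wot H) S)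
    {T : ℕ → H →L[ℂ] H} {p : H →L[ℂ] H} (hT : ∀ n, T n ∈ S)
    (hlim : ∀ v, Tendsto (fun n => T n v) atTop (𝓝 (p v))) : p ∈ S := by
  refine @IsClosed.mem_of_tendsto _ (wot H) ℕ p S T atTop _ hS ?_ (Eventually.of_forall hT)
  rw [wot, nhds_induced, tendsto_comap_iff, tendsto_pi_nhds]
  intro xy
  exact (hlim xy.1).inner tendsto_const_nhds

variable [CompleteSpace H]

theorem mem_orthogonal_closure_range_iff {h : H →L[ℂ] H} (hh : IsSelfAdjoint h) {v : H} :
    v ∈ (h.range.topologicalClosure)ᗮ ↔ h v = 0 := by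
  rw [Submodule.orthogonal_closure, h.orthogonal_range, hh.adjoint_eq]
  simp

/-- The range projection of a self-adjoint element of a weakly closed unital *-subalgebra
belongs to the subalgebra. -/
theorem rangeProjection_mem (A : StarSubalgebra ℂ (H →L[ℂ] H))
    (hA : @IsClosed _ (wot H) (A : Set (H →L[ℂ] H))) {h : H →L[ℂ] H} (hmem : h ∈ A)
    (hh : IsSelfAdjoint h) : h.range.topologicalClosure.starProjection ∈ A := by
  have hcl : IsClosed (A : Set (H →L[ℂ] H)) := isClosed_of_isClosed_wot hA
  set K := h.range.topologicalClosure with hK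
  have hden : ∀ (n : ℕ) (t : ℝ), 1 + (n : ℝ) ^ 2 * t ^ 2 ≠ 0 := fun n t => by positivity
  let f : ℕ → ℝ → ℝ := fun n t => (n : ℝ) ^ 2 * t / (1 + (n : ℝ) ^ 2 * t ^ 2)
  have hf : ∀ n, Continuous (f n) := fun n =>
    Continuous.div (by fun_prop) (by fun_prop) (hden n)
  let T : ℕ → H →L[ℂ] H := fun n => cfc (f n) h * h
  have hid : cfc (fun t : ℝ => t) h = h := cfc_id' ℝ h
  have hTcfc : ∀ n, T n = cfc (fun t => f n t * t) h := fun n => by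
    rw [cfc_mul (f n) (fun t => t) h (hf n).continuousOn continuousOn_id, hid]
  have hTnorm : ∀ n, ‖T n‖ ≤ 1 := fun n => by
    rw [hTcfc]
    refine norm_cfc_le zero_le_one fun t _ => ?_
    have e : f n t * t = (n : ℝ) ^ 2 * t ^ 2 / (1 + (n : ℝ) ^ 2 * t ^ 2) := by
      simp only [f]
      ring
    rw [e, Real.norm_of_nonneg (by positivity)]
    exact div_le_one_of_le₀ (by linarith) (by positivity)
  have hTh : ∀ n : ℕ, 0 < n → ‖T n * h - h‖ ≤ 1 / n := fun n hn => by
    have e : T n * h - h = cfc (fun t => f n t * t * t - t) h := by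
      rw [cfc_sub (fun t => f n t * t * t) (fun t => t) h
          (((hf n).mul continuous_id).mul continuous_id).continuousOn continuousOn_id,
        cfc_mul (fun t => f n t * t) (fun t => t) h
          ((hf n).mul continuous_id).continuousOn continuousOn_id, hid, ← hTcfc]
    rw [e]
    refine norm_cfc_le (by positivity) fun t _ => ?_
    have hn' : (0 : ℝ) < n := by exact_mod_cast hn
    have e : f n t * t * t - t = -t / (1 + (n : ℝ) ^ 2 * t ^ 2) := by
      simp only [f]
      have := hden n t
      field_simp
      ring
    rw [e, norm_div, norm_neg, Real.norm_eq_abs, Real.norm_of_nonneg (by positivity),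
      div_le_div_iff₀ (by positivity) hn', ← sq_abs t]
    nlinarith [sq_nonneg ((n : ℝ) * |t| - 1), sq_nonneg ((n : ℝ) * |t|)]
  refine mem_of_tendsto_strong (T := T) hA (fun n => mul_mem ?_ hmem) fun v => ?_
  · have := hcl
    exact cfc_mem (f n) hmem
  · have hv : h (v - K.starProjection v) = 0 :=
      (mem_orthogonal_closure_range_iff hh).1 (K.sub_starProjection_mem_orthogonal v)
    have hTv : ∀ n, T n v = T n (K.starProjection v) := fun n => by
      have : T n (v - K.starProjection v) = 0 := by
        simp only [T, mul_apply_eq_comp, hv, map_zero]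
      rwa [map_sub, sub_eq_zero] at this
    simp only [hTv]
    have hu : K.starProjection v ∈ K := K.starProjection_apply_mem v
    generalize K.starProjection v = u at hu
    rw [Metric.tendsto_atTop]
    intro ε hε
    obtain ⟨_, ⟨w, rfl⟩, hw⟩ := Metric.mem_closure_iff.1 hu (ε / 3) (by positivity)
    obtain ⟨N, hN⟩ := exists_nat_gt (‖w‖ / (ε / 3))
    refine ⟨N + 1, fun n hn => ?_⟩
    have hn0 : 0 < n := by omega
    have hn' : (0 : ℝ) < n := by exact_mod_cast hn0
    have hNn : (N : ℝ) ≤ n := by exact_mod_cast (by omega : N ≤ n)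
    rw [dist_eq_norm] at hw ⊢
    have e : T n u - u = T n (u - h w) + (T n * h - h) w + -(u - h w) := by
      simp only [map_sub, mul_apply_eq_comp, sub_apply]
      abel
    have b1 : ‖T n (u - h w)‖ ≤ ‖u - h w‖ := by
      simpa using (T n).le_of_opNorm_le (hTnorm n) (u - h w)
    have b2 : ‖(T n * h - h) w‖ < ε / 3 := by
      refine (ContinuousLinearMap.le_of_opNorm_le _ (hTh n hn0) w).trans_lt ?_
      rw [div_lt_iff₀ (by positivity)] at hN
      rw [one_div_mul_eq_div, div_lt_iff₀ hn']
      nlinarith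
    have hw' : ‖u - h w‖ < ε / 3 := hw
    rw [e]
    have := norm_add₃_le (a := T n (u - h w)) (b := (T n * h - h) w) (c := -(u - h w))
    rw [norm_neg] at this
    linarith

end Projection

/-- A self-adjoint element splits as a difference of squares of two self-adjoint elements with
product zero. -/
theorem exists_sq_sub_sq {H : Type*} [NormedAddCommGroup H] [InnerProductSpace ℂ H]
    [CompleteSpace H] (A : StarSubalgebra ℂ (H →L[ℂ] H)) (hcl : IsClosed (A : Set (H →L[ℂ] H)))
    {b : H →L[ℂ] H} (hb : b ∈ A) (hbs : IsSelfAdjoint b) :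
    ∃ c ∈ A, ∃ d ∈ A, IsSelfAdjoint c ∧ IsSelfAdjoint d ∧ c * d = 0 ∧ b = c * c - d * d := by
  have := hcl
  let f : ℝ → ℝ := fun t => √(max t 0)
  let g : ℝ → ℝ := fun t => √(max (-t) 0)
  have hf : Continuous f := by fun_prop
  have hg : Continuous g := by fun_prop
  refine ⟨cfc f b, cfc_mem f hb, cfc g b, cfc_mem g hb, cfc_predicate f b, cfc_predicate g b,
    ?_, ?_⟩
  · rw [← cfc_mul f g b hf.continuousOn hg.continuousOn]
    have : (fun t => f t * g t) = fun _ => 0 := by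
      funext t
      simp only [f, g]
      rcases le_total t 0 with h | h <;> simp [h]
    rw [this, cfc_const_zero]
  · rw [← cfc_mul f f b hf.continuousOn hf.continuousOn,
      ← cfc_mul g g b hg.continuousOn hg.continuousOn,
      ← cfc_sub (fun t => f t * f t) (fun t => g t * g t) b (hf.mul hf).continuousOn
        (hg.mul hg).continuousOn]
    have : (fun t => f t * f t - g t * g t) = fun t => t := by
      funext t
      simp only [f, g]
      rw [Real.mul_self_sqrt (le_max_right _ _), Real.mul_self_sqrt (le_max_right _ _)]
      rcases le_total t 0 with h | h <;> simp [h]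
    rw [this, cfc_id' ℝ b]

/-- A positive functional that is two-valued on the projections of a weakly closed *-subalgebra
`A` annihilates `b * x` and `x * b` for every self-adjoint `b ∈ A` in its kernel. -/
theorem mul_eq_zero_of_selfAdjoint {H : Type*} [NormedAddCommGroup H] [InnerProductSpace ℂ H]
    [CompleteSpace H] (B A : StarSubalgebra ℂ (H →L[ℂ] H)) (hAB : ∀ a ∈ A, a ∈ B)
    (hA : @IsClosed _ (wot H) (A : Set (H →L[ℂ] H))) (φ : (H →L[ℂ] H) → ℂ)
    (hadd : ∀ x ∈ B, ∀ y ∈ B, φ (x + y) = φ x + φ y)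
    (hsmul : ∀ (c : ℂ), ∀ x ∈ B, φ (c • x) = c * φ x)
    (hone : φ 1 = 1)
    (hpos : ∀ x ∈ B, 0 ≤ φ (star x * x))
    (hproj : ∀ p ∈ A, star p = p → p * p = p → φ p = 0 ∨ φ p = 1)
    {b : H →L[ℂ] H} (hb : b ∈ A) (hbs : IsSelfAdjoint b) (hb0 : φ b = 0)
    {x : H →L[ℂ] H} (hx : x ∈ B) : φ (b * x) = 0 ∧ φ (x * b) = 0 := by
  have null : ∀ z ∈ B, star z = z → φ (z * z) = 0 → ∀ y ∈ B, φ (y * z) = 0 ∧ φ (z * y) = 0 := by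
    intro z hz hzs hz0 y hy
    have := positive_functional_null_mul B φ hadd hsmul hpos hz (by rwa [hzs]) hy
    rwa [hzs] at this
  have hsub : ∀ x ∈ B, ∀ y ∈ B, φ (x - y) = φ x - φ y := by
    intro x hx y hy
    have h := hadd _ (sub_mem hx hy) _ hy
    rw [sub_add_cancel] at h
    exact eq_sub_of_add_eq h.symm
  obtain ⟨c, hc, d, hd, hcs, hds, hcd, rfl⟩ :=
    exists_sq_sub_sq A (isClosed_of_isClosed_wot hA) hb hbs
  have hcB := hAB _ hc
  have hdB := hAB _ hd
  have hccB := mul_mem hcB hcB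
  have hddB := mul_mem hdB hdB
  have hdiff : φ (c * c) = φ (d * d) := by
    rw [hsub _ hccB _ hddB] at hb0
    exact sub_eq_zero.1 hb0
  set K := c.range.topologicalClosure with hK
  set p : H →L[ℂ] H := K.starProjection with hp
  have hpA : p ∈ A := rangeProjection_mem A hA hc hcs
  have hpp : p * p = p := K.isIdempotentElem_starProjection
  have hps : star p = p := isSelfAdjoint_starProjection K
  have hpc : p * c = c := by
    ext v
    exact K.starProjection_eq_self_iff.2 (Submodule.le_topologicalClosure _ ⟨v, rfl⟩)
  have hpd : p * d = 0 := by
    ext v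
    refine (K.starProjection_apply_eq_zero_iff).2 ((mem_orthogonal_closure_range_iff hcs).2 ?_)
    exact congrArg (fun T : H →L[ℂ] H => T v) hcd
  have hboth : φ (c * c) = 0 ∧ φ (d * d) = 0 := by
    rcases hproj p hpA hps hpp with h | h
    · have h1 := (null p (hAB _ hpA) hps (by rwa [hpp]) _ hccB).2
      rw [← mul_assoc, hpc] at h1
      exact ⟨h1, hdiff ▸ h1⟩
    · have hqB : 1 - p ∈ B := sub_mem (one_mem _) (hAB _ hpA)
      have hqq : (1 - p) * (1 - p) = 1 - p := by
        simp [mul_sub, sub_mul, hpp]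
      have hq0 : φ ((1 - p) * (1 - p)) = 0 := by
        rw [hqq, hsub _ (one_mem _) _ (hAB _ hpA), hone, h, sub_self]
      have h1 := (null (1 - p) hqB (by simp [hps]) hq0 _ hddB).2
      rw [← mul_assoc, sub_mul, hpd, one_mul, sub_zero] at h1
      exact ⟨hdiff ▸ h1, h1⟩
  have h1 := null c hcB hcs hboth.1
  have h2 := null d hdB hds hboth.2
  constructor
  · rw [sub_mul, hsub _ (mul_mem hccB hx) _ (mul_mem hddB hx), mul_assoc, mul_assoc,
      (h1 _ (mul_mem hcB hx)).2, (h2 _ (mul_mem hdB hx)).2, sub_zero]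
  · rw [mul_sub, hsub _ (mul_mem hx hccB) _ (mul_mem hx hddB), ← mul_assoc, ← mul_assoc,
      (h1 _ (mul_mem hx hcB)).1, (h2 _ (mul_mem hx hdB)).1, sub_zero]

/-- If `φ` is a state on the von Neumann algebra `M` and `A ⊆ M` is a commutative weakly
closed unital *-subalgebra with `φ(p) ∈ {0,1}` for every projection `p ∈ A`, then `A` lies in
the centralizer of `φ`: `φ(ax) = φ(xa)`, `φ(u x u⋆) = φ(x)` for unitaries `u ∈ A`, and `φ` is
constant on `C_A(x)` for every `x ∈ M`. -/
theorem stmt_4 {H : Type*} [NormedAddCommGroup H] [InnerProductSpace ℂ H] [CompleteSpace H]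
    (M : VonNeumannAlgebra H) (A : StarSubalgebra ℂ (H →L[ℂ] H))
    (hAM : (A : Set (H →L[ℂ] H)) ⊆ (M : Set (H →L[ℂ] H)))
    (hAclosed : @IsClosed _ (wot H) (A : Set (H →L[ℂ] H)))
    (hAcomm : ∀ a ∈ A, ∀ b ∈ A, a * b = b * a)
    (φ : (H →L[ℂ] H) → ℂ)
    (hadd : ∀ x ∈ M, ∀ y ∈ M, φ (x + y) = φ x + φ y)
    (hsmul : ∀ (c : ℂ), ∀ x ∈ M, φ (c • x) = c * φ x)
    (hcont : ContinuousOn φ (M : Set (H →L[ℂ] H)))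
    (hone : φ 1 = 1)
    (hpos : ∀ x ∈ M, 0 ≤ φ (star x * x))
    (hproj : ∀ p ∈ A, star p = p → p * p = p → φ p = 0 ∨ φ p = 1) :
    (∀ a ∈ A, ∀ x ∈ M, φ (a * x) = φ (x * a)) ∧
    (∀ u ∈ A, star u * u = 1 → u * star u = 1 → ∀ x ∈ M, φ (u * x * star u) = φ x) ∧
    (∀ x ∈ M, ∀ y ∈ CA A x, φ y = φ x) := by
  set B : StarSubalgebra ℂ (H →L[ℂ] H) := M.toStarSubalgebra with hB
  have hAB : ∀ a ∈ A, a ∈ B := fun a ha => hAM ha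
  replace hadd : ∀ x ∈ B, ∀ y ∈ B, φ (x + y) = φ x + φ y := hadd
  replace hsmul : ∀ (c : ℂ), ∀ x ∈ B, φ (c • x) = c * φ x := hsmul
  replace hpos : ∀ x ∈ B, 0 ≤ φ (star x * x) := hpos
  have real_of_sa : ∀ a ∈ B, IsSelfAdjoint a → (φ a).im = 0 := by
    intro a ha has
    have h1 := hpos _ (add_mem ha (one_mem B))
    have h2 := hpos _ ha
    have e : star (a + 1) * (a + 1) = (star a * a + (2 : ℂ) • a) + 1 := by
      rw [star_add, star_one, has.star_eq, two_smul]
      noncomm_ring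
    have haa := mul_mem (star_mem ha) ha
    rw [e, hadd _ (add_mem haa (B.smul_mem ha _)) _ (one_mem B), hadd _ haa _ (B.smul_mem ha _),
      hsmul _ _ ha, hone] at h1
    rw [Complex.le_def] at h1 h2
    have h3 := h1.2
    have h4 := h2.2
    simp at h3 h4
    rw [← h4] at h3
    linarith
  have commSA : ∀ a ∈ A, IsSelfAdjoint a → ∀ x ∈ B, φ (a * x) = φ (x * a) := by
    intro a ha has x hx
    have haB := hAB a ha
    set l := φ a with hl
    have hb : a + (-l) • (1 : H →L[ℂ] H) ∈ A := add_mem ha (A.smul_mem (one_mem A) _)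
    have hbs : IsSelfAdjoint (a + (-l) • (1 : H →L[ℂ] H)) := by
      refine has.add (IsSelfAdjoint.smul ?_ (.one _))
      exact IsSelfAdjoint.neg (Complex.conj_eq_iff_im.2 (real_of_sa a haB has))
    have hb0 : φ (a + (-l) • (1 : H →L[ℂ] H)) = 0 := by
      rw [hadd _ haB _ (B.smul_mem (one_mem B) _), hsmul _ _ (one_mem B), hone, ← hl]
      ring
    have h := mul_eq_zero_of_selfAdjoint B A hAB hAclosed φ hadd hsmul hone hpos hproj
      hb hbs hb0 hx
    rw [add_mul, mul_add, smul_mul_assoc, mul_smul_comm, one_mul, mul_one,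
      hadd _ (mul_mem haB hx) _ (B.smul_mem hx _), hadd _ (mul_mem hx haB) _ (B.smul_mem hx _)] at h
    exact add_right_cancel (h.1.trans h.2.symm)
  have comm : ∀ a ∈ A, ∀ x ∈ B, φ (a * x) = φ (x * a) := by
    intro a ha x hx
    have hre : (realPart a : H →L[ℂ] H) ∈ A := by
      rw [realPart_apply_coe, ← Complex.coe_smul]
      exact A.smul_mem (add_mem ha (star_mem ha)) _
    have him : (imaginaryPart a : H →L[ℂ] H) ∈ A := by
      rw [imaginaryPart_apply_coe, ← Complex.coe_smul]
      exact A.smul_mem (A.smul_mem (sub_mem ha (star_mem ha)) _) _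
    have hreB := hAB _ hre
    have himB := hAB _ him
    have h1 := commSA _ hre (realPart a).2 x hx
    have h2 := commSA _ him (imaginaryPart a).2 x hx
    rw [← realPart_add_I_smul_imaginaryPart a, add_mul, mul_add, smul_mul_assoc, mul_smul_comm,
      hadd _ (mul_mem hreB hx) _ (B.smul_mem (mul_mem himB hx) _),
      hadd _ (mul_mem hx hreB) _ (B.smul_mem (mul_mem hx himB) _),
      hsmul _ _ (mul_mem himB hx), hsmul _ _ (mul_mem hx himB), h1, h2]
  have conj : ∀ u ∈ A, star u * u = 1 → ∀ x ∈ B, φ (u * x * star u) = φ x := by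
    intro u hu huu x hx
    rw [mul_assoc, comm u hu _ (mul_mem hx (star_mem (hAB u hu))), mul_assoc, huu, mul_one]
  refine ⟨comm, fun u hu huu _ x hx => conj u hu huu x hx, fun x hx y hy => ?_⟩
  replace hx : x ∈ B := hx
  have hMcl : IsClosed (M : Set (H →L[ℂ] H)) := by
    rw [← M.centralizer_centralizer]
    exact Set.isClosed_centralizer _
  have hScl : IsClosed ((M : Set (H →L[ℂ] H)) ∩ φ ⁻¹' {φ x}) :=
    hcont.preimage_isClosed_of_isClosed hMcl isClosed_singleton
  have hconv : Convex ℝ ((M : Set (H →L[ℂ] H)) ∩ φ ⁻¹' {φ x}) := by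
    rintro a ⟨ha, ha'⟩ b ⟨hb, hb'⟩ s t _ _ hst
    replace ha : a ∈ B := ha
    replace hb : b ∈ B := hb
    simp only [Set.mem_preimage, Set.mem_singleton_iff] at ha' hb'
    rw [← Complex.coe_smul s, ← Complex.coe_smul t]
    refine ⟨add_mem (B.smul_mem ha _) (B.smul_mem hb _), ?_⟩
    have hst' : (s : ℂ) + t = 1 := by exact_mod_cast hst
    rw [Set.mem_preimage, Set.mem_singleton_iff, hadd _ (B.smul_mem ha _) _ (B.smul_mem hb _),
      hsmul _ _ ha, hsmul _ _ hb, ha', hb', ← add_mul, hst', one_mul]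
  refine (closure_minimal (convexHull_min ?_ hconv) hScl hy).2
  rintro _ ⟨u, hu, huu, -, rfl⟩
  exact ⟨mul_mem (mul_mem (hAB u hu) hx) (star_mem (hAB u hu)), conj u hu huu x hx⟩
end

section
/- Suppose that every pure state ψ on A admits a unique extension to a state on M, i.e. there is exactly one state φ on M with φ(a) = ψ(a) for all a ∈ A. Then for every x ∈ M the set C_A(x) ∩ A is nonempty. -/
open scoped ComplexOrder

/-- A state on the algebra whose underlying set is `S`: linear and continuous on `S`, unital,
and positive on `S`. -/
def IsStateOn {H : Type*} [NormedAddCommGroup H] [InnerProductSpace ℂ H] [CompleteSpace H]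
    (S : Set (H →L[ℂ] H)) (φ : (H →L[ℂ] H) → ℂ) : Prop :=
  (∀ x ∈ S, ∀ y ∈ S, φ (x + y) = φ x + φ y) ∧
  (∀ (c : ℂ), ∀ x ∈ S, φ (c • x) = c * φ x) ∧
  ContinuousOn φ S ∧ φ 1 = 1 ∧ (∀ x ∈ S, 0 ≤ φ (star x * x))

/-- A pure state: an extreme point of the convex set of states. -/
def IsPureStateOn {H : Type*} [NormedAddCommGroup H] [InnerProductSpace ℂ H] [CompleteSpace H]
    (S : Set (H →L[ℂ] H)) (φ : (H →L[ℂ] H) → ℂ) : Prop :=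
  IsStateOn S φ ∧
  ∀ ψ₁ ψ₂ : (H →L[ℂ] H) → ℂ, IsStateOn S ψ₁ → IsStateOn S ψ₂ →
    ∀ t : ℝ, 0 < t → t < 1 → (∀ x ∈ S, φ x = t * ψ₁ x + (1 - (t : ℂ)) * ψ₂ x) →
      ∀ x ∈ S, ψ₁ x = φ x ∧ ψ₂ x = φ x

section Averaging
variable {B : Type*} [CStarAlgebra B]

/-- The linear map `x ↦ u * x * star u`. -/
noncomputable def conjBy (u : B) : Module.End ℂ B :=
  LinearMap.mulLeft ℂ u * LinearMap.mulRight ℂ (star u)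

lemma conjBy_apply (u x : B) : conjBy u x = u * x * star u := by
  simp [conjBy, mul_assoc]

/-- Convex combinations of conjugations by unitaries of `A`. -/
def averagingMaps (A : StarSubalgebra ℂ B) : Set (Module.End ℂ B) :=
  convexHull ℝ (conjBy '' {u | u ∈ unitary B ∧ u ∈ A})

variable {A : StarSubalgebra ℂ B} {S T : Module.End ℂ B}

lemma conjBy_mem_averagingMaps {u : B} (hu : u ∈ unitary B) (huA : u ∈ A) :
    conjBy u ∈ averagingMaps A :=
  subset_convexHull _ _ ⟨u, ⟨hu, huA⟩, rfl⟩

lemma mul_mem_averagingMaps (hS : S ∈ averagingMaps A) (hT : T ∈ averagingMaps A) :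
    S * T ∈ averagingMaps A := by
  have key : ∀ u ∈ unitary B, u ∈ A → ∀ T ∈ averagingMaps A,
      conjBy u * T ∈ averagingMaps A := by
    intro u hu huA T hT
    refine convexHull_min (t := {T | conjBy u * T ∈ averagingMaps A}) ?_ ?_ hT
    · rintro _ ⟨v, ⟨hv, hvA⟩, rfl⟩
      have : conjBy u * conjBy v = conjBy (u * v) := by
        ext x; simp [conjBy_apply, mul_assoc]
      simpa [this] using conjBy_mem_averagingMaps (mul_mem hu hv) (mul_mem huA hvA)
    · exact (convex_convexHull ℝ _).is_linear_preimage
        (f := fun T => conjBy u * T) ⟨mul_add _, fun c T => by simp⟩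
  refine convexHull_min (t := {S | S * T ∈ averagingMaps A}) ?_ ?_ hS
  · rintro _ ⟨u, ⟨hu, huA⟩, rfl⟩
    exact key u hu huA T hT
  · exact (convex_convexHull ℝ _).is_linear_preimage
      (f := fun S => S * T) ⟨fun a b => add_mul a b _, fun c S => by simp⟩

lemma norm_averagingMaps_le (hT : T ∈ averagingMaps A) (x : B) : ‖T x‖ ≤ ‖x‖ := by
  have : T ∈ {T : Module.End ℂ B | T x ∈ Metric.closedBall (0 : B) ‖x‖} := by
    refine convexHull_min ?_ ?_ hT
    · rintro _ ⟨u, ⟨hu, -⟩, rfl⟩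
      simp [conjBy_apply, CStarRing.norm_mul_mem_unitary _ (Unitary.star_mem hu),
        CStarRing.norm_mem_unitary_mul _ hu]
    · exact (convex_closedBall (0 : B) ‖x‖).is_linear_preimage
        (f := fun T : Module.End ℂ B => T x) ⟨fun _ _ => rfl, fun _ _ => rfl⟩
  simpa using this

lemma averagingMaps_apply_mem_convexHull (hT : T ∈ averagingMaps A) (x : B) :
    T x ∈ convexHull ℝ {y | ∃ u ∈ A, star u * u = 1 ∧ u * star u = 1 ∧ y = u * x * star u} := by
  refine convexHull_min (t := {T : Module.End ℂ B | T x ∈ convexHull ℝ _}) ?_ ?_ hT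
  · rintro _ ⟨u, ⟨hu, huA⟩, rfl⟩
    exact subset_convexHull _ _ ⟨u, huA, hu.1, hu.2, conjBy_apply u x⟩
  · exact (convex_convexHull ℝ _).is_linear_preimage
      (f := fun T : Module.End ℂ B => T x) ⟨fun _ _ => rfl, fun _ _ => rfl⟩

lemma averagingMaps_commute (hA : ∀ a ∈ A, ∀ b ∈ A, a * b = b * a)
    (hS : S ∈ averagingMaps A) (hT : T ∈ averagingMaps A) : Commute S T := by
  have key : ∀ R : Module.End ℂ B, (∀ u ∈ unitary B, u ∈ A → Commute R (conjBy u)) →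
      ∀ T ∈ averagingMaps A, Commute R T := by
    intro R h T hT
    refine convexHull_min (t := {T | Commute R T}) ?_ ?_ hT
    · rintro _ ⟨u, ⟨hu, huA⟩, rfl⟩
      exact h u hu huA
    · intro a ha b hb s t _ _ _
      exact (Commute.smul_right ha s).add_right (Commute.smul_right hb t)
  refine key S (fun u hu huA => (key _ (fun v hv hvA => ?_) S hS).symm) T hT
  ext x
  have h2 := hA _ (star_mem huA) _ (star_mem hvA)
  simp only [Module.End.mul_apply, conjBy_apply]
  calc u * (v * x * star v) * star u = (u * v) * x * (star v * star u) := by noncomm_ring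
    _ = (v * u) * x * (star u * star v) := by rw [hA u huA v hvA, h2]
    _ = _ := by noncomm_ring

lemma averagingMaps_apply_of_mem (hA : ∀ a ∈ A, ∀ b ∈ A, a * b = b * a)
    (hT : T ∈ averagingMaps A) {a : B} (ha : a ∈ A) : T a = a := by
  refine convexHull_min (t := {T : Module.End ℂ B | T a ∈ ({a} : Set B)}) ?_ ?_ hT
  · rintro _ ⟨u, ⟨hu, huA⟩, rfl⟩
    simp [conjBy_apply, hA u huA a ha, mul_assoc, hu.2]
  · exact (convex_singleton a).is_linear_preimage
      (f := fun T : Module.End ℂ B => T a) ⟨fun _ _ => rfl, fun _ _ => rfl⟩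

variable (A) in
/-- Elements which averages over the unitaries of `A` make arbitrarily small. -/
def AveragesToZero (z : B) : Prop := ∀ ε > 0, ∃ T ∈ averagingMaps A, ‖T z‖ ≤ ε

lemma AveragesToZero.add (hA : ∀ a ∈ A, ∀ b ∈ A, a * b = b * a) {y z : B}
    (hy : AveragesToZero A y) (hz : AveragesToZero A z) : AveragesToZero A (y + z) := by
  intro ε hε
  obtain ⟨S, hS, hSy⟩ := hy (ε / 2) (by positivity)
  obtain ⟨T, hT, hTz⟩ := hz (ε / 2) (by positivity)
  refine ⟨S * T, mul_mem_averagingMaps hS hT, ?_⟩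
  rw [map_add]
  refine (norm_add_le _ _).trans ?_
  have h1 : ‖(S * T) y‖ ≤ ε / 2 := by
    rw [averagingMaps_commute hA hS hT]
    exact (norm_averagingMaps_le hT _).trans hSy
  have h2 : ‖(S * T) z‖ ≤ ε / 2 := (norm_averagingMaps_le hS _).trans hTz
  linarith

lemma AveragesToZero.smul {z : B} (hz : AveragesToZero A z) (c : ℂ) :
    AveragesToZero A (c • z) := by
  intro ε hε
  obtain ⟨T, hT, hTz⟩ := hz (ε / (‖c‖ + 1)) (by positivity)
  refine ⟨T, hT, ?_⟩
  rw [map_smul, norm_smul]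
  calc ‖c‖ * ‖T z‖ ≤ (‖c‖ + 1) * (ε / (‖c‖ + 1)) := by gcongr; linarith
    _ = ε := by field_simp

lemma averagesToZero_zero : AveragesToZero A (0 : B) := fun ε hε =>
  ⟨conjBy 1, conjBy_mem_averagingMaps (one_mem _) (one_mem _), by simpa using hε.le⟩

lemma AveragesToZero.sum (hA : ∀ a ∈ A, ∀ b ∈ A, a * b = b * a) {ι : Type*} (s : Finset ι)
    {z : ι → B} (hz : ∀ i ∈ s, AveragesToZero A (z i)) : AveragesToZero A (∑ i ∈ s, z i) :=
  Finset.sum_induction _ _ (fun _ _ => AveragesToZero.add hA) averagesToZero_zero hz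

lemma averagesToZero_conj_sub {v : B} (hv : v ∈ unitary B) (hvA : v ∈ A) (z : B) :
    AveragesToZero A (v * z * star v - z) := by
  intro ε hε
  obtain ⟨n, hn⟩ := exists_nat_gt (2 * ‖z‖ / ε)
  have hn0 : (0 : ℝ) < n := lt_of_le_of_lt (by positivity) hn
  have hpow : ∀ k : ℕ, conjBy v ^ k ∈ averagingMaps A := by
    intro k
    induction k with
    | zero =>
      have : (1 : Module.End ℂ B) = conjBy 1 := by ext x; simp [conjBy_apply]
      rw [pow_zero, this]
      exact conjBy_mem_averagingMaps (one_mem _) (one_mem _)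
    | succ k ih => exact pow_succ (conjBy v) k ▸
        mul_mem_averagingMaps ih (conjBy_mem_averagingMaps hv hvA)
  refine ⟨∑ k ∈ Finset.range n, (n : ℝ)⁻¹ • conjBy v ^ k,
    (convex_convexHull ℝ _).sum_mem (fun _ _ => by positivity) ?_ (fun k _ => hpow k), ?_⟩
  · simp [hn0.ne']
  have h : (∑ k ∈ Finset.range n, (n : ℝ)⁻¹ • conjBy v ^ k) (v * z * star v - z)
      = (n : ℝ)⁻¹ • ((conjBy v ^ n) z - z) := by
    rw [← Finset.smul_sum, LinearMap.smul_apply, LinearMap.sum_apply]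
    congr 1
    have : ∀ k, (conjBy v ^ k) (v * z * star v - z)
        = (conjBy v ^ (k + 1)) z - (conjBy v ^ k) z := by
      intro k
      rw [map_sub, pow_succ, Module.End.mul_apply, conjBy_apply]
    simp only [this]
    rw [Finset.sum_range_sub (fun k => (conjBy v ^ k) z)]
    simp
  rw [h, norm_smul, norm_inv, Real.norm_natCast]
  have h3 : ‖(conjBy v ^ n) z - z‖ ≤ 2 * ‖z‖ := by
    refine (norm_sub_le _ _).trans ?_
    linarith [norm_averagingMaps_le (hpow n) z]
  rw [inv_mul_le_iff₀ hn0]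
  rw [div_lt_iff₀ hε] at hn
  linarith

lemma averagesToZero_commutator (hA : ∀ a ∈ A, ∀ b ∈ A, a * b = b * a)
    (hclosed : IsClosed (A : Set B)) {a : B} (ha : a ∈ A) (z : B) :
    AveragesToZero A (a * z - z * a) := by
  have := hclosed
  have hspan : (⟨a, ha⟩ : A) ∈ Submodule.span ℂ (unitary A : Set A) := by
    rw [CStarAlgebra.span_unitary]; trivial
  suffices ∀ c : A, c ∈ Submodule.span ℂ (unitary A : Set A) →
      AveragesToZero A ((c : B) * z - z * c) from this _ hspan
  intro c hc
  induction hc using Submodule.span_induction with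
  | mem v hv =>
    have h1 : star (v : B) * v = 1 := congrArg Subtype.val hv.1
    have h2 : (v : B) * star (v : B) = 1 := congrArg Subtype.val hv.2
    have := averagesToZero_conj_sub (A := A) (v := (v : B)) ⟨h1, h2⟩ v.2 (z * v)
    rwa [show (v : B) * (z * v) * star (v : B) = v * z by
      rw [← mul_assoc, mul_assoc _ (v : B), h2, mul_one]] at this
  | zero => simpa using averagesToZero_zero (A := A)
  | add c d _ _ hc hd =>
    have := hc.add hA hd
    convert this using 1
    push_cast
    noncomm_ring
  | smul t c _ hc =>
    have := hc.smul t
    simpa [smul_sub] using this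

lemma exists_mem_averagesToZero_sub (hA : ∀ a ∈ A, ∀ b ∈ A, a * b = b * a)
    (hclosed : IsClosed (A : Set B)) {x : B}
    (h : ∀ ε > 0, ∃ a ∈ A, ∃ y, ‖y‖ ≤ ε ∧ AveragesToZero A (x - a - y)) :
    ∃ a ∈ A, AveragesToZero A (x - a) := by
  choose a ha y hy hxy using fun n : ℕ => h (1 / ((n : ℝ) + 1)) Nat.one_div_pos_of_nat
  have hdist : ∀ m n, dist (a m) (a n) ≤ 1 / ((m : ℝ) + 1) + 1 / ((n : ℝ) + 1) := by
    intro m n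
    refine le_of_forall_pos_le_add fun δ hδ => ?_
    obtain ⟨T, hT, hTle⟩ := ((hxy n).add hA ((hxy m).smul (-1))) δ hδ
    have h1 : T (a m - a n) = a m - a n :=
      averagingMaps_apply_of_mem hA hT (sub_mem (ha m) (ha n))
    have h2 : a m - a n = T (x - a n - y n + (-1 : ℂ) • (x - a m - y m)) + T (y n - y m) := by
      rw [← h1, ← map_add]
      congr 1
      simp only [neg_smul, one_smul]
      abel
    rw [dist_eq_norm, h2]
    have h3 := norm_averagingMaps_le hT (y n - y m)
    have h4 := norm_sub_le (y n) (y m)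
    have h5 := norm_add_le (T (x - a n - y n + (-1 : ℂ) • (x - a m - y m))) (T (y n - y m))
    linarith [hy m, hy n]
  have hlim := tendsto_one_div_add_atTop_nhds_zero_nat (𝕜 := ℝ)
  have hcauchy : CauchySeq a := by
    refine cauchySeq_of_le_tendsto_0 (fun n : ℕ => 2 * (1 / ((n : ℝ) + 1))) ?_
      (by simpa using hlim.const_mul 2)
    intro m n N hm hn
    have h1 := Nat.one_div_le_one_div (α := ℝ) hm
    have h2 := Nat.one_div_le_one_div (α := ℝ) hn
    linarith [hdist m n]
  obtain ⟨l, hl⟩ := cauchySeq_tendsto_of_complete hcauchy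
  refine ⟨l, hclosed.mem_of_tendsto hl (Filter.Eventually.of_forall ha), fun ε hε => ?_⟩
  obtain ⟨n, hn1, hn2⟩ := ((Metric.tendsto_nhds.1 hl (ε / 4) (by positivity)).and
    (hlim.eventually_lt_const (show (0 : ℝ) < ε / 4 by positivity))).exists
  obtain ⟨T, hT, hTle⟩ := hxy n (ε / 4) (by positivity)
  refine ⟨T, hT, ?_⟩
  have h1 : x - l = (x - a n - y n) + ((a n - l) + y n) := by abel
  rw [h1, map_add]
  rw [dist_eq_norm] at hn1
  have h2 := norm_averagingMaps_le hT ((a n - l) + y n)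
  have h3 := norm_add_le (a n - l) (y n)
  have h4 := norm_add_le (T (x - a n - y n)) (T ((a n - l) + y n))
  linarith [hy n]

end Averaging

section Partition
open WeakDual
variable {C : Type*} [CommCStarAlgebra C]

lemma exists_squares_partition (d : characterSpace ℂ C → C)
    (hd : ∀ χ, IsSelfAdjoint (d χ))
    {ε : ℝ} (h : ∀ χ : characterSpace ℂ C, (χ (d χ)).re < ε) :
    ∃ (s : Finset (characterSpace ℂ C)) (b c : characterSpace ℂ C → C),
      (∀ i, IsSelfAdjoint (b i)) ∧ ∑ i ∈ s, b i * b i = 1 ∧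
      ∀ i, (ε : ℂ) • (b i * b i) - b i * d i * b i = star (c i) * c i := by
  have hcont : ∀ i, Continuous fun χ : characterSpace ℂ C => (χ (d i)).re := fun i =>
    Complex.continuous_re.comp (gelfandTransform ℂ C (d i)).continuous
  have hreal : ∀ i (χ : characterSpace ℂ C), χ (d i) = ((χ (d i)).re : ℂ) := by
    intro i χ
    refine (Complex.conj_eq_iff_re.1 ?_).symm
    have := map_star (gelfandStarTransform C) (d i)
    rw [(hd i).star_eq] at this
    exact (DFunLike.congr_fun this χ).symm
  set f : characterSpace ℂ C → characterSpace ℂ C → ℝ := fun i χ => max 0 (ε - (χ (d i)).re)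
    with hf
  have hfc : ∀ i, Continuous (f i) := fun i => continuous_const.max (continuous_const.sub (hcont i))
  have hf0 : ∀ i χ, 0 ≤ f i χ := fun i χ => le_max_left _ _
  obtain ⟨s, hs⟩ := CompactSpace.elim_nhds_subcover
    (fun i : characterSpace ℂ C => {χ : characterSpace ℂ C | (χ (d i)).re < ε})
    (fun i => (isOpen_lt (hcont i) continuous_const).mem_nhds (h i))
  have hF : ∀ χ, 0 < ∑ i ∈ s, f i χ := by
    intro χ
    have hχ : χ ∈ ⋃ i ∈ s, {χ : characterSpace ℂ C | (χ (d i)).re < ε} := by rw [hs]; trivial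
    simp only [Set.mem_iUnion, Set.mem_ofPred_eq] at hχ
    obtain ⟨i, hi, hχ⟩ := hχ
    exact Finset.sum_pos' (fun i _ => hf0 i χ) ⟨i, hi, lt_max_of_lt_right (sub_pos.2 hχ)⟩
  have hβc : ∀ i, Continuous fun χ => √(f i χ / ∑ j ∈ s, f j χ) := fun i =>
    ((hfc i).div (continuous_finsetSum _ fun j _ => hfc j) fun χ => (hF χ).ne').sqrt
  set β : characterSpace ℂ C → C(characterSpace ℂ C, ℂ) := fun i =>
    ⟨fun χ => (√(f i χ / ∑ j ∈ s, f j χ) : ℝ), Complex.continuous_ofReal.comp (hβc i)⟩ with hβ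
  set γ : characterSpace ℂ C → C(characterSpace ℂ C, ℂ) := fun i =>
    ⟨fun χ => (√(f i χ / ∑ j ∈ s, f j χ) * √(f i χ) : ℝ),
      Complex.continuous_ofReal.comp ((hβc i).mul (hfc i).sqrt)⟩ with hγ
  set G := gelfandStarTransform C with hG
  refine ⟨s, fun i => G.symm (β i), fun i => G.symm (γ i), fun i => ?_, ?_, fun i => ?_⟩
  · rw [isSelfAdjoint_iff, ← map_star]
    congr 1
    ext χ
    simp [hβ]
  · apply EquivLike.injective G
    simp only [map_sum, map_mul, StarAlgEquiv.apply_symm_apply, map_one]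
    ext χ
    simp only [ContinuousMap.coe_sum, Finset.sum_apply, ContinuousMap.mul_apply,
      ContinuousMap.one_apply, hβ, ContinuousMap.coe_mk, ← Complex.ofReal_mul]
    rw [← Complex.ofReal_sum, Complex.ofReal_eq_one]
    simp only [Real.mul_self_sqrt (div_nonneg (hf0 _ χ) (hF χ).le)]
    rw [← Finset.sum_div, div_self (hF χ).ne']
  · apply EquivLike.injective G
    simp only [map_sub, map_smul, map_mul, map_star, StarAlgEquiv.apply_symm_apply]
    ext χ
    have hdχ : G (d i) χ = ((χ (d i)).re : ℂ) := hreal i χ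
    simp only [ContinuousMap.sub_apply, ContinuousMap.smul_apply, ContinuousMap.mul_apply,
      ContinuousMap.star_apply, hβ, hγ, ContinuousMap.coe_mk, hdχ, smul_eq_mul, RCLike.star_def,
      Complex.conj_ofReal]
    norm_cast
    have h1 : √(f i χ) * √(f i χ) = f i χ := Real.mul_self_sqrt (hf0 i χ)
    rcases le_total (ε - (χ (d i)).re) 0 with h2 | h2
    · have : f i χ = 0 := max_eq_left h2
      simp [this]
    · have h3 : f i χ = ε - (χ (d i)).re := max_eq_right h2
      set t := √(f i χ / ∑ j ∈ s, f j χ)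
      linear_combination (-t * t) * h1 - t * t * h3
end Partition

section Extension
open WeakDual ComplexStarModule
variable {B : Type*} [CStarAlgebra B] [PartialOrder B] [StarOrderedRing B]
  {A : StarSubalgebra ℂ B}

lemma coe_realPart_le_smul_one (y : B) {r : ℝ} (hr : ‖(ℜ y : B)‖ ≤ r) :
    (ℜ y : B) ≤ ((r : ℂ) • (1 : A) : A) := by
  have h := (ℜ y).2.le_algebraMap_norm_self.trans (algebraMap_mono B hr)
  rw [Algebra.algebraMap_eq_smul_one] at h
  simpa using h

variable [hclosed : IsClosed (A : Set B)]

lemma characterSpace_apply_nonneg (χ : characterSpace ℂ A) {a : A} (ha : 0 ≤ (a : B)) :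
    0 ≤ χ a := by
  have h : χ a ∈ spectrum ℂ a := AlgHom.apply_mem_spectrum χ a
  rw [A.spectrum_eq] at h
  exact spectrum_nonneg_of_nonneg ha h

lemma characterSpace_re_mono (χ : characterSpace ℂ A) {a b : A} (h : (a : B) ≤ b) :
    (χ a).re ≤ (χ b).re := by
  have := (Complex.le_def.1 (characterSpace_apply_nonneg χ (a := b - a) (by simpa using h))).1
  simpa using this

/-- The infimum of `Re χ(a)` over the elements `a` of `A` which dominate the real part of `y`. -/
noncomputable def upperEnvelope (χ : characterSpace ℂ A) (y : B) : ℝ :=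
  sInf {r | ∃ a : A, (ℜ y : B) ≤ a ∧ r = (χ a).re}

lemma upperEnvelope_nonempty (χ : characterSpace ℂ A) (y : B) :
    {r | ∃ a : A, (ℜ y : B) ≤ a ∧ r = (χ a).re}.Nonempty :=
  ⟨_, (‖(ℜ y : B)‖ : ℂ) • 1, coe_realPart_le_smul_one y le_rfl, rfl⟩

lemma upperEnvelope_bddBelow (χ : characterSpace ℂ A) (y : B) :
    BddBelow {r | ∃ a : A, (ℜ y : B) ≤ a ∧ r = (χ a).re} := by
  refine ⟨(χ (-((‖(ℜ (-y) : B)‖ : ℂ) • 1))).re, ?_⟩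
  rintro _ ⟨a, ha, rfl⟩
  refine characterSpace_re_mono χ (le_trans ?_ ha)
  have := neg_le_neg (coe_realPart_le_smul_one (A := A) (-y) le_rfl)
  simpa using this

lemma upperEnvelope_le (χ : characterSpace ℂ A) {y : B} {a : A} (h : (ℜ y : B) ≤ a) :
    upperEnvelope χ y ≤ (χ a).re :=
  csInf_le (upperEnvelope_bddBelow χ y) ⟨a, h, rfl⟩

lemma exists_lt_of_upperEnvelope_lt (χ : characterSpace ℂ A) {y : B} {r : ℝ}
    (h : upperEnvelope χ y < r) : ∃ a : A, (ℜ y : B) ≤ a ∧ (χ a).re < r := by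
  obtain ⟨_, ⟨a, ha, rfl⟩, har⟩ := exists_lt_of_csInf_lt (upperEnvelope_nonempty χ y) h
  exact ⟨a, ha, har⟩

lemma upperEnvelope_add_le (χ : characterSpace ℂ A) (x y : B) :
    upperEnvelope χ (x + y) ≤ upperEnvelope χ x + upperEnvelope χ y := by
  refine le_of_forall_pos_le_add fun ε hε => ?_
  obtain ⟨a, ha, hax⟩ := exists_lt_of_upperEnvelope_lt χ
    (lt_add_of_pos_right (upperEnvelope χ x) (half_pos hε))
  obtain ⟨b, hb, hby⟩ := exists_lt_of_upperEnvelope_lt χ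
    (lt_add_of_pos_right (upperEnvelope χ y) (half_pos hε))
  have := upperEnvelope_le χ (y := x + y) (a := a + b) (by simpa using add_le_add ha hb)
  simp only [map_add, Complex.add_re] at this
  linarith

lemma upperEnvelope_smul_le (χ : characterSpace ℂ A) {c : ℝ} (hc : 0 < c) (x : B) :
    upperEnvelope χ (c • x) ≤ c * upperEnvelope χ x := by
  rw [← div_le_iff₀' hc]
  refine le_csInf (upperEnvelope_nonempty χ x) ?_
  rintro _ ⟨a, ha, rfl⟩
  rw [div_le_iff₀' hc]
  have := upperEnvelope_le χ (y := c • x) (a := (c : ℂ) • a) (by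
    simpa using smul_le_smul_of_nonneg_left ha hc.le)
  rwa [map_smul, smul_eq_mul, Complex.re_ofReal_mul] at this

lemma upperEnvelope_smul (χ : characterSpace ℂ A) {c : ℝ} (hc : 0 < c) (x : B) :
    upperEnvelope χ (c • x) = c * upperEnvelope χ x := by
  refine (upperEnvelope_smul_le χ hc x).antisymm ?_
  have := upperEnvelope_smul_le χ (inv_pos.2 hc) (c • x)
  rwa [inv_smul_smul₀ hc.ne', ← div_eq_inv_mul, le_div_iff₀' hc] at this

lemma exists_linear_le_upperEnvelope (χ : characterSpace ℂ A) (x : B) :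
    ∃ g : B →ₗ[ℝ] ℝ, g x = upperEnvelope χ x ∧ ∀ y, g y ≤ upperEnvelope χ y := by
  have h0 : upperEnvelope χ (0 : B) = 0 := by
    have := upperEnvelope_smul χ two_pos (0 : B)
    rw [smul_zero] at this
    linarith
  have hz : ∀ c : ℝ, c • x = 0 → (RingHom.id ℝ) c • upperEnvelope χ x = 0 := by
    intro c hc
    rcases smul_eq_zero.1 hc with rfl | rfl
    · simp
    · simp [h0]
  obtain ⟨g, hg, hgN⟩ := exists_extension_of_le_sublinear
    (LinearPMap.mkSpanSingleton' x (upperEnvelope χ x) hz) (upperEnvelope χ)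
    (fun c hc y => upperEnvelope_smul χ hc y) (upperEnvelope_add_le χ) (by
      rintro ⟨y, hy⟩
      obtain ⟨c, rfl⟩ := Submodule.mem_span_singleton.1 hy
      rw [LinearPMap.mkSpanSingleton'_apply]
      simp only [RingHom.id_apply, smul_eq_mul]
      rcases lt_trichotomy c 0 with hc | rfl | hc
      · have h1 := upperEnvelope_smul χ (neg_pos.2 hc) x
        have h2 := upperEnvelope_add_le χ (c • x) ((-c) • x)
        rw [← add_smul, add_neg_cancel, zero_smul, h0] at h2
        linarith
      · simp [h0]
      · exact (upperEnvelope_smul χ hc x).ge)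
  refine ⟨g, ?_, hgN⟩
  have := hg ⟨x, Submodule.mem_span_singleton_self x⟩
  rw [this]
  exact LinearPMap.mkSpanSingleton'_apply_self _ _ _ _

/-- Positive functionals on `B` extending the character `χ` of `A`. -/
structure IsPositiveExtension (χ : characterSpace ℂ A) (Φ : StrongDual ℂ B) : Prop where
  apply_coe : ∀ a : A, Φ a = χ a
  star_mul_self_nonneg : ∀ y : B, 0 ≤ Φ (star y * y)

lemma exists_isPositiveExtension_of_le (χ : characterSpace ℂ A) (g : B →ₗ[ℝ] ℝ)
    (hg : ∀ y, g y ≤ upperEnvelope χ y) :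
    ∃ Φ : StrongDual ℂ B, IsPositiveExtension χ Φ ∧ ∀ y, (Φ y).re = g y := by
  have hle : ∀ (y : B) (a : A), (ℜ y : B) ≤ a → g y ≤ (χ a).re := fun y a h =>
    (hg y).trans (upperEnvelope_le χ h)
  have hbound : ∀ y : B, g y ≤ ‖y‖ := by
    intro y
    refine (hle y _ (coe_realPart_le_smul_one y (realPart.norm_le y))).trans_eq ?_
    rw [map_smul, map_one, smul_eq_mul, mul_one, Complex.ofReal_re]
  let g' : StrongDual ℝ B := g.mkContinuous 1 fun y => by
    rw [Real.norm_eq_abs, abs_le, one_mul]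
    have := hbound (-y)
    rw [map_neg, norm_neg] at this
    exact ⟨by linarith, hbound y⟩
  have hg' : ∀ y, g' y = g y := fun _ => rfl
  refine ⟨g'.extendRCLike, ⟨fun a => ?_, fun y => ?_⟩, fun y => ?_⟩
  · have hre : ∀ a : A, g a = (χ a).re := by
      have h1 : ∀ a : A, g a ≤ (χ a).re := by
        intro a
        refine (hle a ((2⁻¹ : ℂ) • (a + star a)) (le_of_eq ?_)).trans_eq ?_
        · rw [realPart_apply_coe, ← Complex.coe_smul]
          simp
        · rw [map_smul, map_add, map_star, RCLike.star_def, Complex.add_conj, smul_eq_mul]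
          simp
      intro a
      have := h1 (-a)
      simp only [NegMemClass.coe_neg, map_neg, Complex.neg_re] at this
      linarith [h1 a]
    apply Complex.ext
    · exact (StrongDual.re_extendRCLike_apply (𝕜 := ℂ) g' (a : B)).trans (hre a)
    · refine (StrongDual.im_extendRCLike_apply (𝕜 := ℂ) g' (a : B)).trans ?_
      have := hre (Complex.I • a)
      rw [map_smul] at this
      simpa [hg'] using congrArg Neg.neg this
  · have hs : (ℜ (star y * y) : B) = star y * y := (IsSelfAdjoint.star_mul_self y).coe_realPart
    have hI : (ℜ (Complex.I • (star y * y)) : B) = 0 := by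
      rw [realPart_I_smul, (IsSelfAdjoint.star_mul_self y).imaginaryPart]
      simp
    rw [Complex.le_def]
    constructor
    · refine le_of_le_of_eq ?_ (StrongDual.re_extendRCLike_apply (𝕜 := ℂ) g' _).symm
      have := hle (-(star y * y)) 0 (by rw [map_neg, NegMemClass.coe_neg, hs]; simp)
      simpa [hg'] using this
    · refine Eq.trans ?_ (StrongDual.im_extendRCLike_apply (𝕜 := ℂ) g' _).symm
      have h1 := hle (Complex.I • (star y * y)) 0 (by rw [hI]; simp)
      have h2 := hle (-(Complex.I • (star y * y))) 0 (by rw [map_neg, NegMemClass.coe_neg, hI]; simp)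
      simp only [map_neg, map_zero, Complex.zero_re] at h1 h2
      simp only [Complex.zero_im, hg', RCLike.I_to_complex]
      linarith
  · exact StrongDual.re_extendRCLike_apply (𝕜 := ℂ) g' y

/-- If `χ` has at most one positive extension at `x`, then `x` is squeezed by elements of `A`. -/
lemma exists_le_le_of_unique_extension (χ : characterSpace ℂ A) {x : B} (hx : IsSelfAdjoint x)
    (huniq : ∀ Φ Ψ : StrongDual ℂ B, IsPositiveExtension χ Φ → IsPositiveExtension χ Ψ → Φ x = Ψ x)
    {ε : ℝ} (hε : 0 < ε) :
    ∃ a b : A, (a : B) ≤ x ∧ x ≤ b ∧ (χ (b - a)).re < ε := by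
  obtain ⟨g, hgx, hg⟩ := exists_linear_le_upperEnvelope χ x
  obtain ⟨k, hkx, hk⟩ := exists_linear_le_upperEnvelope χ (-x)
  obtain ⟨Φ, hΦ, hΦg⟩ := exists_isPositiveExtension_of_le χ g hg
  obtain ⟨Ψ, hΨ, hΨk⟩ := exists_isPositiveExtension_of_le χ k hk
  have heq : g x = k x := by rw [← hΦg, ← hΨk, huniq Φ Ψ hΦ hΨ]
  rw [map_neg] at hkx
  obtain ⟨b, hb, hbx⟩ := exists_lt_of_upperEnvelope_lt χ
    (lt_add_of_pos_right (upperEnvelope χ x) (half_pos hε))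
  obtain ⟨a, ha, hax⟩ := exists_lt_of_upperEnvelope_lt χ
    (lt_add_of_pos_right (upperEnvelope χ (-x)) (half_pos hε))
  rw [hx.coe_realPart] at hb
  rw [hx.neg.coe_realPart] at ha
  refine ⟨-a, b, by simpa using neg_le_neg ha, hb, ?_⟩
  simp only [map_sub, map_neg, Complex.sub_re, Complex.neg_re]
  linarith

end Extension

section Paving

open WeakDual ComplexStarModule

variable {B : Type*} [CStarAlgebra B] [PartialOrder B] [StarOrderedRing B]
  {A : StarSubalgebra ℂ B} [hclosed : IsClosed (A : Set B)]

lemma exists_mem_averagesToZero_sub_of_unique_extension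
    (hA : ∀ a ∈ A, ∀ b ∈ A, a * b = b * a) {x : B} (hx : IsSelfAdjoint x)
    (huniq : ∀ (χ : characterSpace ℂ A) (Φ Ψ : StrongDual ℂ B),
      IsPositiveExtension χ Φ → IsPositiveExtension χ Ψ → Φ x = Ψ x) :
    ∃ a ∈ A, AveragesToZero A (x - a) := by
  let _ : CommCStarAlgebra A :=
    { (inferInstance : CStarAlgebra A) with mul_comm := fun a b => Subtype.ext (hA a a.2 b b.2) }
  refine exists_mem_averagesToZero_sub hA hclosed fun ε hε => ?_
  choose a b ha hb hab using fun χ : characterSpace ℂ A =>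
    exists_le_le_of_unique_extension χ hx (huniq χ) hε
  have hd : ∀ χ, IsSelfAdjoint (b χ - a χ) := fun χ => by
    have : IsSelfAdjoint ((b χ : B) - a χ) :=
      (sub_nonneg.2 ((ha χ).trans (hb χ))).isSelfAdjoint
    exact Subtype.ext this
  obtain ⟨s, β, c, hβ, hsum, hc⟩ := exists_squares_partition (fun χ => b χ - a χ) hd hab
  have hβ' : ∀ i, star (β i : B) = β i := fun i => congrArg Subtype.val (hβ i)
  have hsum' : ∑ i ∈ s, (β i : B) * β i = 1 := by
    simpa using congrArg (Subtype.val : A → B) hsum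
  have hconj : ∀ i {z w : B}, z ≤ w → β i * z * β i ≤ (β i : B) * w * β i := by
    intro i z w h
    simpa [hβ'] using star_left_conjugate_le_conjugate h (β i : B)
  refine ⟨∑ i ∈ s, (β i : B) * a i * β i,
    sum_mem fun i _ => mul_mem (mul_mem (β i).2 (a i).2) (β i).2,
    ∑ i ∈ s, (β i : B) * (x - a i) * β i, ?_, ?_⟩
  · rw [CStarAlgebra.norm_le_iff_le_algebraMap _ hε.le (Finset.sum_nonneg fun i _ => ?_)]
    · have hle : ∀ i ∈ s, (β i : B) * (x - a i) * β i ≤ (ε : ℂ) • ((β i : B) * β i) := by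
        intro i _
        refine (hconj i (sub_le_sub_right (hb i) (a i : B))).trans (sub_nonneg.1 ?_)
        have h := congrArg (Subtype.val : A → B) (hc i)
        have h' : (ε : ℂ) • ((β i : B) * β i) - β i * ((b i : B) - a i) * β i
          = star (c i : B) * c i := h
        rw [h']
        exact star_mul_self_nonneg _
      refine (Finset.sum_le_sum hle).trans_eq ?_
      rw [← Finset.smul_sum, hsum', Algebra.algebraMap_eq_smul_one, Complex.coe_smul]
    · simpa using hconj i (sub_nonneg.2 (ha i))
  · have h : x - ∑ i ∈ s, (β i : B) * a i * β i - ∑ i ∈ s, (β i : B) * (x - a i) * β i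
        = ∑ i ∈ s, ((β i : B) * (β i * x) - (β i * x) * β i) := by
      have hx1 : x = ∑ i ∈ s, (β i : B) * β i * x := by rw [← Finset.sum_mul, hsum', one_mul]
      rw [sub_sub, ← Finset.sum_add_distrib]
      nth_rw 1 [hx1]
      rw [← Finset.sum_sub_distrib]
      exact Finset.sum_congr rfl fun i _ => by noncomm_ring
    rw [h]
    exact AveragesToZero.sum hA s fun i _ => averagesToZero_commutator hA hclosed (β i).2 _

end Paving

section States

open WeakDual ComplexStarModule

variable {H : Type*} [NormedAddCommGroup H] [InnerProductSpace ℂ H] [CompleteSpace H]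

lemma IsStateOn.apply_eq_zero_of_star_mul_self {A : StarSubalgebra ℂ (H →L[ℂ] H)}
    {φ : (H →L[ℂ] H) → ℂ} (hφ : IsStateOn (A : Set (H →L[ℂ] H)) φ) {c : H →L[ℂ] H} (hc : c ∈ A)
    (h0 : φ (star c * c) = 0) : φ c = 0 := by
  obtain ⟨hadd, hsmul, -, hone, hpos⟩ := hφ
  have key : ∀ s : ℂ, 0 ≤ s * φ (star c) + star s * φ c + star s * s := by
    intro s
    have hs : s • (1 : H →L[ℂ] H) ∈ A := A.smul_mem A.one_mem s
    have h := hpos (c + s • 1) (add_mem hc hs)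
    have hexp : star (c + s • (1 : H →L[ℂ] H)) * (c + s • 1)
        = ((star c * c + s • star c) + star s • c) + (star s * s) • 1 := by
      simp only [star_add, star_smul, star_one, add_mul, mul_add, mul_smul_comm, smul_mul_assoc,
        one_mul, mul_one, smul_add, smul_smul, mul_comm (star s) s]
      abel
    have m1 := mul_mem (star_mem hc) hc
    have m2 := A.smul_mem (star_mem hc) s
    have m3 := A.smul_mem hc (star s)
    rw [hexp, hadd _ (add_mem (add_mem m1 m2) m3) _ (A.smul_mem A.one_mem _),
      hadd _ (add_mem m1 m2) _ m3, hadd _ m1 _ m2, hsmul _ _ (star_mem hc), hsmul _ _ hc,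
      hsmul _ _ A.one_mem, h0, hone] at h
    simpa using h
  have hreal : ∀ w : ℂ, (∀ r : ℝ, 0 ≤ (r : ℂ) * w + r * r) → w = 0 := by
    intro w hw
    have h1 := (Complex.le_def.1 (hw 1)).2
    have h2 := (Complex.le_def.1 (hw (-w.re / 2))).1
    simp only [Complex.add_re, Complex.re_ofReal_mul, Complex.ofReal_re, Complex.zero_re] at h2
    apply Complex.ext
    · simp only [Complex.zero_re]
      nlinarith
    · simpa using h1.symm
  have h1 := hreal (φ (star c) + φ c) fun r => by
    have := key r
    simp only [RCLike.star_def, Complex.conj_ofReal] at this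
    convert this using 1
    ring
  have h2 := hreal (Complex.I * (φ (star c) - φ c)) fun r => by
    have := key (r * Complex.I)
    simp only [RCLike.star_def, map_mul, Complex.conj_ofReal, Complex.conj_I] at this
    convert this using 1
    linear_combination (r * r : ℂ) * Complex.I_mul_I
  have h3 : φ (star c) - φ c = 0 := (mul_eq_zero.1 h2).resolve_left Complex.I_ne_zero
  linear_combination (h1 - h3) / 2

variable {A : StarSubalgebra ℂ (H →L[ℂ] H)} [hclosed : IsClosed (A : Set (H →L[ℂ] H))]

open Classical in
/-- The extension by zero of a character of `A`. -/
noncomputable def characterExtend (χ : characterSpace ℂ A) (y : H →L[ℂ] H) : ℂ :=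
  if h : y ∈ A then χ ⟨y, h⟩ else 0

lemma characterExtend_coe (χ : characterSpace ℂ A) (a : A) :
    characterExtend χ (a : H →L[ℂ] H) = χ a := dif_pos a.2

lemma isPureStateOn_characterExtend (χ : characterSpace ℂ A) :
    IsPureStateOn (A : Set (H →L[ℂ] H)) (characterExtend χ) := by
  have hcoe := characterExtend_coe χ
  refine ⟨⟨fun x hx y hy => ?_, fun c x hx => ?_, ?_, ?_, fun x hx => ?_⟩, ?_⟩
  · lift x to A using hx
    lift y to A using hy
    rw [← AddMemClass.coe_add]
    simp only [hcoe, map_add]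
  · lift x to A using hx
    have := hcoe (c • x)
    rw [map_smul, smul_eq_mul] at this
    rwa [hcoe]
  · rw [continuousOn_iff_continuous_domRestrict]
    have : Set.domRestrict (A : Set (H →L[ℂ] H)) (characterExtend χ) = fun a : A => χ a :=
      funext hcoe
    rw [this]
    exact map_continuous χ
  · simpa using hcoe 1
  · lift x to A using hx
    have := hcoe (star x * x)
    rw [MulMemClass.coe_mul, StarMemClass.coe_star] at this
    rw [this]
    exact characterSpace_apply_nonneg χ (star_mul_self_nonneg (x : H →L[ℂ] H))
  · intro ψ₁ ψ₂ h₁ h₂ t ht0 ht1 hψ x hx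
    lift x to A using hx
    set c : A := x - algebraMap ℂ A (χ x) with hc
    have hχc : χ (star c * c) = 0 := by
      have : χ c = 0 := by
        rw [hc, map_sub, AlgHomClass.commutes]
        simp
      rw [map_mul, this, mul_zero]
    have hsum := hψ _ (star c * c).2
    rw [hcoe, hχc] at hsum
    have hp₁ := h₁.2.2.2.2 c c.2
    have hp₂ := h₂.2.2.2.2 c c.2
    have ht1' : (0 : ℂ) < 1 - (t : ℂ) := by
      rw [← Complex.ofReal_one, ← Complex.ofReal_sub]
      exact_mod_cast sub_pos.2 ht1
    have ht0' : (0 : ℂ) < t := by exact_mod_cast ht0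
    have hz := (add_eq_zero_iff_of_nonneg (mul_nonneg ht0'.le hp₁)
      (mul_nonneg ht1'.le hp₂)).1 hsum.symm
    have hz₁ := (mul_eq_zero.1 hz.1).resolve_left ht0'.ne'
    have hz₂ := (mul_eq_zero.1 hz.2).resolve_left ht1'.ne'
    have hx : (x : H →L[ℂ] H) = c + χ x • 1 := by
      simp [hc, Algebra.algebraMap_eq_smul_one]
    have heval : ∀ ψ, IsStateOn (A : Set (H →L[ℂ] H)) ψ →
        ψ (star (c : H →L[ℂ] H) * c) = 0 → ψ x = χ x := by
      intro ψ hψ h0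
      have hc0 := hψ.apply_eq_zero_of_star_mul_self c.2 h0
      rw [hx, hψ.1 _ c.2 _ (A.smul_mem A.one_mem _), hψ.2.1 _ _ A.one_mem, hψ.2.2.2.1, hc0]
      ring
    rw [hcoe]
    exact ⟨heval ψ₁ h₁ hz₁, heval ψ₂ h₂ hz₂⟩

lemma IsPositiveExtension.isStateOn {χ : characterSpace ℂ A} {Φ : StrongDual ℂ (H →L[ℂ] H)}
    (hΦ : IsPositiveExtension χ Φ) (S : Set (H →L[ℂ] H)) : IsStateOn S Φ :=
  ⟨fun x _ y _ => map_add Φ x y, fun c x _ => map_smul Φ c x, Φ.continuous.continuousOn,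
    by simpa using hΦ.apply_coe 1, fun x _ => hΦ.star_mul_self_nonneg x⟩

end States

open ComplexStarModule

/-- If every pure state on the MASA `A` has a unique state extension to `M`, then
`C_A(x) ∩ A ≠ ∅` for every `x ∈ M`. -/
theorem stmt_5 {H : Type*} [NormedAddCommGroup H] [InnerProductSpace ℂ H] [CompleteSpace H]
    (M : VonNeumannAlgebra H) (A : StarSubalgebra ℂ (H →L[ℂ] H))
    (hMASA : ∀ y : H →L[ℂ] H, y ∈ A ↔ (y ∈ M ∧ ∀ a ∈ A, a * y = y * a))
    (hKS : ∀ ψ : (H →L[ℂ] H) → ℂ, IsPureStateOn (A : Set (H →L[ℂ] H)) ψ →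
      (∃ φ : (H →L[ℂ] H) → ℂ, IsStateOn (M : Set (H →L[ℂ] H)) φ ∧ ∀ a ∈ A, φ a = ψ a) ∧
      (∀ φ₁ φ₂ : (H →L[ℂ] H) → ℂ,
        IsStateOn (M : Set (H →L[ℂ] H)) φ₁ → IsStateOn (M : Set (H →L[ℂ] H)) φ₂ →
        (∀ a ∈ A, φ₁ a = ψ a) → (∀ a ∈ A, φ₂ a = ψ a) → ∀ x ∈ M, φ₁ x = φ₂ x)) :
    ∀ x ∈ M, (CA A x ∩ (A : Set (H →L[ℂ] H))).Nonempty := by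
  have hAM : ∀ a ∈ A, a ∈ M := fun a ha => ((hMASA a).1 ha).1
  have hA : ∀ a ∈ A, ∀ b ∈ A, a * b = b * a := fun a ha b hb => ((hMASA b).1 hb).2 a ha
  have hclosed : IsClosed (A : Set (H →L[ℂ] H)) := by
    have h : (A : Set (H →L[ℂ] H)) = (M : Set (H →L[ℂ] H)) ∩ Set.centralizer A := by
      ext y
      exact hMASA y
    rw [h, ← M.centralizer_centralizer]
    exact (Set.isClosed_centralizer _).inter (Set.isClosed_centralizer _)
  have hself : ∀ x ∈ M, IsSelfAdjoint x → ∃ a ∈ A, AveragesToZero A (x - a) := by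
    intro x hx hxs
    refine exists_mem_averagesToZero_sub_of_unique_extension hA hxs fun χ Φ Ψ hΦ hΨ => ?_
    refine (hKS _ (isPureStateOn_characterExtend χ)).2 Φ Ψ (hΦ.isStateOn _) (hΨ.isStateOn _)
      (fun a ha => ?_) (fun a ha => ?_) x hx
    · exact (hΦ.apply_coe ⟨a, ha⟩).trans (characterExtend_coe χ ⟨a, ha⟩).symm
    · exact (hΨ.apply_coe ⟨a, ha⟩).trans (characterExtend_coe χ ⟨a, ha⟩).symm
  have hsmul : ∀ (c : ℂ) {y : H →L[ℂ] H}, y ∈ M → c • y ∈ M := fun c _ hy =>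
    M.toStarSubalgebra.smul_mem hy c
  intro x hx
  have hre : (ℜ x : H →L[ℂ] H) ∈ M := by
    rw [realPart_apply_coe, ← Complex.coe_smul]
    exact hsmul _ (add_mem hx (star_mem hx))
  have him : (ℑ x : H →L[ℂ] H) ∈ M := by
    rw [imaginaryPart_apply_coe, ← Complex.coe_smul]
    exact hsmul _ (hsmul _ (sub_mem hx (star_mem hx)))
  obtain ⟨a, ha, hxa⟩ := hself _ hre (ℜ x).2
  obtain ⟨b, hb, hxb⟩ := hself _ him (ℑ x).2
  have hab : a + Complex.I • b ∈ A := add_mem ha (A.smul_mem hb _)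
  refine ⟨a + Complex.I • b, Metric.mem_closure_iff.2 fun ε hε => ?_, hab⟩
  obtain ⟨T, hT, hTle⟩ := (hxa.add hA (hxb.smul Complex.I)) (ε / 2) (half_pos hε)
  refine ⟨T x, averagingMaps_apply_mem_convexHull hT x, ?_⟩
  have h : (ℜ x : H →L[ℂ] H) - a + Complex.I • ((ℑ x : H →L[ℂ] H) - b)
      = x - (a + Complex.I • b) := by
    conv_rhs => rw [← realPart_add_I_smul_imaginaryPart x]
    rw [smul_sub]
    abel
  rw [h, map_sub, averagingMaps_apply_of_mem hA hT hab] at hTle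
  rw [dist_comm, dist_eq_norm]
  linarith
end

section
/- The following are equivalent: (i) every pure state on A has a unique extension to a state on M (the Kadison–Singer property); (ii) for every x ∈ M and every ε > 0 there exists a finite partition of 1 in A by projections q₁, …, q_n such that the distance in operator norm from Σ_{k=1}^n q_k x q_k to A is at most ε (the paving property). -/
open scoped ComplexOrder

section Paving

open scoped ComplexStarModule

variable {H : Type*} [NormedAddCommGroup H] [InnerProductSpace ℂ H] [CompleteSpace H]

/-- A star subalgebra contains the bicommutant of each of its self-adjoint elements. -/
def ContainsBicommutants (A : StarSubalgebra ℂ (H →L[ℂ] H)) : Prop :=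
  ∀ b ∈ A, IsSelfAdjoint b → ∀ y : H →L[ℂ] H, (∀ z, Commute b z → Commute y z) → y ∈ A

theorem containsBicommutants_of_masa {M : VonNeumannAlgebra H}
    {A : StarSubalgebra ℂ (H →L[ℂ] H)}
    (hMASA : ∀ y : H →L[ℂ] H, y ∈ A ↔ (y ∈ M ∧ ∀ a ∈ A, a * y = y * a)) :
    ContainsBicommutants A := by
  intro b hb _ y hy
  refine (hMASA y).2 ⟨?_, fun a ha => (hy a (((hMASA b).1 hb).2 a ha).symm).eq.symm⟩
  rw [← VonNeumannAlgebra.commutant_commutant M, VonNeumannAlgebra.mem_commutant_iff]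
  intro z hz
  exact (hy z (VonNeumannAlgebra.mem_commutant_iff.1 hz b ((hMASA b).1 hb).1)).eq.symm

theorem isClosed_of_masa {M : VonNeumannAlgebra H} {A : StarSubalgebra ℂ (H →L[ℂ] H)}
    (hMASA : ∀ y : H →L[ℂ] H, y ∈ A ↔ (y ∈ M ∧ ∀ a ∈ A, a * y = y * a)) :
    IsClosed (A : Set (H →L[ℂ] H)) := by
  have h : (A : Set (H →L[ℂ] H)) =
      Set.centralizer (Set.centralizer (M : Set (H →L[ℂ] H))) ∩ Set.centralizer A := by
    ext y
    rw [VonNeumannAlgebra.centralizer_centralizer]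
    exact hMASA y
  rw [h]
  exact (Set.isClosed_centralizer _).inter (Set.isClosed_centralizer _)

theorem exists_isStarProjection_mul_nonneg {A : StarSubalgebra ℂ (H →L[ℂ] H)}
    (hA : ContainsBicommutants A) {b : H →L[ℂ] H} (hb : b ∈ A) (hbs : IsSelfAdjoint b) :
    ∃ q ∈ A, IsStarProjection q ∧ b⁺ ∈ A ∧ b⁻ ∈ A ∧ q * b⁺ = b⁺ ∧ 0 ≤ q * b * q := by
  have hpc : ∀ z, Commute b z → Commute (b⁺) z := fun z hz => by
    rw [CFC.posPart_def]; exact hz.cfcₙ_real _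
  have hnc : ∀ z, Commute b z → Commute (b⁻) z := fun z hz => by
    rw [CFC.negPart_def]; exact hz.cfcₙ_real _
  have hps : IsSelfAdjoint (b⁺) := .of_nonneg (CFC.posPart_nonneg b)
  set K : Submodule ℂ H := LinearMap.ker (b⁺ : H →L[ℂ] H).toLinearMap with hK
  have hKc : IsClosed (K : Set H) := (b⁺ : H →L[ℂ] H).isClosed_ker
  have : CompleteSpace K := hKc.completeSpace_coe
  have hmem : ∀ v, v ∈ K ↔ (b⁺ : H →L[ℂ] H) v = 0 := fun v => LinearMap.mem_ker
  set e : H →L[ℂ] H := K.starProjection with he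
  have hes : IsStarProjection e := isStarProjection_starProjection
  have hpe : b⁺ * e = 0 := by
    ext v
    exact (hmem _).1 (K.starProjection_apply_mem v)
  have hep : e * b⁺ = 0 := by
    have := congrArg star hpe
    simpa [hps.star_eq, hes.isSelfAdjoint.star_eq] using this
  have hke : ∀ y : H →L[ℂ] H, b⁺ * y = 0 → e * y = y := by
    intro y hy
    ext v
    exact K.starProjection_eq_self_iff.2 ((hmem _).2 (by simpa using congrArg (fun T => T v) hy))
  have hinv : ∀ z, Commute b z → e * z * e = z * e := by
    intro z hz
    rw [mul_assoc]
    exact hke _ (by rw [← mul_assoc, (hpc z hz).eq, mul_assoc, hpe, mul_zero])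
  have hec : ∀ z, Commute b z → Commute e z := by
    intro z hz
    have h1 := hinv z hz
    have hz' : Commute b (star z) := by
      have := hz.star_star
      rwa [hbs.star_eq] at this
    have h2 := congrArg star (hinv (star z) hz')
    simp only [star_mul, star_star, hes.isSelfAdjoint.star_eq] at h2
    rw [← mul_assoc] at h2
    exact h2.symm.trans h1
  have heb : e * b⁻ = b⁻ := hke _ (CFC.posPart_mul_negPart b)
  refine ⟨1 - e, sub_mem (one_mem _) (hA b hb hbs e hec), hes.one_sub, hA b hb hbs _ hpc,
    hA b hb hbs _ hnc, by rw [sub_mul, hep, one_mul, sub_zero], ?_⟩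
  have hqb : (1 - e) * b = b⁺ := by
    conv_lhs => rw [← CFC.posPart_sub_negPart b hbs]
    rw [mul_sub, sub_mul, sub_mul, hep, heb]
    simp
  rw [hqb, mul_sub, hpe, mul_one, sub_zero]
  exact CFC.posPart_nonneg b

namespace IsStateOn

variable {S : StarSubalgebra ℂ (H →L[ℂ] H)} {φ : (H →L[ℂ] H) → ℂ}

theorem map_add (h : IsStateOn (S : Set (H →L[ℂ] H)) φ) {x y : H →L[ℂ] H} (hx : x ∈ S)
    (hy : y ∈ S) : φ (x + y) = φ x + φ y := h.1 x hx y hy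

theorem map_smul (h : IsStateOn (S : Set (H →L[ℂ] H)) φ) (c : ℂ) {x : H →L[ℂ] H}
    (hx : x ∈ S) : φ (c • x) = c * φ x := h.2.1 c x hx

theorem map_one (h : IsStateOn (S : Set (H →L[ℂ] H)) φ) : φ 1 = 1 := h.2.2.2.1

theorem map_star_mul_self_nonneg (h : IsStateOn (S : Set (H →L[ℂ] H)) φ) {x : H →L[ℂ] H}
    (hx : x ∈ S) : 0 ≤ φ (star x * x) := h.2.2.2.2 x hx

theorem map_zero (h : IsStateOn (S : Set (H →L[ℂ] H)) φ) : φ 0 = 0 := by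
  simpa using h.map_smul 0 (zero_mem S)

theorem map_neg (h : IsStateOn (S : Set (H →L[ℂ] H)) φ) {x : H →L[ℂ] H} (hx : x ∈ S) :
    φ (-x) = -φ x := by
  simpa using h.map_smul (-1) hx

theorem map_sub (h : IsStateOn (S : Set (H →L[ℂ] H)) φ) {x y : H →L[ℂ] H} (hx : x ∈ S)
    (hy : y ∈ S) : φ (x - y) = φ x - φ y := by
  rw [sub_eq_add_neg, h.map_add hx (neg_mem hy), h.map_neg hy, sub_eq_add_neg]

theorem map_sum (h : IsStateOn (S : Set (H →L[ℂ] H)) φ) {ι : Type*} (s : Finset ι)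
    (f : ι → H →L[ℂ] H) (hf : ∀ i ∈ s, f i ∈ S) : φ (∑ i ∈ s, f i) = ∑ i ∈ s, φ (f i) := by
  classical
  induction s using Finset.induction_on with
  | empty => simpa using h.map_zero
  | insert i s hi ih =>
    rw [Finset.sum_insert hi, Finset.sum_insert hi,
      h.map_add (hf i (by simp)) (sum_mem fun j hj => hf j (by simp [hj])),
      ih fun j hj => hf j (by simp [hj])]

theorem mono {T : StarSubalgebra ℂ (H →L[ℂ] H)} (h : IsStateOn (S : Set (H →L[ℂ] H)) φ)
    (hTS : T ≤ S) : IsStateOn (T : Set (H →L[ℂ] H)) φ :=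
  ⟨fun x hx y hy => h.1 x (hTS hx) y (hTS hy), fun c x hx => h.2.1 c x (hTS hx),
    h.2.2.1.mono hTS, h.2.2.2.1, fun x hx => h.2.2.2.2 x (hTS hx)⟩

theorem cross_terms_eq_zero (h : IsStateOn (S : Set (H →L[ℂ] H)) φ) {x y : H →L[ℂ] H}
    (hx : x ∈ S) (hy : y ∈ S) (h0 : φ (star x * x) = 0) :
    φ (star y * x) = 0 ∧ φ (star x * y) = 0 := by
  have key : ∀ c : ℂ,
      0 ≤ φ (star y * y) + (c * φ (star y * x) + star c * φ (star x * y)) := by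
    intro c
    have hyy := mul_mem (star_mem hy) hy
    have hyx := mul_mem (star_mem hy) hx
    have hxy := mul_mem (star_mem hx) hy
    have hxx := mul_mem (star_mem hx) hx
    have h1 := h.map_star_mul_self_nonneg (add_mem hy (S.smul_mem hx c))
    have h2 : star (y + c • x) * (y + c • x) =
        star y * y + (c • (star y * x) + (star c • (star x * y) +
          (c * star c) • (star x * x))) := by
      simp only [star_add, star_smul, add_mul, mul_add, smul_mul_assoc, mul_smul_comm, smul_add,
        smul_smul]
      abel
    rw [h2, h.map_add hyy (add_mem (S.smul_mem hyx c) (add_mem (S.smul_mem hxy _)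
      (S.smul_mem hxx _))), h.map_add (S.smul_mem hyx c) (add_mem (S.smul_mem hxy _)
      (S.smul_mem hxx _)), h.map_add (S.smul_mem hxy _) (S.smul_mem hxx _),
      h.map_smul _ hyx, h.map_smul _ hxy, h.map_smul _ hxx, h0, mul_zero, add_zero] at h1
    exact h1
  have hK := h.map_star_mul_self_nonneg hy
  generalize φ (star y * y) = K at *
  generalize φ (star y * x) = u at *
  generalize φ (star x * y) = v at *
  have hK0 : K.im = 0 := (Complex.nonneg_iff.1 hK).2.symm
  have k1 := fun r : ℝ => Complex.nonneg_iff.1 (key (r : ℂ))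
  have k2 := fun r : ℝ => Complex.nonneg_iff.1 (key (r * Complex.I : ℂ))
  simp [hK0] at k1 k2
  have lin : ∀ s : ℝ, (∀ r : ℝ, 0 ≤ K.re + r * s) → s = 0 := by
    intro s hs
    by_contra hne
    have := hs (-(K.re + 1) / s)
    rw [div_mul_cancel₀ _ hne] at this
    linarith
  have e1 := lin (u.re + v.re) fun r => by linarith [(k1 r).1]
  have e2 := lin (v.im - u.im) fun r => by linarith [(k2 r).1]
  have e3 := (k1 1).2
  have e4 := (k2 1).2
  constructor <;> apply Complex.ext <;> simp <;> linarith

end IsStateOn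

theorem norm_le_of_self_adjoint_bounds {y : H →L[ℂ] H} (hy : IsSelfAdjoint y) {r : ℝ}
    (h1 : y ≤ algebraMap ℝ _ r) (h2 : -y ≤ algebraMap ℝ _ r) (hr : 0 ≤ r) : ‖y‖ ≤ r := by
  rcases subsingleton_or_nontrivial (H →L[ℂ] H) with hs | hs
  · rw [Subsingleton.elim y 0, norm_zero]
    exact hr
  · rcases CStarAlgebra.norm_or_neg_norm_mem_spectrum hy with h | h
    · exact (le_algebraMap_iff_spectrum_le hy).1 h1 _ h
    · refine (le_algebraMap_iff_spectrum_le hy.neg).1 h2 _ ?_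
      rw [← spectrum.neg_eq]
      simpa using h

/-- Evaluating on the real and imaginary part turns a unital positive real functional on the
self-adjoint operators into a state. -/
theorem isStateOn_complexification (g : selfAdjoint (H →L[ℂ] H) →ₗ[ℝ] ℝ)
    (hpos : ∀ y : selfAdjoint (H →L[ℂ] H), 0 ≤ (y : H →L[ℂ] H) → 0 ≤ g y) (hone : g 1 = 1) :
    IsStateOn ((⊤ : StarSubalgebra ℂ (H →L[ℂ] H)) : Set (H →L[ℂ] H))
      (fun x => (g (ℜ x) : ℂ) + Complex.I * g (ℑ x)) := by
  have hbound : ∀ y : selfAdjoint (H →L[ℂ] H), |g y| ≤ ‖y‖ := by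
    intro y
    have hy : IsSelfAdjoint (y : H →L[ℂ] H) := y.2
    have e1 := hpos (‖y‖ • 1 - y) (by
      simpa [Algebra.algebraMap_eq_smul_one] using hy.le_algebraMap_norm_self)
    have e2 := hpos (‖y‖ • 1 + y) (by
      have := hy.neg_algebraMap_norm_le_self
      rw [neg_le_iff_add_nonneg'] at this
      simpa [Algebra.algebraMap_eq_smul_one] using this)
    simp only [map_sub, map_add, map_smul, hone, smul_eq_mul, mul_one] at e1 e2
    exact abs_le.2 ⟨by linarith, by linarith⟩
  have hcont : Continuous g :=
    (g.mkContinuous 1 fun y => by simpa using hbound y).continuous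
  have hre : Continuous fun x : H →L[ℂ] H => ℜ x := by
    refine continuous_induced_rng.2 ?_
    simp only [Function.comp_def, realPart_apply_coe]
    fun_prop
  have him : Continuous fun x : H →L[ℂ] H => ℑ x := by
    refine continuous_induced_rng.2 ?_
    simp only [Function.comp_def, imaginaryPart_apply_coe]
    fun_prop
  refine ⟨?_, ?_, ?_, ?_, ?_⟩
  · intro x _ y _
    simp only [map_add, Complex.ofReal_add]
    ring
  · intro c x _
    simp only [realPart_smul, imaginaryPart_smul, g.map_sub, g.map_add, g.map_smul, smul_eq_mul]
    apply Complex.ext <;> simp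
  · exact Continuous.continuousOn (by fun_prop)
  · have h1 : IsSelfAdjoint (1 : H →L[ℂ] H) := .one _
    have h2 : ℜ (1 : H →L[ℂ] H) = 1 := Subtype.ext h1.coe_realPart
    simp [h2, hone, h1.imaginaryPart]
  · intro x _
    have h1 : IsSelfAdjoint (star x * x) := .star_mul_self x
    simp only [h1.imaginaryPart, map_zero, Complex.ofReal_zero, mul_zero, add_zero]
    exact_mod_cast hpos _ (by rw [h1.coe_realPart]; exact star_mul_self_nonneg x)

/-- The infimum of the values of `ψ` at the elements of `A` dominating `x`. -/
noncomputable def upperValue (A : StarSubalgebra ℂ (H →L[ℂ] H)) (ψ : (H →L[ℂ] H) → ℂ)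
    (x : H →L[ℂ] H) : ℝ :=
  sInf {r | ∃ a ∈ A, x ≤ a ∧ r = (ψ a).re}

namespace IsStateOn

variable {A : StarSubalgebra ℂ (H →L[ℂ] H)} {ψ : (H →L[ℂ] H) → ℂ}

theorem nonneg_of_nonneg (h : IsStateOn (A : Set (H →L[ℂ] H)) ψ) (hA : ContainsBicommutants A)
    {a : H →L[ℂ] H} (ha : a ∈ A) (h0 : 0 ≤ a) : 0 ≤ ψ a := by
  have hs : CFC.sqrt a ∈ A := hA a ha (.of_nonneg h0) _ fun z hz => hz.cfcₙ_nnreal _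
  have hss : star (CFC.sqrt a) = CFC.sqrt a := (IsSelfAdjoint.of_nonneg (CFC.sqrt_nonneg a)).star_eq
  have := h.map_star_mul_self_nonneg hs
  rwa [hss, CFC.sqrt_mul_sqrt_self a] at this

theorem re_le_re (h : IsStateOn (A : Set (H →L[ℂ] H)) ψ) (hA : ContainsBicommutants A)
    {a b : H →L[ℂ] H} (ha : a ∈ A) (hb : b ∈ A) (hab : a ≤ b) : (ψ a).re ≤ (ψ b).re := by
  have := h.nonneg_of_nonneg hA (sub_mem hb ha) (sub_nonneg.2 hab)
  rw [h.map_sub hb ha] at this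
  simpa using (Complex.nonneg_iff.1 this).1

theorem map_real_smul_one (h : IsStateOn (A : Set (H →L[ℂ] H)) ψ) (r : ℝ) :
    ψ (algebraMap ℝ _ r) = r := by
  have := h.map_smul r (one_mem A)
  rw [h.map_one, mul_one] at this
  rw [← this, Algebra.algebraMap_eq_smul_one, Complex.coe_smul]

theorem algebraMap_real_mem (A : StarSubalgebra ℂ (H →L[ℂ] H)) (r : ℝ) :
    algebraMap ℝ (H →L[ℂ] H) r ∈ A := by
  rw [Algebra.algebraMap_eq_smul_one, ← Complex.coe_smul]
  exact A.smul_mem (one_mem A) _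

theorem upperValue_le (h : IsStateOn (A : Set (H →L[ℂ] H)) ψ) (hA : ContainsBicommutants A)
    {x a : H →L[ℂ] H} (hx : IsSelfAdjoint x) (ha : a ∈ A) (hxa : x ≤ a) :
    upperValue A ψ x ≤ (ψ a).re := by
  refine csInf_le ⟨-‖x‖, ?_⟩ ⟨a, ha, hxa, rfl⟩
  rintro _ ⟨b, hb, hxb, rfl⟩
  have h1 : algebraMap ℝ (H →L[ℂ] H) (-‖x‖) ≤ b := by
    rw [_root_.map_neg]
    exact hx.neg_algebraMap_norm_le_self.trans hxb
  have := h.re_le_re hA (algebraMap_real_mem A _) hb h1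
  rwa [h.map_real_smul_one, Complex.ofReal_re] at this

theorem exists_lt_of_upperValue_lt {x : H →L[ℂ] H} (hx : IsSelfAdjoint x) {t : ℝ}
    (ht : upperValue A ψ x < t) : ∃ a ∈ A, x ≤ a ∧ (ψ a).re < t := by
  have hne : {r | ∃ a ∈ A, x ≤ a ∧ r = (ψ a).re}.Nonempty :=
    ⟨_, algebraMap ℝ _ ‖x‖, algebraMap_real_mem A _, hx.le_algebraMap_norm_self, rfl⟩
  obtain ⟨_, ⟨a, ha, hxa, rfl⟩, hlt⟩ := exists_lt_of_csInf_lt hne ht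
  exact ⟨a, ha, hxa, hlt⟩

theorem upperValue_eq (h : IsStateOn (A : Set (H →L[ℂ] H)) ψ) (hA : ContainsBicommutants A)
    {a : H →L[ℂ] H} (ha : a ∈ A) (has : IsSelfAdjoint a) : upperValue A ψ a = (ψ a).re := by
  refine le_antisymm (h.upperValue_le hA has ha le_rfl) (le_of_forall_gt fun t ht => ?_)
  obtain ⟨b, hb, hab, hlt⟩ := exists_lt_of_upperValue_lt has ht
  exact (h.re_le_re hA ha hb hab).trans_lt hlt

theorem upperValue_add_le (h : IsStateOn (A : Set (H →L[ℂ] H)) ψ) (hA : ContainsBicommutants A)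
    {x y : H →L[ℂ] H} (hx : IsSelfAdjoint x) (hy : IsSelfAdjoint y) :
    upperValue A ψ (x + y) ≤ upperValue A ψ x + upperValue A ψ y := by
  refine le_of_forall_pos_le_add fun ε hε => ?_
  obtain ⟨a, ha, hxa, hlt⟩ := exists_lt_of_upperValue_lt (A := A) (ψ := ψ) hx
    (lt_add_of_pos_right _ (half_pos hε))
  obtain ⟨b, hb, hyb, hlt'⟩ := exists_lt_of_upperValue_lt (A := A) (ψ := ψ) hy
    (lt_add_of_pos_right _ (half_pos hε))
  have := h.upperValue_le hA (hx.add hy) (add_mem ha hb) (add_le_add hxa hyb)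
  rw [h.map_add ha hb, Complex.add_re] at this
  linarith

theorem upperValue_smul_le (h : IsStateOn (A : Set (H →L[ℂ] H)) ψ) (hA : ContainsBicommutants A)
    {x : H →L[ℂ] H} (hx : IsSelfAdjoint x) {c : ℝ} (hc : 0 < c) :
    upperValue A ψ (c • x) ≤ c * upperValue A ψ x := by
  rw [← div_le_iff₀' hc]
  refine le_of_forall_gt fun t ht => ?_
  obtain ⟨a, ha, hxa, hlt⟩ := exists_lt_of_upperValue_lt hx ht
  rw [div_lt_iff₀' hc]
  have hca : c • a ∈ A := by rw [← Complex.coe_smul]; exact A.smul_mem ha _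
  have := h.upperValue_le hA (IsSelfAdjoint.smul (.all c) hx) hca
    (smul_le_smul_of_nonneg_left hxa hc.le)
  rw [← Complex.coe_smul c a, h.map_smul _ ha, Complex.re_ofReal_mul] at this
  exact this.trans_lt (mul_lt_mul_of_pos_left hlt hc)

theorem upperValue_smul (h : IsStateOn (A : Set (H →L[ℂ] H)) ψ) (hA : ContainsBicommutants A)
    {x : H →L[ℂ] H} (hx : IsSelfAdjoint x) {c : ℝ} (hc : 0 < c) :
    upperValue A ψ (c • x) = c * upperValue A ψ x := by
  refine le_antisymm (h.upperValue_smul_le hA hx hc) ?_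
  have := h.upperValue_smul_le hA (IsSelfAdjoint.smul (.all c) hx) (inv_pos.2 hc)
  rwa [inv_smul_smul₀ hc.ne', ← div_eq_inv_mul, le_div_iff₀' hc] at this

/-- A state on `A` extends to a state on all bounded operators that takes the largest possible
value at a given self-adjoint operator. -/
theorem exists_extension (h : IsStateOn (A : Set (H →L[ℂ] H)) ψ) (hA : ContainsBicommutants A)
    {x : H →L[ℂ] H} (hx : IsSelfAdjoint x) :
    ∃ φ, IsStateOn ((⊤ : StarSubalgebra ℂ (H →L[ℂ] H)) : Set (H →L[ℂ] H)) φ ∧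
      (∀ a ∈ A, φ a = ψ a) ∧ φ x = upperValue A ψ x := by
  let N : selfAdjoint (H →L[ℂ] H) → ℝ := fun y => upperValue A ψ y
  have hN_eq : ∀ y : selfAdjoint (H →L[ℂ] H), (y : H →L[ℂ] H) ∈ A → N y = (ψ y).re :=
    fun y hy => h.upperValue_eq hA hy y.2
  have hN0 : N 0 = 0 := by
    rw [hN_eq 0 (zero_mem A)]
    simp [h.map_zero]
  have hN_smul : ∀ c : ℝ, 0 < c → ∀ y, N (c • y) = c * N y := fun c hc y =>
    h.upperValue_smul hA y.2 hc
  have hN_add : ∀ y z, N (y + z) ≤ N y + N z := fun y z => h.upperValue_add_le hA y.2 z.2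
  let x' : selfAdjoint (H →L[ℂ] H) := ⟨x, hx⟩
  let f : selfAdjoint (H →L[ℂ] H) →ₗ.[ℝ] ℝ := LinearPMap.mkSpanSingleton' x' (N x') (by
    intro c hc
    have hc' : c • x = 0 := congrArg Subtype.val hc
    rcases smul_eq_zero.1 hc' with h0 | h0
    · simp [h0]
    · have h1 : x' = 0 := Subtype.ext h0
      simp [h1, hN0])
  obtain ⟨g, hgf, hgN⟩ := exists_extension_of_le_sublinear f N hN_smul hN_add (by
    rintro ⟨y, hy⟩
    obtain ⟨c, rfl⟩ := Submodule.mem_span_singleton.1 hy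
    rw [LinearPMap.mkSpanSingleton'_apply, RingHom.id_apply, smul_eq_mul]
    rcases lt_trichotomy c 0 with hc | hc | hc
    · have h1 := hN_add (c • x') ((-c) • x')
      have h2 : c • x' + (-c) • x' = 0 := Subtype.ext (by
        change c • x + (-c) • x = 0
        rw [← add_smul, add_neg_cancel, zero_smul])
      rw [hN_smul (-c) (neg_pos.2 hc), h2, hN0] at h1
      change c * N x' ≤ N (c • x')
      linarith
    · have h2 : c • x' = 0 := Subtype.ext (by
        change c • x = 0
        rw [hc, zero_smul])
      change c * N x' ≤ N (c • x')
      rw [h2, hN0, hc, zero_mul]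
    · exact (hN_smul c hc x').ge)
  have hgA : ∀ y : selfAdjoint (H →L[ℂ] H), (y : H →L[ℂ] H) ∈ A → g y = (ψ y).re := by
    intro y hy
    refine le_antisymm ((hgN y).trans_eq (hN_eq y hy)) ?_
    have h1 := (hgN (-y)).trans_eq (hN_eq (-y) (neg_mem hy))
    rw [_root_.map_neg, NegMemClass.coe_neg, h.map_neg hy, Complex.neg_re] at h1
    linarith
  have hgpos : ∀ y : selfAdjoint (H →L[ℂ] H), 0 ≤ (y : H →L[ℂ] H) → 0 ≤ g y := by
    intro y hy
    have h1 := hgN (-y)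
    have h2 : N (-y) ≤ 0 := by
      have := h.upperValue_le hA (-y).2 (zero_mem A) (by simpa using hy)
      rwa [h.map_zero] at this
    rw [_root_.map_neg] at h1
    linarith
  have hgx : g x' = N x' := by
    rw [hgf ⟨x', Submodule.mem_span_singleton_self _⟩]
    exact LinearPMap.mkSpanSingleton'_apply_self ..
  have him : ∀ a ∈ A, IsSelfAdjoint a → (ψ a).im = 0 := by
    intro a ha has
    have h1 := h.nonneg_of_nonneg hA (sub_mem (algebraMap_real_mem A ‖a‖) ha)
      (sub_nonneg.2 has.le_algebraMap_norm_self)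
    rw [h.map_sub (algebraMap_real_mem A _) ha, h.map_real_smul_one] at h1
    simpa using (Complex.nonneg_iff.1 h1).2
  refine ⟨_, isStateOn_complexification g hgpos ?_, ?_, ?_⟩
  · rw [hgA 1 (one_mem A)]
    simp [h.map_one]
  · intro a ha
    have hre : (ℜ a : H →L[ℂ] H) ∈ A := by
      rw [realPart_apply_coe, ← Complex.coe_smul]
      exact A.smul_mem (add_mem ha (star_mem ha)) _
    have him' : (ℑ a : H →L[ℂ] H) ∈ A := by
      rw [imaginaryPart_apply_coe, ← Complex.coe_smul]
      exact A.smul_mem (A.smul_mem (sub_mem ha (star_mem ha)) _) _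
    have h1 : ∀ b ∈ A, IsSelfAdjoint b → (((ψ b).re : ℝ) : ℂ) = ψ b := fun b hb hbs =>
      Complex.ext rfl (by simp [him b hb hbs])
    rw [hgA _ hre, hgA _ him', h1 _ hre (ℜ a).2, h1 _ him' (ℑ a).2, ← h.map_smul _ him',
      ← h.map_add hre (A.smul_mem him' _), realPart_add_I_smul_imaginaryPart]
  · have h2 : ℜ x = x' := Subtype.ext hx.coe_realPart
    simp only [h2, hgx, hx.imaginaryPart]
    simp [N, x']

end IsStateOn

namespace IsStateOn

variable {S A : StarSubalgebra ℂ (H →L[ℂ] H)} {φ ψ : (H →L[ℂ] H) → ℂ}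

theorem map_isStarProjection_nonneg (h : IsStateOn (S : Set (H →L[ℂ] H)) φ) {q : H →L[ℂ] H}
    (hq : q ∈ S) (hqp : IsStarProjection q) : 0 ≤ φ q := by
  have := h.map_star_mul_self_nonneg hq
  rwa [hqp.isSelfAdjoint.star_eq, hqp.isIdempotentElem.eq] at this

theorem map_mul_eq_zero (h : IsStateOn (S : Set (H →L[ℂ] H)) φ) {q y : H →L[ℂ] H}
    (hq : q ∈ S) (hqp : IsStarProjection q) (hy : y ∈ S) (h0 : φ q = 0) :
    φ (y * q) = 0 ∧ φ (q * y) = 0 := by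
  have h1 : φ (star q * q) = 0 := by rwa [hqp.isSelfAdjoint.star_eq, hqp.isIdempotentElem.eq]
  have h2 := (h.cross_terms_eq_zero hq (star_mem hy) h1).1
  have h3 := (h.cross_terms_eq_zero hq hy h1).2
  rw [star_star] at h2
  rw [hqp.isSelfAdjoint.star_eq] at h3
  exact ⟨h2, h3⟩

/-- Compressing a state by a projection of positive mass in a commutative algebra gives a
state. -/
theorem compression (h : IsStateOn (A : Set (H →L[ℂ] H)) ψ)
    (hcomm : ∀ a ∈ A, ∀ b ∈ A, a * b = b * a) {q : H →L[ℂ] H} (hq : q ∈ A)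
    (hqp : IsStarProjection q) (h0 : ψ q ≠ 0) :
    IsStateOn (A : Set (H →L[ℂ] H)) (fun x => (ψ q)⁻¹ * ψ (q * x)) := by
  refine ⟨fun x hx y hy => ?_, fun c x hx => ?_, ?_, ?_, fun x hx => ?_⟩
  · simp only
    rw [mul_add, h.map_add (mul_mem hq hx) (mul_mem hq hy), mul_add]
  · simp only
    rw [mul_smul_comm, h.map_smul c (mul_mem hq hx)]
    ring
  · refine continuousOn_const.mul (h.2.2.1.comp ?_ fun x hx => mul_mem hq hx)
    exact (continuous_const.mul continuous_id).continuousOn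
  · simp [h0]
  · have h1 := h.map_star_mul_self_nonneg (mul_mem hx hq)
    have h2 : star (x * q) * (x * q) = q * (star x * x) := by
      rw [star_mul, hqp.isSelfAdjoint.star_eq, hcomm x hx q hq, mul_assoc,
        ← mul_assoc (star x) q x, hcomm (star x) (star_mem hx) q hq, ← mul_assoc, ← mul_assoc,
        hqp.isIdempotentElem.eq, mul_assoc]
    rw [h2] at h1
    have h3 : (0 : ℂ) ≤ (ψ q)⁻¹ := by
      have h4 := Complex.nonneg_iff.1 (h.map_isStarProjection_nonneg hq hqp)
      have h5 : ψ q = ((ψ q).re : ℂ) := Complex.ext rfl (by simpa using h4.2.symm)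
      rw [h5, ← Complex.ofReal_inv]
      exact_mod_cast inv_nonneg.2 h4.1
    exact mul_nonneg h3 h1

end IsStateOn

theorem IsPureStateOn.map_isStarProjection {A : StarSubalgebra ℂ (H →L[ℂ] H)}
    {ψ : (H →L[ℂ] H) → ℂ} (hψ : IsPureStateOn (A : Set (H →L[ℂ] H)) ψ)
    (hcomm : ∀ a ∈ A, ∀ b ∈ A, a * b = b * a) {q : H →L[ℂ] H} (hq : q ∈ A)
    (hqp : IsStarProjection q) : ψ q = 0 ∨ ψ (1 - q) = 0 := by
  by_contra! hne
  obtain ⟨h0, h1⟩ := hne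
  have hs := hψ.1
  have hq' : 1 - q ∈ A := sub_mem (one_mem A) hq
  have hmap : ψ (1 - q) = 1 - ψ q := by rw [hs.map_sub (one_mem A) hq, hs.map_one]
  have h4 := Complex.nonneg_iff.1 (hs.map_isStarProjection_nonneg hq hqp)
  have h5 : ψ q = ((ψ q).re : ℂ) := Complex.ext rfl (by simpa using h4.2.symm)
  have h6 := (Complex.nonneg_iff.1 (hs.map_isStarProjection_nonneg hq' hqp.one_sub)).1
  have ht0 : (ψ q).re ≠ 0 := fun h => h0 (by rw [h5, h, Complex.ofReal_zero])
  have ht1 : 1 - (ψ q).re ≠ 0 := fun h => h1 (by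
    rw [hmap, h5, ← Complex.ofReal_one, ← Complex.ofReal_sub, h, Complex.ofReal_zero])
  rw [hmap, Complex.sub_re, Complex.one_re] at h6
  have key := hψ.2 _ _ (hs.compression hcomm hq hqp h0)
    (hs.compression hcomm hq' hqp.one_sub h1) (ψ q).re (lt_of_le_of_ne h4.1 (Ne.symm ht0))
    (by linarith [lt_of_le_of_ne h6 (Ne.symm ht1)]) (fun x hx => by
      rw [← h5, ← hmap, mul_inv_cancel_left₀ h0, mul_inv_cancel_left₀ h1,
        ← hs.map_add (mul_mem hq hx) (mul_mem hq' hx), ← add_mul]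
      simp) q hq
  have := key.2
  rw [sub_mul, one_mul, hqp.isIdempotentElem.eq, sub_self, hs.map_zero, mul_zero] at this
  exact h0 this.symm

theorem IsStateOn.map_sum_conj {S : StarSubalgebra ℂ (H →L[ℂ] H)} {φ : (H →L[ℂ] H) → ℂ}
    (h : IsStateOn (S : Set (H →L[ℂ] H)) φ) {ι : Type*} [Fintype ι] {q : ι → H →L[ℂ] H}
    (hq : ∀ k, q k ∈ S) (hqp : ∀ k, IsStarProjection (q k)) (hsum : ∑ k, q k = 1)
    (h01 : ∀ k, φ (q k) = 0 ∨ φ (1 - q k) = 0) {x : H →L[ℂ] H} (hx : x ∈ S) :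
    φ (∑ k, q k * x * q k) = φ x := by
  have h1 : ∀ k, φ (q k * x * q k) = φ (q k * x) := by
    intro k
    have hqx := mul_mem (hq k) hx
    have h2 : φ (q k * x * (1 - q k)) = 0 := by
      rcases h01 k with h0 | h0
      · rw [mul_assoc]
        exact (h.map_mul_eq_zero (hq k) (hqp k)
          (mul_mem hx (sub_mem (one_mem S) (hq k))) h0).2
      · exact (h.map_mul_eq_zero (sub_mem (one_mem S) (hq k)) (hqp k).one_sub hqx h0).1
    rw [mul_sub, mul_one, h.map_sub hqx (mul_mem hqx (hq k))] at h2
    exact (sub_eq_zero.1 h2).symm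
  rw [h.map_sum _ _ fun k _ => mul_mem (mul_mem (hq k) hx) (hq k), Finset.sum_congr rfl
    fun k _ => h1 k, ← h.map_sum _ _ fun k _ => mul_mem (hq k) hx, ← Finset.sum_mul, hsum,
    one_mul]

/-- Two extensions of a pure state agree at every element that can be paved. -/
theorem IsPureStateOn.eq_of_paving {A S : StarSubalgebra ℂ (H →L[ℂ] H)} (hAS : A ≤ S)
    (hcomm : ∀ a ∈ A, ∀ b ∈ A, a * b = b * a) {ψ φ₁ φ₂ : (H →L[ℂ] H) → ℂ}
    (hψ : IsPureStateOn (A : Set (H →L[ℂ] H)) ψ) (h₁ : IsStateOn (S : Set (H →L[ℂ] H)) φ₁)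
    (h₂ : IsStateOn (S : Set (H →L[ℂ] H)) φ₂) (he₁ : ∀ a ∈ A, φ₁ a = ψ a)
    (he₂ : ∀ a ∈ A, φ₂ a = ψ a) {x : H →L[ℂ] H} (hx : x ∈ S)
    (hpave : ∀ ε > (0 : ℝ), ∃ (n : ℕ) (q : Fin n → (H →L[ℂ] H)),
      (∀ k, q k ∈ A) ∧ (∀ k, IsStarProjection (q k)) ∧ (∑ k, q k = 1) ∧
      Metric.infDist (∑ k, q k * x * q k) (A : Set (H →L[ℂ] H)) ≤ ε) : φ₁ x = φ₂ x := by
  refine eq_of_forall_dist_le fun ε hε => ?_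
  obtain ⟨δ₁, hδ₁, hc₁⟩ := Metric.continuousOn_iff.1 h₁.2.2.1 0 (zero_mem S) (ε / 2) (half_pos hε)
  obtain ⟨δ₂, hδ₂, hc₂⟩ := Metric.continuousOn_iff.1 h₂.2.2.1 0 (zero_mem S) (ε / 2) (half_pos hε)
  have hδ := lt_min hδ₁ hδ₂
  obtain ⟨n, q, hq, hqp, hsum, hdist⟩ := hpave _ (half_pos hδ)
  obtain ⟨a, ha, hlt⟩ := (Metric.infDist_lt_iff ⟨0, zero_mem A⟩).1
    (hdist.trans_lt (half_lt_self hδ))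
  have hyS : ∑ k, q k * x * q k ∈ S :=
    sum_mem fun k _ => mul_mem (mul_mem (hAS (hq k)) hx) (hAS (hq k))
  have hd : dist (∑ k, q k * x * q k - a) 0 < min δ₁ δ₂ := by
    rwa [dist_zero_right, ← dist_eq_norm]
  have key : ∀ φ : (H →L[ℂ] H) → ℂ, IsStateOn (S : Set (H →L[ℂ] H)) φ →
      (∀ a ∈ A, φ a = ψ a) → φ (∑ k, q k * x * q k - a) = φ x - ψ a := by
    intro φ h he
    rw [h.map_sub hyS (hAS ha), he a ha,
      h.map_sum_conj (fun k => hAS (hq k)) hqp hsum (fun k => ?_) hx]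
    rw [he _ (hq k), he _ (sub_mem (one_mem A) (hq k))]
    exact hψ.map_isStarProjection hcomm (hq k) (hqp k)
  have e₁ := hc₁ _ (sub_mem hyS (hAS ha)) (hd.trans_le (min_le_left _ _))
  have e₂ := hc₂ _ (sub_mem hyS (hAS ha)) (hd.trans_le (min_le_right _ _))
  rw [key _ h₁ he₁, h₁.map_zero, dist_zero_right] at e₁
  rw [key _ h₂ he₂, h₂.map_zero, dist_zero_right] at e₂
  rw [← dist_sub_right _ _ (ψ a)]
  have := dist_le_norm_add_norm (φ₁ x - ψ a) (φ₂ x - ψ a)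
  linarith

theorem exists_character_apply_eq_zero {B : Type*} [NormedRing B] [NormedAlgebra ℂ B]
    [CompleteSpace B] (hcomm : ∀ a b : B, a * b = b * a) {a : B} (ha : ¬IsUnit a) :
    ∃ f : WeakDual.characterSpace ℂ B, f a = 0 := by
  let _ : NormedCommRing B := { ‹NormedRing B› with mul_comm := hcomm }
  exact WeakDual.CharacterSpace.exists_apply_eq_zero ha

open Classical in
/-- The extension by zero of a functional defined on a star subalgebra. -/
noncomputable def extendByZero (A : StarSubalgebra ℂ (H →L[ℂ] H)) (f : A → ℂ)
    (x : H →L[ℂ] H) : ℂ :=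
  if h : x ∈ A then f ⟨x, h⟩ else 0

theorem extendByZero_apply {A : StarSubalgebra ℂ (H →L[ℂ] H)} (f : A → ℂ) {x : H →L[ℂ] H}
    (hx : x ∈ A) : extendByZero A f x = f ⟨x, hx⟩ := dif_pos hx

theorem isPureStateOn_character {A : StarSubalgebra ℂ (H →L[ℂ] H)}
    [IsClosed (A : Set (H →L[ℂ] H))] (χ : WeakDual.characterSpace ℂ A) :
    IsPureStateOn (A : Set (H →L[ℂ] H)) (extendByZero A χ) := by
  have hstar : ∀ x : A, χ (star x * x) = star (χ x) * χ x := fun x => by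
    rw [map_mul, map_star]
  have hS : IsStateOn (A : Set (H →L[ℂ] H)) (extendByZero A χ) := by
    refine ⟨fun x hx y hy => ?_, fun c x hx => ?_, ?_, ?_, fun x hx => ?_⟩
    · rw [extendByZero_apply _ hx, extendByZero_apply _ hy, extendByZero_apply _ (add_mem hx hy),
        ← map_add]
      rfl
    · rw [extendByZero_apply _ hx, extendByZero_apply _ (A.smul_mem hx c), ← smul_eq_mul,
        ← map_smul]
      rfl
    · rw [continuousOn_iff_continuous_domRestrict]
      have : Set.domRestrict (A : Set (H →L[ℂ] H)) (extendByZero A χ) = fun x => χ x :=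
        funext fun x => extendByZero_apply _ x.2
      rw [this]
      exact map_continuous χ
    · rw [extendByZero_apply _ (one_mem A)]
      exact map_one χ
    · rw [extendByZero_apply _ (mul_mem (star_mem hx) hx)]
      exact (star_mul_self_nonneg (χ ⟨x, hx⟩)).trans_eq (hstar ⟨x, hx⟩).symm
  refine ⟨hS, fun ψ₁ ψ₂ h₁ h₂ t ht0 ht1 heq x hx => ?_⟩
  set ψ := extendByZero A χ with hψ
  have hy : x - ψ x • 1 ∈ A := sub_mem hx (A.smul_mem (one_mem A) _)
  have hψy : ψ (x - ψ x • 1) = 0 := by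
    rw [hS.map_sub hx (A.smul_mem (one_mem A) _), hS.map_smul _ (one_mem A), hS.map_one, mul_one,
      sub_self]
  set y := x - ψ x • 1 with hydef
  have hyy := mul_mem (star_mem hy) hy
  have h0 : ψ (star y * y) = 0 := by
    rw [hψ, extendByZero_apply _ hyy]
    rw [hψ, extendByZero_apply _ hy] at hψy
    refine (hstar ⟨y, hy⟩).trans ?_
    rw [hψy, mul_zero]
  have hsum := heq _ hyy
  rw [h0] at hsum
  have p₁ := Complex.nonneg_iff.1 (h₁.map_star_mul_self_nonneg hy)
  have p₂ := Complex.nonneg_iff.1 (h₂.map_star_mul_self_nonneg hy)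
  have hre := congrArg Complex.re hsum
  simp only [Complex.zero_re, Complex.add_re, Complex.mul_re, Complex.ofReal_re, Complex.ofReal_im,
    Complex.sub_re, Complex.sub_im, Complex.one_re, Complex.one_im, zero_mul, sub_zero] at hre
  have ht1' : 0 < 1 - t := sub_pos.2 ht1
  have q₁ := mul_nonneg ht0.le p₁.1
  have q₂ := mul_nonneg ht1'.le p₂.1
  have r₁ : ψ₁ (star y * y) = 0 := by
    refine Complex.ext ?_ p₁.2.symm
    exact (mul_eq_zero.1 (by linarith : t * (ψ₁ (star y * y)).re = 0)).resolve_left ht0.ne'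
  have r₂ : ψ₂ (star y * y) = 0 := by
    refine Complex.ext ?_ p₂.2.symm
    exact (mul_eq_zero.1 (by linarith : (1 - t) * (ψ₂ (star y * y)).re = 0)).resolve_left ht1'.ne'
  have fin : ∀ φ : (H →L[ℂ] H) → ℂ, IsStateOn (A : Set (H →L[ℂ] H)) φ →
      φ (star y * y) = 0 → φ x = ψ x := by
    intro φ h hφ
    have := (h.cross_terms_eq_zero hy (one_mem A) hφ).1
    rw [star_one, one_mul, hydef, h.map_sub hx (A.smul_mem (one_mem A) _),
      h.map_smul _ (one_mem A), h.map_one, mul_one] at this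
    exact sub_eq_zero.1 this
  exact ⟨fin _ h₁ r₁, fin _ h₂ r₂⟩

theorem IsStateOn.exists_projection_conj_le {A : StarSubalgebra ℂ (H →L[ℂ] H)}
    {ψ : (H →L[ℂ] H) → ℂ} (h : IsStateOn (A : Set (H →L[ℂ] H)) ψ)
    (hA : ContainsBicommutants A) (hmul : ∀ a ∈ A, ∀ b ∈ A, ψ (a * b) = ψ a * ψ b)
    {x : H →L[ℂ] H} (hx : IsSelfAdjoint x) {t : ℝ} (ht : upperValue A ψ x < t) :
    ∃ q ∈ A, IsStarProjection q ∧ ψ q = 1 ∧ q * x * q ≤ t • q := by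
  obtain ⟨a, ha, hxa, hlt⟩ := exists_lt_of_upperValue_lt hx ht
  have has : IsSelfAdjoint a := by
    simpa using (IsSelfAdjoint.of_nonneg (sub_nonneg.2 hxa)).add hx
  have htm := algebraMap_real_mem A t
  have hbs : IsSelfAdjoint (algebraMap ℝ (H →L[ℂ] H) t - a) :=
    (IsSelfAdjoint.algebraMap _ (.all t)).sub has
  obtain ⟨q, hq, hqp, hpos, hneg, hqb, hnn⟩ :=
    exists_isStarProjection_mul_nonneg hA (sub_mem htm ha) hbs
  set b := algebraMap ℝ (H →L[ℂ] H) t - a with hb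
  refine ⟨q, hq, hqp, ?_, ?_⟩
  · have h1 : ψ b = ψ (b⁺) - ψ (b⁻) := by
      rw [← h.map_sub hpos hneg, CFC.posPart_sub_negPart b hbs]
    have h2 : ψ b = t - ψ a := by rw [hb, h.map_sub htm ha, h.map_real_smul_one]
    have h3 := (Complex.nonneg_iff.1 (h.nonneg_of_nonneg hA hneg (CFC.negPart_nonneg b))).1
    have h4 := congrArg Complex.re (h1.symm.trans h2)
    simp only [Complex.sub_re, Complex.ofReal_re] at h4
    have h5 : ψ (b⁺) ≠ 0 := fun h0 => by
      rw [h0, Complex.zero_re] at h4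
      linarith
    have h6 := hmul q hq _ hpos
    rw [hqb] at h6
    exact (mul_eq_right₀ h5).1 h6.symm
  · refine (hqp.isSelfAdjoint.conjugate_le_conjugate hxa).trans (sub_nonneg.1 ?_)
    have h1 : q * b * q = t • q - q * a * q := by
      rw [hb, Algebra.algebraMap_eq_smul_one, mul_sub, sub_mul, mul_smul_comm, mul_one,
        smul_mul_assoc, hqp.isIdempotentElem.eq]
    rwa [← h1]

theorem conj_mul_le {p q x : H →L[ℂ] H} (hp : IsSelfAdjoint p)
    (hpp : IsIdempotentElem p) (hpq : p * q = q * p) {t : ℝ} (h : q * x * q ≤ t • q) :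
    p * q * x * (p * q) ≤ t • (p * q) := by
  have h1 := hp.conjugate_le_conjugate h
  have h2 : p * (q * x * q) * p = p * q * x * (p * q) := by
    rw [hpq]
    simp only [mul_assoc]
    rw [← mul_assoc p q, hpq, mul_assoc]
  have h3 : p * (t • q) * p = t • (p * q) := by
    rw [mul_smul_comm, smul_mul_assoc, mul_assoc, ← hpq, ← mul_assoc, hpp.eq]
  rwa [h2, h3] at h1

theorem IsStateOn.exists_projection_forall_conj_le {A : StarSubalgebra ℂ (H →L[ℂ] H)}
    {ψ : (H →L[ℂ] H) → ℂ} (h : IsStateOn (A : Set (H →L[ℂ] H)) ψ)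
    (hA : ContainsBicommutants A) (hcomm : ∀ a ∈ A, ∀ b ∈ A, a * b = b * a)
    (hmul : ∀ a ∈ A, ∀ b ∈ A, ψ (a * b) = ψ a * ψ b) (l : List ((H →L[ℂ] H) × ℝ))
    (hl : ∀ r ∈ l, IsSelfAdjoint r.1 ∧ upperValue A ψ r.1 < r.2) :
    ∃ q ∈ A, IsStarProjection q ∧ ψ q = 1 ∧ ∀ r ∈ l, q * r.1 * q ≤ r.2 • q := by
  induction l with
  | nil => exact ⟨1, one_mem A, .one _, h.map_one, by simp⟩
  | cons r l ih =>
    obtain ⟨q, hq, hqp, hq1, hql⟩ := ih fun s hs => hl s (List.mem_cons_of_mem _ hs)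
    obtain ⟨hrs, hrt⟩ := hl r List.mem_cons_self
    obtain ⟨p, hp, hpp, hp1, hpl⟩ := h.exists_projection_conj_le hA hmul hrs hrt
    have hpq := hcomm p hp q hq
    refine ⟨p * q, mul_mem hp hq, hpp.mul hqp hpq, by rw [hmul p hp q hq, hp1, hq1, mul_one], ?_⟩
    intro s hs
    rcases List.mem_cons.1 hs with rfl | hs
    · rw [hpq]
      exact conj_mul_le hqp.isSelfAdjoint hqp.isIdempotentElem hpq.symm hpl
    · exact conj_mul_le hpp.isSelfAdjoint hpp.isIdempotentElem hpq (hql s hs)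

/-- A finite family of projections in a commutative algebra is dominated by the sum of an
orthogonal family of projections, each of which lies below a member of the given family. -/
theorem exists_orthogonal_refinement_s6 {A : StarSubalgebra ℂ (H →L[ℂ] H)}
    (hcomm : ∀ a ∈ A, ∀ b ∈ A, a * b = b * a) {P : (H →L[ℂ] H) → Prop}
    (hP : ∀ p ∈ A, IsStarProjection p → ∀ q ∈ A, IsStarProjection q → P q → P (p * q))
    {ι : Type*} (q : ι → H →L[ℂ] H) (hq : ∀ i, q i ∈ A) (hqp : ∀ i, IsStarProjection (q i))
    (hPq : ∀ i, P (q i)) (s : Finset ι) :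
    ∃ (n : ℕ) (r : Fin n → (H →L[ℂ] H)), (∀ k, r k ∈ A) ∧ (∀ k, IsStarProjection (r k)) ∧
      (∀ k l, k ≠ l → r k * r l = 0) ∧ (∀ k, P (r k)) ∧ IsStarProjection (∑ k, r k) ∧
      ∀ i ∈ s, (∑ k, r k) * q i = q i := by
  classical
  induction s using Finset.induction_on with
  | empty => exact ⟨0, Fin.elim0, by simp, by simp, by simp, by simp, by simp, by simp⟩
  | insert i s _ ih =>
    obtain ⟨n, r, hr, hrp, horth, hPr, hsum, hdom⟩ := ih
    set p := ∑ k, r k with hpdef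
    have hp : p ∈ A := sum_mem fun k _ => hr k
    have hp' : 1 - p ∈ A := sub_mem (one_mem A) hp
    have hpr : ∀ k, p * r k = r k := by
      intro k
      rw [hpdef, Finset.sum_mul, Finset.sum_eq_single k (fun l _ hl => horth l k hl) (by simp),
        (hrp k).isIdempotentElem.eq]
    have hpq := hcomm _ hp' _ (hq i)
    have h1 : ∀ k, (1 - p) * q i * r k = 0 := by
      intro k
      rw [hpq, mul_assoc, sub_mul, one_mul, hpr, sub_self, mul_zero]
    have hm := mul_mem hp' (hq i)
    have hmp : IsStarProjection ((1 - p) * q i) := hsum.one_sub.mul (hqp i) hpq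
    have hs : ∑ k, (Fin.cons ((1 - p) * q i) r : Fin (n + 1) → H →L[ℂ] H) k =
        (1 - p) * q i + p := by rw [Fin.sum_cons]
    refine ⟨n + 1, Fin.cons ((1 - p) * q i) r, ?_, ?_, ?_, ?_, ?_, ?_⟩
    · exact Fin.cases hm hr
    · exact Fin.cases hmp hrp
    · refine Fin.cases (Fin.cases (by simp) fun l _ => ?_) fun k => Fin.cases (fun _ => ?_) ?_
      · simpa using h1 l
      · simpa using (hcomm _ (hr k) _ hm).trans (h1 k)
      · intro l hkl
        simpa using horth k l fun hkl' => hkl (congrArg Fin.succ hkl')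
    · exact Fin.cases (hP _ hp' hsum.one_sub _ (hq i) (hqp i) (hPq i)) hPr
    · have h2 : (1 - p) * q i + p = 1 - (1 - p) * (1 - q i) := by
        rw [mul_sub, mul_one]
        abel
      rw [hs, h2]
      exact (hsum.one_sub.mul (hqp i).one_sub
        (hcomm _ hp' _ (sub_mem (one_mem A) (hq i)))).one_sub
    · intro j hj
      rw [hs, add_mul]
      rcases Finset.mem_insert.1 hj with rfl | hj
      · rw [mul_assoc, (hqp j).isIdempotentElem.eq, sub_mul, one_mul, sub_add_cancel]
      · rw [hpq, mul_assoc, sub_mul, one_mul, hdom j hj, sub_self, mul_zero, zero_add]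

theorem exists_orthogonal_partition {A : StarSubalgebra ℂ (H →L[ℂ] H)}
    [IsClosed (A : Set (H →L[ℂ] H))] (hcomm : ∀ a ∈ A, ∀ b ∈ A, a * b = b * a)
    {P : (H →L[ℂ] H) → Prop}
    (hP : ∀ p ∈ A, IsStarProjection p → ∀ q ∈ A, IsStarProjection q → P q → P (p * q))
    (hlocal : ∀ χ : WeakDual.characterSpace ℂ A,
      ∃ q ∈ A, IsStarProjection q ∧ extendByZero A χ q = 1 ∧ P q) :
    ∃ (n : ℕ) (r : Fin n → (H →L[ℂ] H)), (∀ k, r k ∈ A) ∧ (∀ k, IsStarProjection (r k)) ∧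
      (∀ k l, k ≠ l → r k * r l = 0) ∧ (∀ k, P (r k)) ∧ ∑ k, r k = 1 := by
  choose q hq hqp hq1 hPq using hlocal
  let U : WeakDual.characterSpace ℂ A → Set (WeakDual.characterSpace ℂ A) :=
    fun χ => {f | f ⟨q χ, hq χ⟩ ≠ 0}
  have hU : ∀ χ, U χ ∈ nhds χ := by
    intro χ
    have hc : Continuous fun f : WeakDual.characterSpace ℂ A => f ⟨q χ, hq χ⟩ :=
      (WeakDual.eval_continuous _).comp continuous_subtype_val
    refine (isOpen_ne_fun hc continuous_const).mem_nhds ?_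
    have := hq1 χ
    rw [extendByZero_apply _ (hq χ)] at this
    change χ ⟨q χ, hq χ⟩ ≠ 0
    rw [this]
    exact one_ne_zero
  obtain ⟨s, hs⟩ := CompactSpace.elim_nhds_subcover U hU
  obtain ⟨n, r, hr, hrp, horth, hPr, hsum, hdom⟩ :=
    exists_orthogonal_refinement_s6 hcomm hP q hq hqp hPq s
  refine ⟨n, r, hr, hrp, horth, hPr, ?_⟩
  set p := ∑ k, r k with hpdef
  have hp : p ∈ A := sum_mem fun k _ => hr k
  by_contra hne
  have hnu : ¬IsUnit (⟨p, hp⟩ : A) := by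
    intro hu
    have h1 : (⟨p, hp⟩ : A) * ⟨p, hp⟩ = ⟨p, hp⟩ := Subtype.ext hsum.isIdempotentElem.eq
    exact hne (congrArg Subtype.val (hu.mul_eq_left.1 h1))
  obtain ⟨f, hf⟩ := exists_character_apply_eq_zero
    (fun a b : A => Subtype.ext (hcomm a a.2 b b.2)) hnu
  have hfU : f ∈ ⋃ χ ∈ s, U χ := by rw [hs]; trivial
  obtain ⟨χ, hχ, hfχ⟩ := Set.mem_iUnion₂.1 hfU
  have h1 : (⟨p, hp⟩ : A) * ⟨q χ, hq χ⟩ = ⟨q χ, hq χ⟩ := Subtype.ext (hdom χ hχ)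
  refine hfχ ?_
  rw [← h1, map_mul, hf, zero_mul]

theorem norm_sum_conj_sub_le {n : ℕ} {q : Fin n → (H →L[ℂ] H)}
    (hqp : ∀ k, IsStarProjection (q k)) (hsum : ∑ k, q k = 1) {x : H →L[ℂ] H}
    (hx : IsSelfAdjoint x) {ε : ℝ} (hε : 0 ≤ ε) (l : Fin n → ℝ)
    (h₁ : ∀ k, q k * x * q k ≤ (l k + ε) • q k) (h₂ : ∀ k, q k * -x * q k ≤ (-l k + ε) • q k) :
    ‖∑ k, q k * x * q k - ∑ k, l k • q k‖ ≤ ε := by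
  have hs : ∀ k, IsSelfAdjoint (q k * x * q k) := fun k => by
    have := hx.conjugate (q k)
    rwa [(hqp k).isSelfAdjoint.star_eq] at this
  have hone : algebraMap ℝ (H →L[ℂ] H) ε = ∑ k, ε • q k := by
    rw [← Finset.smul_sum, hsum, Algebra.algebraMap_eq_smul_one]
  refine norm_le_of_self_adjoint_bounds ?_ ?_ ?_ hε
  · exact (isSelfAdjoint_sum _ fun k _ => hs k).sub
      (isSelfAdjoint_sum _ fun k _ => IsSelfAdjoint.smul (.all _) (hqp k).isSelfAdjoint)
  · rw [hone, ← Finset.sum_sub_distrib]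
    refine Finset.sum_le_sum fun k _ => ?_
    rw [sub_le_iff_le_add', ← add_smul]
    exact h₁ k
  · rw [hone, ← Finset.sum_sub_distrib, ← Finset.sum_neg_distrib]
    refine Finset.sum_le_sum fun k _ => ?_
    have := sub_nonneg.2 (h₂ k)
    rw [add_smul, neg_smul, mul_neg, neg_mul] at this
    rw [neg_sub, ← sub_nonneg]
    convert this using 1
    abel

/-- Uniqueness of extensions of pure states forces the upper and lower values to agree. -/
theorem upperValue_neg_of_unique {A S : StarSubalgebra ℂ (H →L[ℂ] H)}
    (hA : ContainsBicommutants A) {ψ : (H →L[ℂ] H) → ℂ}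
    (h : IsStateOn (A : Set (H →L[ℂ] H)) ψ)
    (huniq : ∀ φ₁ φ₂ : (H →L[ℂ] H) → ℂ, IsStateOn (S : Set (H →L[ℂ] H)) φ₁ →
      IsStateOn (S : Set (H →L[ℂ] H)) φ₂ → (∀ a ∈ A, φ₁ a = ψ a) → (∀ a ∈ A, φ₂ a = ψ a) →
      ∀ x ∈ S, φ₁ x = φ₂ x) {x : H →L[ℂ] H} (hxS : x ∈ S) (hx : IsSelfAdjoint x) :
    upperValue A ψ (-x) = -upperValue A ψ x := by
  obtain ⟨φ₁, h₁, he₁, hv₁⟩ := h.exists_extension hA hx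
  obtain ⟨φ₂, h₂, he₂, hv₂⟩ := h.exists_extension hA hx.neg
  have := huniq φ₁ φ₂ (h₁.mono le_top) (h₂.mono le_top) he₁ he₂ x hxS
  rw [h₂.map_neg (x := x) trivial, ← this, hv₁] at hv₂
  exact_mod_cast hv₂.symm

theorem paving_of_unique {A S : StarSubalgebra ℂ (H →L[ℂ] H)} [IsClosed (A : Set (H →L[ℂ] H))]
    (hA : ContainsBicommutants A) (hcomm : ∀ a ∈ A, ∀ b ∈ A, a * b = b * a)
    (huniq : ∀ ψ : (H →L[ℂ] H) → ℂ, IsPureStateOn (A : Set (H →L[ℂ] H)) ψ →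
      ∀ φ₁ φ₂ : (H →L[ℂ] H) → ℂ, IsStateOn (S : Set (H →L[ℂ] H)) φ₁ →
      IsStateOn (S : Set (H →L[ℂ] H)) φ₂ → (∀ a ∈ A, φ₁ a = ψ a) → (∀ a ∈ A, φ₂ a = ψ a) →
      ∀ x ∈ S, φ₁ x = φ₂ x) {x : H →L[ℂ] H} (hx : x ∈ S) {ε : ℝ} (hε : 0 < ε) :
    ∃ (n : ℕ) (q : Fin n → (H →L[ℂ] H)),
      (∀ k, q k ∈ A) ∧ (∀ k, IsStarProjection (q k)) ∧ (∀ k l, k ≠ l → q k * q l = 0) ∧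
      (∑ k, q k = 1) ∧ Metric.infDist (∑ k, q k * x * q k) (A : Set (H →L[ℂ] H)) ≤ ε := by
  have hre : (ℜ x : H →L[ℂ] H) ∈ S := by
    rw [realPart_apply_coe, ← Complex.coe_smul]
    exact S.smul_mem (add_mem hx (star_mem hx)) _
  have him : (ℑ x : H →L[ℂ] H) ∈ S := by
    rw [imaginaryPart_apply_coe, ← Complex.coe_smul]
    exact S.smul_mem (S.smul_mem (sub_mem hx (star_mem hx)) _) _
  have hε2 := half_pos hε
  obtain ⟨n, q, hq, hqp, horth, hPq, hsum⟩ := exists_orthogonal_partition hcomm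
    (P := fun q => ∃ c d : ℝ, ∀ r ∈ [((ℜ x : H →L[ℂ] H), c + ε / 2),
      (-(ℜ x : H →L[ℂ] H), -c + ε / 2), ((ℑ x : H →L[ℂ] H), d + ε / 2), (-(ℑ x : H →L[ℂ] H), -d + ε / 2)],
      q * r.1 * q ≤ r.2 • q)
    (fun p hp hpp q hq hqp ⟨c, d, hcd⟩ => ⟨c, d, fun r hr =>
      conj_mul_le hpp.isSelfAdjoint hpp.isIdempotentElem (hcomm p hp q hq) (hcd r hr)⟩)
    (fun χ => by
      have hpure := isPureStateOn_character χ
      have hmul : ∀ a ∈ A, ∀ b ∈ A,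
          extendByZero A χ (a * b) = extendByZero A χ a * extendByZero A χ b := by
        intro a ha b hb
        rw [extendByZero_apply _ ha, extendByZero_apply _ hb,
          extendByZero_apply _ (mul_mem ha hb), ← map_mul]
        rfl
      obtain ⟨q, hq, hqp, hq1, hql⟩ := hpure.1.exists_projection_forall_conj_le hA hcomm hmul
        [((ℜ x : H →L[ℂ] H), upperValue A (extendByZero A χ) (ℜ x : H →L[ℂ] H) + ε / 2),
          (-(ℜ x : H →L[ℂ] H), -upperValue A (extendByZero A χ) (ℜ x : H →L[ℂ] H) + ε / 2),
          ((ℑ x : H →L[ℂ] H), upperValue A (extendByZero A χ) (ℑ x : H →L[ℂ] H) + ε / 2),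
          (-(ℑ x : H →L[ℂ] H), -upperValue A (extendByZero A χ) (ℑ x : H →L[ℂ] H) + ε / 2)] (by
        simp only [List.forall_mem_cons, List.not_mem_nil, false_imp_iff, forall_const,
          and_true]
        refine ⟨⟨(ℜ x).2, by linarith⟩, ⟨(ℜ x).2.neg, ?_⟩, ⟨(ℑ x).2, by linarith⟩,
          ⟨(ℑ x).2.neg, ?_⟩⟩
        · rw [upperValue_neg_of_unique hA hpure.1 (huniq _ hpure) hre (ℜ x).2]
          linarith
        · rw [upperValue_neg_of_unique hA hpure.1 (huniq _ hpure) him (ℑ x).2]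
          linarith)
      exact ⟨q, hq, hqp, hq1, _, _, hql⟩)
  choose c d hcd using hPq
  simp only [List.forall_mem_cons, List.not_mem_nil, false_imp_iff, forall_const, and_true] at hcd
  refine ⟨n, q, hq, hqp, horth, hsum, ?_⟩
  have hca : ∀ (l : Fin n → ℝ), ∑ k, l k • q k ∈ A := fun l =>
    sum_mem fun k _ => by rw [← Complex.coe_smul]; exact A.smul_mem (hq k) _
  refine (Metric.infDist_le_dist_of_mem
    (add_mem (hca c) (A.smul_mem (hca d) Complex.I))).trans ?_
  have e₁ := norm_sum_conj_sub_le hqp hsum (ℜ x).2 hε2.le c (fun k => (hcd k).1)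
    fun k => (hcd k).2.1
  have e₂ := norm_sum_conj_sub_le hqp hsum (ℑ x).2 hε2.le d (fun k => (hcd k).2.2.1)
    fun k => (hcd k).2.2.2
  have hdec : ∑ k, q k * x * q k = ∑ k, q k * (ℜ x : H →L[ℂ] H) * q k +
      Complex.I • ∑ k, q k * (ℑ x : H →L[ℂ] H) * q k := by
    rw [Finset.smul_sum, ← Finset.sum_add_distrib]
    refine Finset.sum_congr rfl fun k _ => ?_
    conv_lhs => rw [← realPart_add_I_smul_imaginaryPart x]
    rw [mul_add, add_mul, mul_smul_comm, smul_mul_assoc]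
  rw [hdec, dist_eq_norm, add_sub_add_comm, ← smul_sub]
  refine (norm_add_le _ _).trans ?_
  rw [norm_smul, Complex.norm_I, one_mul]
  linarith

end Paving

/-- The Kadison–Singer property (unique state extension of pure states from the MASA `A` to
`M`) is equivalent to the paving property. -/
theorem stmt_6 {H : Type*} [NormedAddCommGroup H] [InnerProductSpace ℂ H] [CompleteSpace H]
    (M : VonNeumannAlgebra H) (A : StarSubalgebra ℂ (H →L[ℂ] H))
    (hMASA : ∀ y : H →L[ℂ] H, y ∈ A ↔ (y ∈ M ∧ ∀ a ∈ A, a * y = y * a)) :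
    (∀ ψ : (H →L[ℂ] H) → ℂ, IsPureStateOn (A : Set (H →L[ℂ] H)) ψ →
      (∃ φ : (H →L[ℂ] H) → ℂ, IsStateOn (M : Set (H →L[ℂ] H)) φ ∧ ∀ a ∈ A, φ a = ψ a) ∧
      (∀ φ₁ φ₂ : (H →L[ℂ] H) → ℂ,
        IsStateOn (M : Set (H →L[ℂ] H)) φ₁ → IsStateOn (M : Set (H →L[ℂ] H)) φ₂ →
        (∀ a ∈ A, φ₁ a = ψ a) → (∀ a ∈ A, φ₂ a = ψ a) → ∀ x ∈ M, φ₁ x = φ₂ x)) ↔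
    (∀ x ∈ M, ∀ ε > (0 : ℝ), ∃ (n : ℕ) (q : Fin n → (H →L[ℂ] H)),
      (∀ k, q k ∈ A) ∧ (∀ k, star (q k) = q k) ∧ (∀ k, q k * q k = q k) ∧
      (∀ k l, k ≠ l → q k * q l = 0) ∧ (∑ k, q k = 1) ∧
      Metric.infDist (∑ k, q k * x * q k) (A : Set (H →L[ℂ] H)) ≤ ε) := by
  have hA := containsBicommutants_of_masa hMASA
  have hAM : A ≤ M.toStarSubalgebra := fun a ha => ((hMASA a).1 ha).1
  have hcomm : ∀ a ∈ A, ∀ b ∈ A, a * b = b * a := fun a ha b hb => ((hMASA b).1 hb).2 a ha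
  have : IsClosed (A : Set (H →L[ℂ] H)) := isClosed_of_masa hMASA
  constructor
  · intro hKS x hx ε hε
    obtain ⟨n, q, hq, hqp, horth, hsum, hdist⟩ := paving_of_unique (S := M.toStarSubalgebra) hA
      hcomm (fun ψ hψ => (hKS ψ hψ).2) hx hε
    exact ⟨n, q, hq, fun k => (hqp k).isSelfAdjoint, fun k => (hqp k).isIdempotentElem, horth,
      hsum, hdist⟩
  · intro hpave ψ hψ
    constructor
    · obtain ⟨φ, hφ, he, -⟩ := hψ.1.exists_extension hA (.zero _)
      exact ⟨φ, hφ.mono (T := M.toStarSubalgebra) le_top, he⟩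
    · intro φ₁ φ₂ h₁ h₂ he₁ he₂ x hx
      refine hψ.eq_of_paving hAM hcomm h₁ h₂ he₁ he₂ hx fun ε hε => ?_
      obtain ⟨n, q, hq, hqs, hqi, -, hsum, hdist⟩ := hpave x hx ε hε
      exact ⟨n, q, hq, fun k => ⟨hqi k, hqs k⟩, hsum, hdist⟩
end

section
/- Let ε > 0 and n ≥ 1. Suppose that for every k ≥ 1 and every matrix x ∈ M_k(ℂ) with zero diagonal (x_{ii} = 0 for all i) there exists a partition of {0, …, k−1} into n sets S₁, …, S_n such that ‖Σ_{j=1}^n p_{S_j} x p_{S_j}‖ ≤ ε‖x‖. Then for every bounded linear operator T on ℓ²(ℕ) with zero diagonal (⟨T e_i, e_i⟩ = 0 for all i ∈ ℕ) there exists a partition of ℕ into n sets Y₁, …, Y_n such that ‖Σ_{j=1}^n P_{Y_j} T P_{Y_j}‖ ≤ ε‖T‖. -/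
open Filter Topology

section Compression

variable {E : Type*} [NormedAddCommGroup E] [InnerProductSpace ℂ E]

/-- The matrix of the sesquilinear form of `A` on a family of vectors. -/
noncomputable def compressionMatrix {ι : Type*} (e : ι → E) (A : E →L[ℂ] E) : Matrix ι ι ℂ :=
  Matrix.of fun a b => inner ℂ (e a) (A (e b))

theorem inner_compressionMatrix {ι : Type*} [Fintype ι] [DecidableEq ι] (e : ι → E)
    (A : E →L[ℂ] E) (u v : EuclideanSpace ℂ ι) :
    inner ℂ u (Matrix.toEuclideanCLM (𝕜 := ℂ) (compressionMatrix e A) v) =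
      inner ℂ (∑ i, u i • e i) (A (∑ i, v i • e i)) := by
  simp only [PiLp.inner_apply, Matrix.ofLp_toEuclideanCLM, Matrix.mulVec, dotProduct,
    compressionMatrix, Matrix.of_apply, map_sum, map_smul, sum_inner, inner_sum, inner_smul_left,
    inner_smul_right, RCLike.inner_apply, Finset.sum_mul, Finset.mul_sum]
  rw [Finset.sum_comm]
  refine Finset.sum_congr rfl fun i _ => Finset.sum_congr rfl fun j _ => ?_
  ring

theorem Orthonormal.norm_sum_smul {ι : Type*} [Fintype ι] {e : ι → E}
    (he : Orthonormal ℂ e) (u : EuclideanSpace ℂ ι) : ‖∑ i, u i • e i‖ = ‖u‖ := by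
  rw [@norm_eq_sqrt_re_inner ℂ, @norm_eq_sqrt_re_inner ℂ _ _ _ _ u, he.inner_sum, PiLp.inner_apply]
  simp only [RCLike.inner_apply, mul_comm]

theorem norm_compressionMatrix_le {ι : Type*} [Fintype ι] [DecidableEq ι] {e : ι → E}
    (he : Orthonormal ℂ e) (A : E →L[ℂ] E) :
    ‖Matrix.toEuclideanCLM (𝕜 := ℂ) (compressionMatrix e A)‖ ≤ ‖A‖ := by
  refine ContinuousLinearMap.opNorm_le_of_re_inner_le (𝕜 := ℂ) (norm_nonneg A) fun x y hx hy => ?_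
  rw [← inner_conj_symm, RCLike.conj_re, inner_compressionMatrix]
  refine (RCLike.re_le_norm _).trans ((norm_inner_le_norm _ _).trans ?_)
  rw [he.norm_sum_smul, hy, one_mul]
  refine (A.le_opNorm _).trans ?_
  rw [he.norm_sum_smul, hx, mul_one]

theorem norm_le_of_norm_compressionMatrix_le (b : HilbertBasis ℕ ℂ E) (A : E →L[ℂ] E) {C : ℝ}
    (hC : 0 ≤ C)
    (h : ∀ K : ℕ, ‖Matrix.toEuclideanCLM (𝕜 := ℂ)
      (compressionMatrix (fun i : Fin K => b i) A)‖ ≤ C) : ‖A‖ ≤ C := by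
  have lim (f : E) : Tendsto (fun K : ℕ => ∑ i : Fin K, b.repr f i • b i) atTop (𝓝 f) := by
    simpa only [Fin.sum_univ_eq_sum_range (fun i => b.repr f i • b i)] using
      (b.hasSum_repr f).tendsto_sum_nat
  refine ContinuousLinearMap.opNorm_le_of_re_inner_le (𝕜 := ℂ) hC fun x y hx hy => ?_
  rw [← inner_conj_symm, RCLike.conj_re]
  refine (RCLike.re_le_norm _).trans ?_
  have h₁ := ((lim y).inner (𝕜 := ℂ) ((A.continuous.tendsto x).comp (lim x))).norm
  have h₂ := ((lim y).norm.mul (lim x).norm).const_mul C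
  rw [hx, hy, mul_one, mul_one] at h₂
  refine le_of_tendsto_of_tendsto' h₁ h₂ fun K => ?_
  have he : Orthonormal ℂ fun i : Fin K => b i := b.orthonormal.comp _ Fin.val_injective
  set u : EuclideanSpace ℂ (Fin K) := WithLp.toLp 2 fun i => b.repr y i
  set v : EuclideanSpace ℂ (Fin K) := WithLp.toLp 2 fun i => b.repr x i
  have hu := he.norm_sum_smul u
  have hv := he.norm_sum_smul v
  have huv := inner_compressionMatrix (fun i : Fin K => b i) A u v
  simp only [u, v] at hu hv huv
  simp only [Function.comp_apply]
  rw [hu, hv, ← huv]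
  refine (norm_inner_le_norm _ _).trans ?_
  rw [mul_left_comm]
  gcongr
  exact ContinuousLinearMap.le_of_opNorm_le _ (h K) _

end Compression

theorem Matrix.norm_toEuclideanCLM_submatrix_le {ι κ : Type*} [Fintype ι] [DecidableEq ι]
    [Fintype κ] [DecidableEq κ] {f : κ → ι} (hf : Function.Injective f) (x : Matrix ι ι ℂ) :
    ‖Matrix.toEuclideanCLM (𝕜 := ℂ) (x.submatrix f f)‖ ≤ ‖Matrix.toEuclideanCLM (𝕜 := ℂ) x‖ := by
  convert norm_compressionMatrix_le ((EuclideanSpace.basisFun ι ℂ).orthonormal.comp f hf)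
    (Matrix.toEuclideanCLM (𝕜 := ℂ) x)
  ext a b
  simp [compressionMatrix, EuclideanSpace.inner_single_left]

theorem Matrix.sum_diagonal_mul_mul_diagonal_apply {ι κ : Type*} [Fintype ι] [DecidableEq ι]
    [Fintype κ] [DecidableEq κ] (c : ι → κ) (x : Matrix ι ι ℂ) (a b : ι) :
    (∑ j : κ, (Matrix.diagonal fun i => if c i = j then (1 : ℂ) else 0) * x *
      (Matrix.diagonal fun i => if c i = j then (1 : ℂ) else 0)) a b =
      if c a = c b then x a b else 0 := by
  simp [Matrix.sum_apply, Matrix.mul_diagonal, Matrix.diagonal_mul]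

/-- Multiplication by the indicator function of `s` on `ℓ²(ℕ)`. -/
noncomputable def lpIndicator (s : Set ℕ) :
    lp (fun _ : ℕ => ℂ) 2 →L[ℂ] lp (fun _ : ℕ => ℂ) 2 :=
  LinearMap.mkContinuous
    { toFun := fun f => ⟨s.indicator f, (lp.memℓp f).mono' fun i => norm_indicator_le_norm_self _ _⟩
      map_add' := fun f g => lp.ext (Set.indicator_add' s f g)
      map_smul' := fun r f => lp.ext (Set.indicator_const_smul s r f) }
    1 fun f => by
      rw [one_mul]
      exact lp.norm_mono two_ne_zero fun i => norm_indicator_le_norm_self _ _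

theorem lpIndicator_apply (s : Set ℕ) (f : lp (fun _ : ℕ => ℂ) 2) (i : ℕ) :
    lpIndicator s f i = s.indicator f i := rfl

theorem lpIndicator_single (s : Set ℕ) [DecidablePred (· ∈ s)] (i : ℕ) :
    lpIndicator s (lp.single 2 i (1 : ℂ)) = if i ∈ s then lp.single 2 i (1 : ℂ) else 0 := by
  ext k
  rw [lpIndicator_apply]
  by_cases hk : k = i
  · subst hk
    by_cases hs : k ∈ s <;> simp [hs]
  · by_cases hs : i ∈ s <;> simp [hs, Set.indicator_apply, hk]

/-- A sequence of colourings has a pointwise cluster point with finitely many colours. -/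
theorem exists_coloring_frequently_eq {κ : Type*} [Finite κ] (d : ℕ → ℕ → κ) :
    ∃ c : ℕ → κ, ∀ K : ℕ, ∃ k ≥ K, 1 ≤ k ∧ ∀ i < K, d k i = c i := by
  have h (i : ℕ) : ∃ j, ∀ᶠ k in (hyperfilter ℕ : Filter ℕ), d k i = j :=
    Ultrafilter.eventually_exists_iff.1 (Eventually.of_forall fun k => ⟨d k i, rfl⟩)
  choose c hc using h
  refine ⟨c, fun K => ?_⟩
  have hK : ∀ᶠ k in (hyperfilter ℕ : Filter ℕ), K ≤ k ∧ 1 ≤ k :=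
    Nat.hyperfilter_le_atTop ((eventually_ge_atTop K).and (eventually_ge_atTop 1))
  have hall : ∀ᶠ k in (hyperfilter ℕ : Filter ℕ), ∀ i ∈ Set.Iio K, d k i = c i :=
    (eventually_all_finite (Set.finite_Iio K)).2 fun i _ => hc i
  obtain ⟨k, ⟨h₁, h₂⟩, h₃⟩ := (hK.and hall).exists
  exact ⟨k, h₁, h₂, h₃⟩


/-- If, for some `n` and `ε > 0`, every finite matrix with zero diagonal can be paved by `n`
diagonal projections with norm reduction factor `ε`, then every bounded operator on `ℓ²(ℕ)`
with zero diagonal can be paved by `n` diagonal projections with the same factor `ε`. -/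
theorem stmt_7 (ε : ℝ) (hε : 0 < ε) (n : ℕ) (hn : 1 ≤ n)
    (hfin : ∀ k : ℕ, 1 ≤ k → ∀ x : Matrix (Fin k) (Fin k) ℂ, (∀ i, x i i = 0) →
      ∃ c : Fin k → Fin n,
        ‖Matrix.toEuclideanCLM (𝕜 := ℂ) (∑ j : Fin n,
            (Matrix.diagonal fun i => if c i = j then (1 : ℂ) else 0) * x *
            (Matrix.diagonal fun i => if c i = j then (1 : ℂ) else 0))‖ ≤
          ε * ‖Matrix.toEuclideanCLM (𝕜 := ℂ) x‖) :
    ∀ T : lp (fun _ : ℕ => ℂ) 2 →L[ℂ] lp (fun _ : ℕ => ℂ) 2,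
      (∀ i : ℕ, @inner ℂ _ _ (T (lp.single 2 i (1 : ℂ))) (lp.single 2 i (1 : ℂ)) = 0) →
      ∃ (c : ℕ → Fin n) (P : Fin n → (lp (fun _ : ℕ => ℂ) 2 →L[ℂ] lp (fun _ : ℕ => ℂ) 2)),
        (∀ (j : Fin n) (f : lp (fun _ : ℕ => ℂ) 2) (i : ℕ),
          (P j f) i = if c i = j then f i else 0) ∧
        ‖∑ j : Fin n, P j * T * P j‖ ≤ ε * ‖T‖ := by
  intro T hT
  set e : ℕ → lp (fun _ : ℕ => ℂ) 2 := fun i => lp.single 2 i (1 : ℂ) with he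
  let b : HilbertBasis ℕ ℂ (lp (fun _ : ℕ => ℂ) 2) := .ofRepr (.refl ℂ _)
  have hb (i : ℕ) : b i = e i := b.repr_symm_single i |>.symm
  let x (k : ℕ) : Matrix (Fin k) (Fin k) ℂ := compressionMatrix (fun i : Fin k => b i) T
  have hx (k : ℕ) (i : Fin k) : x k i i = 0 := by
    simpa [x, compressionMatrix, hb] using inner_eq_zero_symm.1 (hT i)
  have hxT (k : ℕ) : ‖Matrix.toEuclideanCLM (𝕜 := ℂ) (x k)‖ ≤ ‖T‖ :=
    norm_compressionMatrix_le (b.orthonormal.comp _ Fin.val_injective) T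
  have hd (k : ℕ) : ∃ d : ℕ → Fin n, 1 ≤ k → ‖Matrix.toEuclideanCLM (𝕜 := ℂ) (∑ j : Fin n,
      (Matrix.diagonal fun i : Fin k => if d i = j then (1 : ℂ) else 0) * x k *
      (Matrix.diagonal fun i : Fin k => if d i = j then (1 : ℂ) else 0))‖ ≤ ε * ‖T‖ := by
    by_cases hk : 1 ≤ k
    · obtain ⟨c, hc⟩ := hfin k hk (x k) (hx k)
      refine ⟨fun i => if hi : i < k then c ⟨i, hi⟩ else ⟨0, hn⟩, fun _ => ?_⟩
      simpa using hc.trans (mul_le_mul_of_nonneg_left (hxT k) hε.le)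
    · exact ⟨fun _ => ⟨0, hn⟩, fun h => absurd h hk⟩
  choose d hd using hd
  obtain ⟨c, hc⟩ := exists_coloring_frequently_eq d
  refine ⟨c, fun j => lpIndicator {i | c i = j}, fun j f i => by
    simp [lpIndicator_apply, Set.indicator_apply], ?_⟩
  refine norm_le_of_norm_compressionMatrix_le b _ (by positivity) fun K => ?_
  obtain ⟨k, hKk, hk, hdc⟩ := hc K
  refine le_trans (le_of_eq ?_) ((Matrix.norm_toEuclideanCLM_submatrix_le
    (Fin.castLE_injective hKk) _).trans (hd k hk))
  congr 2
  ext p q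
  rw [Matrix.submatrix_apply, Matrix.sum_diagonal_mul_mul_diagonal_apply]
  simp only [Fin.val_castLE, hdc p p.2, hdc q q.2, x, compressionMatrix, Matrix.of_apply, hb, he,
    _root_.sum_apply, mul_apply_eq_comp, lpIndicator_single,
    lp.inner_single_left, Set.mem_ofPred_eq]
  rw [Finset.sum_eq_single (c q)]
  · simp [lpIndicator_apply, Set.indicator_apply]
  · intro j _ hj
    simp [hj.symm]
  · simp
end

section
/- Let E : M → M be a linear map with range contained in A such that E(a) = a for all a ∈ A and E(a y b) = a E(y) b for all a, b ∈ A and y ∈ M. Let 0 < ε < 1 and n ≥ 1, and suppose that every y ∈ M admits a finite partition of 1 in A by at most n projections p₁, …, p_n with ‖Σ_i p_i y p_i − E(y)‖ ≤ ε‖y − E(y)‖. Then every x ∈ M admits a finite partition of 1 in A by at most n² projections q₁, …, q_m with ‖Σ_j q_j x q_j − E(x)‖ ≤ ε²‖x − E(x)‖. -/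
/-- If every element of `M` can be `ε`-paved over the MASA `A` (relative to the conditional
expectation `E`) with at most `n` projections, then every element can be `ε²`-paved with at
most `n²` projections. -/
theorem stmt_8 {H : Type*} [NormedAddCommGroup H] [InnerProductSpace ℂ H] [CompleteSpace H]
    (M : VonNeumannAlgebra H) (A : StarSubalgebra ℂ (H →L[ℂ] H))
    (hMASA : ∀ y : H →L[ℂ] H, y ∈ A ↔ (y ∈ M ∧ ∀ a ∈ A, a * y = y * a))
    (E : (H →L[ℂ] H) → (H →L[ℂ] H))
    (hEadd : ∀ y ∈ M, ∀ z ∈ M, E (y + z) = E y + E z)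
    (hEsmul : ∀ (c : ℂ), ∀ y ∈ M, E (c • y) = c • E y)
    (hErange : ∀ y ∈ M, E y ∈ A)
    (hEfix : ∀ b ∈ A, E b = b)
    (hEbimod : ∀ a ∈ A, ∀ b ∈ A, ∀ y ∈ M, E (a * y * b) = a * E y * b)
    (ε : ℝ) (hε0 : 0 < ε) (hε1 : ε < 1) (n : ℕ) (hn : 1 ≤ n)
    (hpave : ∀ y ∈ M, ∃ m : ℕ, m ≤ n ∧ ∃ p : Fin m → (H →L[ℂ] H),
      (∀ i, p i ∈ A) ∧ (∀ i, star (p i) = p i) ∧ (∀ i, p i * p i = p i) ∧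
      (∀ i j, i ≠ j → p i * p j = 0) ∧ (∑ i, p i = 1) ∧
      ‖(∑ i, p i * y * p i) - E y‖ ≤ ε * ‖y - E y‖) :
    ∀ x ∈ M, ∃ m : ℕ, m ≤ n ^ 2 ∧ ∃ q : Fin m → (H →L[ℂ] H),
      (∀ i, q i ∈ A) ∧ (∀ i, star (q i) = q i) ∧ (∀ i, q i * q i = q i) ∧
      (∀ i j, i ≠ j → q i * q j = 0) ∧ (∑ i, q i = 1) ∧
      ‖(∑ i, q i * x * q i) - E x‖ ≤ ε ^ 2 * ‖x - E x‖ := by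
  intro x hx
  have hAM : ∀ a ∈ A, a ∈ M := fun a ha => ((hMASA a).1 ha).1
  have hcomm : ∀ a ∈ A, ∀ b ∈ A, a * b = b * a := fun a ha b hb => ((hMASA b).1 hb).2 a ha
  have hEsum : ∀ (k : ℕ) (f : Fin k → (H →L[ℂ] H)), (∀ i, f i ∈ M) →
      E (∑ i, f i) = ∑ i, E (f i) := by
    intro k
    induction k with
    | zero => intro f _; simpa using hEfix 0 (zero_mem A)
    | succ k ih =>
      intro f hf
      rw [Fin.sum_univ_succ, Fin.sum_univ_succ,
        hEadd _ (hf 0) _ (sum_mem fun i _ => hf i.succ), ih _ fun i => hf i.succ]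
  obtain ⟨m, hm, p, hpA, hps, hpp, hpo, hp1, hpn⟩ := hpave x hx
  have hpxp : ∀ i, p i * x * p i ∈ M := fun i =>
    mul_mem (mul_mem (hAM _ (hpA i)) hx) (hAM _ (hpA i))
  have hEy : E (∑ i, p i * x * p i) = E x := by
    rw [hEsum _ _ hpxp]
    calc ∑ i, E (p i * x * p i) = ∑ i, p i * E x := by
          refine Finset.sum_congr rfl fun i _ => ?_
          rw [hEbimod _ (hpA i) _ (hpA i) _ hx, mul_assoc,
            hcomm _ (hErange x hx) _ (hpA i), ← mul_assoc, hpp]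
      _ = E x := by rw [← Finset.sum_mul, hp1, one_mul]
  obtain ⟨l, hl, r, hrA, hrs, hrr, hro, hr1, hrn⟩ := hpave _ (sum_mem fun i _ => hpxp i)
  rw [hEy] at hrn
  have hmul : ∀ i j i' j', (r i * p j) * (r i' * p j') = (r i * r i') * (p j * p j') := by
    intro i j i' j'
    rw [mul_assoc, ← mul_assoc (p j), hcomm _ (hpA j) _ (hrA i')]
    simp only [mul_assoc]
  refine ⟨l * m, by rw [sq]; exact Nat.mul_le_mul hl hm,
    fun k => r (finProdFinEquiv.symm k).1 * p (finProdFinEquiv.symm k).2,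
    fun k => mul_mem (hrA _) (hpA _), fun k => ?_, fun k => ?_, fun k k' hk => ?_, ?_, ?_⟩
  · rw [star_mul, hps, hrs, hcomm _ (hpA _) _ (hrA _)]
  · rw [hmul, hrr, hpp]
  · rw [hmul]
    by_cases h : (finProdFinEquiv.symm k).1 = (finProdFinEquiv.symm k').1
    · rw [hpo _ _ fun h' => hk (finProdFinEquiv.symm.injective (Prod.ext h h')), mul_zero]
    · rw [hro _ _ h, zero_mul]
  · rw [Equiv.sum_comp finProdFinEquiv.symm fun ij => r ij.1 * p ij.2, Fintype.sum_prod_type]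
    simp only [← Finset.mul_sum, hp1, mul_one, hr1]
  · rw [Equiv.sum_comp finProdFinEquiv.symm fun ij => r ij.1 * p ij.2 * x * (r ij.1 * p ij.2),
      Fintype.sum_prod_type]
    have hsum : ∀ i, ∑ j, r i * p j * x * (r i * p j) = r i * (∑ j, p j * x * p j) * r i := by
      intro i
      rw [Finset.mul_sum, Finset.sum_mul]
      refine Finset.sum_congr rfl fun j _ => ?_
      nth_rewrite 2 [hcomm _ (hrA i) _ (hpA j)]
      simp only [mul_assoc]
    simp only [hsum]
    calc _ ≤ ε * ‖(∑ i, p i * x * p i) - E x‖ := hrn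
      _ ≤ ε * (ε * ‖x - E x‖) := mul_le_mul_of_nonneg_left hpn hε0.le
      _ = ε ^ 2 * ‖x - E x‖ := by ring
end
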